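/- arXiv:1406.0733 — 3 statements merged into one kernel-verified Lean document; each statement's English description precedes it below -/
import Mathlib

section
/- Let P = {x ∈ ℝⁿ | Lᵢ(x) > 0 for 1 ≤ i ≤ N} be a bounded convex polytope defined by N affine maps L₁, …, L_N : ℝⁿ → ℝ, and assume P is non-empty. Then for any pair of points x, y in P, the Hilbert distance satisfies d_P(x,y) = (1/2) · sup_{1 ≤ i, j ≤ N} log( (Lᵢ(x)/Lᵢ(y)) · (Lⱼ(y)/Lⱼ(x)) ). -/
open Set Filter MeasureTheory

noncomputable section

abbrev Euc (n : ℕ) := EuclideanSpace ℝ (Fin n)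

/-- `Ω` is a convex domain: a non-empty bounded open convex subset of `ℝⁿ`. -/
def IsConvexDomain {n : ℕ} (Ω : Set (Euc n)) : Prop :=
  Ω.Nonempty ∧ IsOpen Ω ∧ Bornology.IsBounded Ω ∧ Convex ℝ Ω

/-- `d` is the Hilbert distance of the convex domain `Ω` : for distinct `p q ∈ Ω`, if `a` and
`b` are the points where the line through `p` and `q` meets `∂Ω`, in the order `a, p, q, b`
(`a = p + s•(q-p)` with `s < 0`, `b = p + t•(q-p)` with `t > 1`), then
`d p q = ½ log [a,p,q,b]`, and `d p p = 0`. -/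
def IsHilbertDist {n : ℕ} (Ω : Set (Euc n)) (d : Euc n → Euc n → ℝ) : Prop :=
  (∀ p ∈ Ω, d p p = 0) ∧
  ∀ p ∈ Ω, ∀ q ∈ Ω, p ≠ q → ∀ a b : Euc n,
    a ∈ frontier Ω → b ∈ frontier Ω →
    (∃ s t : ℝ, s < 0 ∧ 1 < t ∧ a = p + s • (q - p) ∧ b = p + t • (q - p)) →
    d p q = (1/2) * Real.log ((‖q - a‖ / ‖p - a‖) * (‖p - b‖ / ‖q - b‖))

/-- A preconnected set that meets an open set and its complement meets the frontier. -/
theorem IsPreconnected.inter_frontier_nonempty_of_isOpen {X : Type*} [TopologicalSpace X]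
    {s u : Set X} (hs : IsPreconnected s) (hu : IsOpen u) (h : (s ∩ u).Nonempty)
    (h' : (s ∩ uᶜ).Nonempty) : (s ∩ frontier u).Nonempty := by
  by_contra hne
  have hmem : ∀ x ∈ s, x ∈ closure u → x ∈ u := fun x hx hxc => by
    by_contra hxu
    exact hne ⟨x, hx, hu.frontier_eq ▸ ⟨hxc, hxu⟩⟩
  obtain ⟨y, hy, hyu⟩ := h'
  obtain ⟨z, -, hzu, hzc⟩ := hs u (closure u)ᶜ hu isClosed_closure.isOpen_compl
    (fun x hx => (em (x ∈ closure u)).imp (hmem x hx) id) h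
    ⟨y, hy, fun hyc => hyu (hmem y hy hyc)⟩
  exact hzc (subset_closure hzu)

/-- A ray issued from a point of a bounded open set meets the frontier of the set. -/
theorem exists_pos_add_smul_mem_frontier {E : Type*} [NormedAddCommGroup E] [NormedSpace ℝ E]
    {P : Set E} (hopen : IsOpen P) (hbdd : Bornology.IsBounded P) {p v : E} (hp : p ∈ P)
    (hv : v ≠ 0) : ∃ r : ℝ, 0 < r ∧ p + r • v ∈ frontier P := by
  have hpre : IsPreconnected ((fun r : ℝ => p + r • v) '' Ici 0) :=
    isPreconnected_Ici.image _ (by fun_prop)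
  obtain ⟨R, hR⟩ := hbdd.exists_norm_le
  have hv' : 0 < ‖v‖ := norm_pos_iff.mpr hv
  have hR0 : 0 ≤ R := (norm_nonneg p).trans (hR p hp)
  have hout : p + ((‖p‖ + R + 1) / ‖v‖) • v ∉ P := by
    intro h
    have h1 := hR _ h
    have h2 : ‖((‖p‖ + R + 1) / ‖v‖) • v‖ = ‖p‖ + R + 1 := by
      rw [norm_smul, Real.norm_of_nonneg (by positivity)]
      field_simp
    have h3 := norm_sub_le (p + ((‖p‖ + R + 1) / ‖v‖) • v) p
    rw [add_sub_cancel_left, h2] at h3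
    linarith
  obtain ⟨-, ⟨r, hr, rfl⟩, hfr⟩ := hpre.inter_frontier_nonempty_of_isOpen hopen
    ⟨p, ⟨0, by simp, by simp⟩, hp⟩ ⟨_, ⟨(‖p‖ + R + 1) / ‖v‖, mem_Ici.2 (by positivity), rfl⟩, hout⟩
  refine ⟨r, lt_of_le_of_ne hr ?_, hfr⟩
  rintro rfl
  rw [hopen.frontier_eq] at hfr
  exact hfr.2 (by simpa using hp)

/-- At a frontier point of `{x | ∀ i, 0 < f i x}` all `f i` are nonnegative and one vanishes. -/
theorem nonneg_and_exists_eq_zero_of_mem_frontier {X ι : Type*} [TopologicalSpace X] [Finite ι]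
    {f : ι → X → ℝ} (hf : ∀ i, Continuous (f i)) {b : X}
    (hb : b ∈ frontier {x | ∀ i, 0 < f i x}) : (∀ i, 0 ≤ f i b) ∧ ∃ i, f i b = 0 := by
  have hopen : IsOpen {x | ∀ i, 0 < f i x} := by
    simp only [ofPred_forall]
    exact isOpen_iInter_of_finite fun i => isOpen_lt continuous_const (hf i)
  rw [hopen.frontier_eq] at hb
  have hnn : ∀ i, 0 ≤ f i b := fun i =>
    closure_minimal (fun x hx => (hx i).le) (isClosed_le continuous_const (hf i)) hb.1
  refine ⟨hnn, ?_⟩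
  by_contra! h
  exact hb.2 fun i => lt_of_le_of_ne (hnn i) (h i).symm

/-- Evaluation of a real affine map at the point `p + r • (p - q)` of a line. -/
theorem AffineMap.apply_add_smul_sub {E : Type*} [AddCommGroup E] [Module ℝ E] (f : E →ᵃ[ℝ] ℝ)
    (p q : E) (r : ℝ) : f (p + r • (p - q)) = f p + r * (f p - f q) := by
  have h : p + r • (p - q) = AffineMap.lineMap q p (1 + r) := by
    rw [AffineMap.lineMap_apply_module]
    module
  rw [h, AffineMap.apply_lineMap, AffineMap.lineMap_apply_ring]
  ring

/-- If the positive affine maps `f i` are nonnegative at `p + r • (p - q)`, where one of them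
vanishes, then `(1 + r) / r` is the largest of the ratios `f i q / f i p`. -/
theorem isGreatest_range_div {E ι : Type*} [AddCommGroup E] [Module ℝ E]
    {f : ι → E →ᵃ[ℝ] ℝ} {p q : E} {r : ℝ} (hr : 0 < r) (hp : ∀ i, 0 < f i p)
    (hnn : ∀ i, 0 ≤ f i (p + r • (p - q))) (hz : ∃ i, f i (p + r • (p - q)) = 0) :
    IsGreatest (range fun i => f i q / f i p) ((1 + r) / r) := by
  simp only [AffineMap.apply_add_smul_sub] at hnn hz
  constructor
  · obtain ⟨i, hi⟩ := hz
    refine ⟨i, ?_⟩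
    have := hp i
    change f i q / f i p = _
    rw [div_eq_div_iff this.ne' hr.ne']
    linarith
  · rintro _ ⟨i, rfl⟩
    change f i q / f i p ≤ _
    rw [div_le_div_iff₀ (hp i) hr]
    linarith [hnn i]

/-- **Birkhoff's formula.** If `P = {x | Lᵢ(x) > 0, 1 ≤ i ≤ N}` is a non-empty bounded convex
polytope defined by `N` affine maps, then for `x, y ∈ P` the Hilbert distance is
`d_P(x,y) = ½ sup_{i,j} log((Lᵢx/Lᵢy)·(Lⱼy/Lⱼx))`. -/
theorem birkhoff_formula {n N : ℕ}
    (L : Fin N → (Euc n →ᵃ[ℝ] ℝ))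
    (P : Set (Euc n)) (hP : P = {x : Euc n | ∀ i, 0 < L i x})
    (hbdd : Bornology.IsBounded P) (hne : P.Nonempty)
    (d : Euc n → Euc n → ℝ) (hd : IsHilbertDist P d)
    (x y : Euc n) (hx : x ∈ P) (hy : y ∈ P) :
    d x y = (1/2) * ⨆ i : Fin N, ⨆ j : Fin N,
      Real.log ((L i x / L i y) * (L j y / L j x)) := by
  have hcont : ∀ i, Continuous (L i) := fun i => (L i).continuous_of_finiteDimensional
  have hopen : IsOpen P := by
    rw [hP]
    simp only [ofPred_forall]
    exact isOpen_iInter_of_finite fun i => isOpen_lt continuous_const (hcont i)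
  have hx' : ∀ i, 0 < L i x := by simpa [hP] using hx
  have hy' : ∀ i, 0 < L i y := by simpa [hP] using hy
  rcases eq_or_ne x y with rfl | hxy
  · simp [hd.1 x hx, fun i => (hx' i).ne']
  have hv : 0 < ‖y - x‖ := norm_pos_iff.mpr (sub_ne_zero.mpr hxy.symm)
  obtain ⟨r, hr, hb⟩ := exists_pos_add_smul_mem_frontier hopen hbdd hy (sub_ne_zero.mpr hxy.symm)
  obtain ⟨s, hs, ha⟩ := exists_pos_add_smul_mem_frontier hopen hbdd hx (sub_ne_zero.mpr hxy)
  rw [hd.2 x hx y hy hxy _ _ ha hb ⟨-s, 1 + r, by linarith, by linarith, by module, by module⟩]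
  have h1 : y - (x + s • (x - y)) = (1 + s) • (y - x) := by module
  have h2 : x - (x + s • (x - y)) = s • (y - x) := by module
  have h3 : x - (y + r • (y - x)) = (-(1 + r)) • (y - x) := by module
  have h4 : y - (y + r • (y - x)) = (-r) • (y - x) := by module
  rw [h1, h2, h3, h4]
  simp only [norm_smul, norm_neg, mul_div_mul_right _ _ hv.ne', Real.norm_of_nonneg hr.le,
    Real.norm_of_nonneg hs.le, Real.norm_of_nonneg (by linarith : (0 : ℝ) ≤ 1 + r),
    Real.norm_of_nonneg (by linarith : (0 : ℝ) ≤ 1 + s)]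
  rw [hP] at ha hb
  obtain ⟨hann, haz⟩ := nonneg_and_exists_eq_zero_of_mem_frontier hcont ha
  obtain ⟨hbnn, hbz⟩ := nonneg_and_exists_eq_zero_of_mem_frontier hcont hb
  obtain ⟨⟨i, hi⟩, hiub⟩ := isGreatest_range_div hr hy' hbnn hbz
  obtain ⟨⟨j, hj⟩, hjub⟩ := isGreatest_range_div hs hx' hann haz
  have : Nonempty (Fin N) := ⟨i⟩
  congr 1
  refine le_antisymm ?_ (ciSup_le fun k => ciSup_le fun l => ?_)
  · rw [← hi, ← hj, mul_comm]
    exact (le_ciSup (f := fun l => Real.log ((L i x / L i y) * (L l y / L l x)))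
      (finite_range _).bddAbove j).trans
      (le_ciSup (f := fun k => ⨆ l, Real.log ((L k x / L k y) * (L l y / L l x)))
        (finite_range _).bddAbove i)
  · rw [mul_comm ((1 + s) / s)]
    have hk := div_pos (hx' k) (hy' k)
    have hl := div_pos (hy' l) (hx' l)
    exact Real.log_le_log (mul_pos hk hl) (mul_le_mul (hiub ⟨k, rfl⟩) (hjub ⟨l, rfl⟩) hl.le
      (by positivity))
end
end

section
/- Let P be a convex polygon in ℝ² with vertices p₁, …, p_N, and for each i let Qᵢ be the interior angle (sector) of P at the vertex pᵢ. Then for any two points x, y in the interior of P, the Hilbert distance satisfies d_P(x,y) = (1/2) · Σ_{i=1}^{N} δ_{Qᵢ}(x,y). -/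
open Set Filter MeasureTheory

noncomputable section

/-- The cone (sector) pseudo-metric `δ_Q(x,y) = ½ |log |(L₁x/L₁y)·(L₂y/L₂x)||` associated to a
sector bounded by the lines `{L₁ = 0}` and `{L₂ = 0}`. -/
def coneDist {n : ℕ} (L₁ L₂ : Euc n →ᵃ[ℝ] ℝ) (x y : Euc n) : ℝ :=
  (1/2) * |Real.log (|(L₁ x / L₁ y) * (L₂ y / L₂ x)|)|


lemma two_mul_sub_le_sum_abs_cyclic {N : ℕ} [NeZero N] (f : Fin N → ℝ) (j k : Fin N) :
    2 * (f j - f k) ≤ ∑ i, |f (i - 1) - f i| := by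
  have hval : ∀ n : ℕ, n • (1 : Fin N) = Fin.ofNat N n := by
    intro n
    induction n with
    | zero => simp
    | succ n ih => rw [succ_nsmul, ih]; ext; simp [Fin.val_add]
  set g : ℕ → ℝ := fun n => f (j + n • 1) with hg
  have hsum : ∑ i, |f (i - 1) - f i| = ∑ n ∈ Finset.range N, dist (g n) (g (n + 1)) := by
    rw [Finset.sum_range, ← Equiv.sum_comp (Equiv.addLeft (j + 1))]
    refine Finset.sum_congr rfl fun i _ => ?_
    have : (i : ℕ) • (1 : Fin N) = i := by rw [hval]; simp
    simp only [hg, Real.dist_eq, succ_nsmul, this, Equiv.coe_addLeft]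
    congr 3 <;> abel_nf
  obtain ⟨n, hn, hk⟩ : ∃ n ≤ N, g n = f k := by
    refine ⟨(k - j : Fin N), (k - j : Fin N).2.le, ?_⟩
    simp [hg, hval]
  have h0 : g 0 = f j := by simp [hg]
  have hN : g N = f j := by simp [hg, hval]
  rw [hsum, Finset.range_eq_Ico, ← Finset.sum_Ico_consecutive _ (Nat.zero_le n) hn]
  have h1 := dist_le_Ico_sum_dist g (Nat.zero_le n)
  have h2 := dist_le_Ico_sum_dist g hn
  rw [h0, hk, Real.dist_eq] at h1
  rw [hN, hk, Real.dist_eq] at h2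
  have h3 := le_abs_self (f j - f k)
  have h4 := neg_le_abs (f k - f j)
  linarith

/-- If no level is strictly crossed by three of the pairs `(f i, g i)`, their total variation is at
most twice the range. -/
lemma sum_abs_sub_le_of_crossings_le_two {ι : Type*} [Fintype ι] (f g : ι → ℝ) (m M : ℝ) (hmM : m ≤ M)
    (hf : ∀ i, f i ∈ Icc m M) (hg : ∀ i, g i ∈ Icc m M)
    (h : ∀ c : ℝ, ∀ i₁ i₂ i₃, i₁ ≠ i₂ → i₁ ≠ i₃ → i₂ ≠ i₃ → (f i₁ - c) * (g i₁ - c) < 0 →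
      (f i₂ - c) * (g i₂ - c) < 0 → ¬ (f i₃ - c) * (g i₃ - c) < 0) :
    ∑ i, |f i - g i| ≤ 2 * (M - m) := by
  classical
  set S : ι → Set ℝ := fun i => Ioo (min (f i) (g i)) (max (f i) (g i)) with hS
  have hI : ∀ i, Integrable ((S i).indicator (1 : ℝ → ℝ)) := fun i =>
    (integrable_indicator_iff measurableSet_Ioo).2
      (integrableOn_const (by simp))
  have h1 : ∀ i, |f i - g i| = ∫ c, (S i).indicator (1 : ℝ → ℝ) c := by
    intro i
    rw [integral_indicator_one measurableSet_Ioo, Real.volume_real_Ioo_of_le min_le_max,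
      max_sub_min_eq_abs, abs_sub_comm]
  have h2 : 2 * (M - m) = ∫ c, (Icc m M).indicator (fun _ => (2 : ℝ)) c := by
    rw [integral_indicator_const _ measurableSet_Icc, Real.volume_real_Icc_of_le hmM, smul_eq_mul,
      mul_comm]
  have hS' : ∀ i c, c ∈ S i → (f i - c) * (g i - c) < 0 ∧ c ∈ Icc m M := by
    rintro i c ⟨hc1, hc2⟩
    have := hf i
    have := hg i
    simp only [mem_Icc] at *
    rcases le_total (f i) (g i) with hle | hle <;> simp [hle] at hc1 hc2
    · exact ⟨mul_neg_of_neg_of_pos (by linarith) (by linarith), by linarith, by linarith⟩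
    · exact ⟨mul_neg_of_pos_of_neg (by linarith) (by linarith), by linarith, by linarith⟩
  simp_rw [h1]
  rw [← integral_finsetSum _ fun i _ => hI i, h2]
  refine integral_mono (integrable_finsetSum _ fun i _ => hI i)
    ((integrable_indicator_iff measurableSet_Icc).2 (integrableOn_const (by simp))) fun c => ?_
  have hcount : ∑ i, (S i).indicator (1 : ℝ → ℝ) c =
      ((Finset.univ.filter fun i => c ∈ S i).card : ℝ) := by
    rw [Finset.card_filter]
    simp [Set.indicator_apply]
  have hcard : (Finset.univ.filter fun i => c ∈ S i).card ≤ 2 := by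
    by_contra! hlt
    obtain ⟨a, ha, b, hb, d, hd, hab, had, hbd⟩ := Finset.two_lt_card.1 hlt
    simp only [Finset.mem_filter, Finset.mem_univ, true_and] at ha hb hd
    exact h c a b d hab had hbd (hS' _ _ ha).1 (hS' _ _ hb).1 (hS' _ _ hd).1
  change ∑ i, (S i).indicator (1 : ℝ → ℝ) c ≤ _
  rw [hcount]
  by_cases hc : c ∈ Icc m M
  · rw [indicator_of_mem hc]
    exact_mod_cast hcard
  · rw [indicator_of_notMem hc, Finset.filter_false_of_mem fun i _ hi => hc (hS' i c hi).2]
    simp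

/-- Twice the signed area of the triangle `x y v`. -/
def planeCross (x y v : Euc 2) : ℝ :=
  (y 0 - x 0) * (v 1 - x 1) - (y 1 - x 1) * (v 0 - x 0)

lemma exists_eq_mul_planeCross {x y : Euc 2} (hxy : x ≠ y) (k : Euc 2 →ᵃ[ℝ] ℝ)
    (hx : k x = 0) (hy : k y = 0) : ∃ c : ℝ, ∀ v, k v = c * planeCross x y v := by
  set α := k.linear (EuclideanSpace.single 0 1) with hα
  set β := k.linear (EuclideanSpace.single 1 1) with hβ
  have hk : ∀ v, k v = (v 0 - x 0) * α + (v 1 - x 1) * β := by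
    intro v
    have h1 : k v = k.linear (v - x) := by
      have := k.linearMap_vsub v x
      simp only [vsub_eq_sub, hx, sub_zero] at this
      exact this.symm
    have h2 : v - x = (v 0 - x 0) • EuclideanSpace.single (0 : Fin 2) (1 : ℝ) +
        (v 1 - x 1) • EuclideanSpace.single (1 : Fin 2) (1 : ℝ) := by
      ext i; fin_cases i <;> simp
    rw [h1, h2, map_add, map_smul, map_smul, smul_eq_mul, smul_eq_mul]
  have hd := hk y
  rw [hy] at hd
  have hne : (y 0 - x 0) ^ 2 + (y 1 - x 1) ^ 2 ≠ 0 := by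
    intro h0
    refine hxy ?_
    have h1 : y 0 - x 0 = 0 := by nlinarith [sq_nonneg (y 0 - x 0), sq_nonneg (y 1 - x 1)]
    have h2 : y 1 - x 1 = 0 := by nlinarith [sq_nonneg (y 0 - x 0), sq_nonneg (y 1 - x 1)]
    ext i; fin_cases i <;> simp <;> linarith
  refine ⟨((y 0 - x 0) * β - (y 1 - x 1) * α) / ((y 0 - x 0) ^ 2 + (y 1 - x 1) ^ 2), fun v => ?_⟩
  rw [hk, planeCross, div_mul_eq_mul_div, eq_div_iff hne]
  linear_combination (-(v 0 - x 0) * (y 0 - x 0) - (v 1 - x 1) * (y 1 - x 1)) * hd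

lemma collinear_of_planeCross_eq_zero {x y v : Euc 2} (hxy : x ≠ y) (h : planeCross x y v = 0) :
    Collinear ℝ {x, y, v} := by
  have hd : y 0 - x 0 ≠ 0 ∨ y 1 - x 1 ≠ 0 := by
    by_contra! hc
    refine hxy ?_
    ext i; fin_cases i <;> simp <;> linarith
  rw [collinear_iff_of_mem (p₀ := x) (by simp)]
  refine ⟨y - x, ?_⟩
  simp only [mem_insert_iff, mem_singleton_iff, vadd_eq_add, forall_eq_or_imp, forall_eq]
  refine ⟨⟨0, by simp⟩, ⟨1, by simp⟩, ?_⟩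
  unfold planeCross at h
  rcases hd with hd | hd
  · refine ⟨(v 0 - x 0) / (y 0 - x 0), ?_⟩
    ext i; fin_cases i
    · simp; field_simp; ring
    · simp; field_simp; linarith
  · refine ⟨(v 1 - x 1) / (y 1 - x 1), ?_⟩
    ext i; fin_cases i
    · simp; field_simp; linarith
    · simp; field_simp; ring

lemma not_collinear_of_extremePoints {E : Type*} [AddCommGroup E] [Module ℝ E] {P : Set E}
    {x y z : E} (hx : x ∈ P.extremePoints ℝ)
    (hy : y ∈ P.extremePoints ℝ) (hz : z ∈ P.extremePoints ℝ) (hxy : x ≠ y) (hxz : x ≠ z)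
    (hyz : y ≠ z) : ¬ Collinear ℝ {x, y, z} := by
  have key : ∀ {a b c : E}, a ∈ P → c ∈ P → b ∈ P.extremePoints ℝ → Wbtw ℝ a b c → a ≠ b → b ≠ c →
      False := by
    intro a b c ha hc hb hw hab hbc
    rcases (mem_extremePoints_iff_forall_segment.1 hb).2 a ha c hc (mem_segment_iff_wbtw.2 hw) with
      h | h
    · exact hab h
    · exact hbc h.symm
  intro h
  rcases h.wbtw_or_wbtw_or_wbtw with hw | hw | hw
  · exact key hx.1 hz.1 hy hw hxy hyz
  · exact key hy.1 hx.1 hz hw hyz hxz.symm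
  · exact key hz.1 hy.1 hx hw hxz.symm hxy

/-- A convex set with nonempty interior has a supporting functional along any segment contained in
its frontier. -/
lemma exists_supporting_affineMap {E : Type*} [NormedAddCommGroup E] [NormedSpace ℝ E] {P : Set E}
    (hP : Convex ℝ P) (hne : (interior P).Nonempty) {a b : E} (ha : a ∈ P) (hb : b ∈ P)
    (hab : midpoint ℝ a b ∉ interior P) :
    ∃ M : E →ᵃ[ℝ] ℝ, M a = 0 ∧ M b = 0 ∧ (∀ v ∈ interior P, 0 < M v) ∧ ∀ v ∈ P, 0 ≤ M v := by
  set m := midpoint ℝ a b with hm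
  obtain ⟨f, hf⟩ := geometric_hahn_banach_open_point hP.interior isOpen_interior hab
  have hle : ∀ v ∈ P, f v ≤ f m := by
    intro v hv
    have hv' : v ∈ closure (interior P) := by
      rw [hP.closure_interior_eq_closure_of_nonempty_interior hne]
      exact subset_closure hv
    exact closure_minimal (t := {w | f w ≤ f m}) (fun w hw => (hf w hw).le)
      (isClosed_le f.continuous continuous_const) hv'
  have hmid : f a + f b = 2 * f m := by
    have : m + m = a + b := midpoint_add_self ℝ a b
    rw [← map_add, ← this, map_add]; ring
  have h1 := hle a ha
  have h2 := hle b hb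
  refine ⟨AffineMap.const ℝ E (f m) - (f : E →ₗ[ℝ] ℝ).toAffineMap, ?_, ?_, fun v hv => ?_,
    fun v hv => ?_⟩
  · simp; linarith
  · simp; linarith
  · simpa using hf v hv
  · simpa using hle v hv

lemma exists_ray_mem_frontier {E : Type*} [NormedAddCommGroup E] [NormedSpace ℝ E] {U : Set E}
    (hU : IsOpen U) (hb : Bornology.IsBounded U) {x y : E} (hy : y ∈ U) (hxy : x ≠ y) :
    ∃ t : ℝ, 1 < t ∧ x + t • (y - x) ∈ frontier U := by
  set γ : ℝ → E := fun t => x + t • (y - x) with hγ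
  have hcont : Continuous γ := by fun_prop
  have hpre : IsPreconnected (γ '' Ici 1) := isPreconnected_Ici.image _ hcont.continuousOn
  have hnot : ¬ γ '' Ici 1 ⊆ U := by
    intro hsub
    obtain ⟨R, hR⟩ := hb.exists_norm_le
    have hpos : 0 < ‖y - x‖ := norm_pos_iff.2 (sub_ne_zero.2 hxy.symm)
    set t := max 1 ((R + ‖x‖ + 1) / ‖y - x‖) with ht
    have h1 : ‖γ t‖ ≤ R := hR _ (hsub ⟨t, mem_Ici.2 (le_max_left _ _), rfl⟩)
    have h2 : ‖t • (y - x)‖ ≤ ‖γ t‖ + ‖x‖ := by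
      have : t • (y - x) = γ t - x := by simp [hγ]
      rw [this]; exact norm_sub_le _ _
    have h3 : 1 ≤ t := le_max_left _ _
    rw [norm_smul, Real.norm_of_nonneg (by linarith)] at h2
    have h4 : R + ‖x‖ + 1 ≤ t * ‖y - x‖ := (div_le_iff₀ hpos).1 (le_max_right _ _)
    linarith
  have hγ1 : γ 1 = y := by simp [hγ]
  by_contra! hc
  refine hnot ?_
  have hdis : Disjoint (γ '' Ici 1) (frontier U) := by
    rw [Set.disjoint_left]
    rintro _ ⟨t, ht, rfl⟩ hfr
    rcases (mem_Ici.1 ht).eq_or_lt with rfl | h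
    · rw [hγ1, hU.frontier_eq] at hfr
      exact hfr.2 hy
    · exact hc t h hfr
  refine hpre.subset_left_of_subset_union hU isClosed_closure.isOpen_compl
    (disjoint_compl_right.mono_right (compl_subset_compl.2 subset_closure)) (fun w hw => ?_)
    ⟨y, ⟨1, by simp, hγ1⟩, hy⟩
  by_contra hw'
  simp only [mem_union, mem_compl_iff, not_or, not_not] at hw'
  exact Set.disjoint_left.1 hdis hw (by rw [hU.frontier_eq]; exact ⟨hw'.2, hw'.1⟩)

lemma planeCross_mul_neg {x y q r : Euc 2} (hxy : x ≠ y) {C : ℝ} {A B : Euc 2 →ᵃ[ℝ] ℝ}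
    (hAx : 0 < A x) (hBx : 0 < B x) (hAy : A x = C * A y) (hBy : B x = C * B y)
    (hAq : A q = 0) (hAr : 0 < A r) (hBr : B r = 0) (hBq : 0 < B q) :
    planeCross x y q * planeCross x y r < 0 := by
  obtain ⟨c, hc⟩ := exists_eq_mul_planeCross hxy (B x • A - A x • B) (by simp; ring)
    (by simp [hAy, hBy]; ring)
  have h1 := hc q
  have h2 := hc r
  simp [hAq, hBr] at h1 h2
  have h3 : 0 < A x * B q := mul_pos hAx hBq
  have h4 : 0 < B x * A r := mul_pos hBx hAr
  have h5 : c * planeCross x y q * (c * planeCross x y r) < 0 := by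
    rw [← h1, ← h2]
    exact mul_neg_of_neg_of_pos (by linarith) h4
  by_contra! h
  nlinarith [mul_nonneg (sq_nonneg c) h]

/-- If two edge functionals meeting at `v` change sign differently at the projective point
`x - C y`, the line through that point and `v` supports the sector at `v` only at `v`. -/
lemma exists_tangent_affineMap {x y v : Euc 2} {C : ℝ} {A B : Euc 2 →ᵃ[ℝ] ℝ}
    (hAx : 0 < A x) (hBx : 0 < B x) (hAv : A v = 0) (hBv : B v = 0)
    (hAB : (A x - C * A y) * (B x - C * B y) < 0) :
    ∃ h : Euc 2 →ᵃ[ℝ] ℝ, h v = 0 ∧ 0 < h x ∧ h x = C * h y ∧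
      ∀ w, w ≠ v → 0 ≤ A w → 0 ≤ B w → 0 < h w := by
  set a := A x - C * A y with ha
  set b := B x - C * B y with hb
  have ha0 : 0 < |a| := abs_pos.2 fun h0 => by simp [h0] at hAB
  have hb0 : 0 < |b| := abs_pos.2 fun h0 => by simp [h0] at hAB
  have hsum : |a| * b + |b| * a = 0 := by
    rcases mul_neg_iff.1 hAB with ⟨h1, h2⟩ | ⟨h1, h2⟩
    · rw [abs_of_pos h1, abs_of_neg h2]; ring
    · rw [abs_of_neg h1, abs_of_pos h2]; ring
  refine ⟨|a| • B + |b| • A, by simp [hAv, hBv], ?_, ?_, fun w hw hA hB => ?_⟩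
  · simp only [AffineMap.coe_add, AffineMap.coe_smul, Pi.add_apply, Pi.smul_apply, smul_eq_mul]
    positivity
  · simp only [AffineMap.coe_add, AffineMap.coe_smul, Pi.add_apply, Pi.smul_apply, smul_eq_mul]
    linear_combination hsum - |a| * hb - |b| * ha
  · simp only [AffineMap.coe_add, AffineMap.coe_smul, Pi.add_apply, Pi.smul_apply, smul_eq_mul]
    by_contra! hle
    have h1 : 0 ≤ |a| * B w := by positivity
    have h2 : 0 ≤ |b| * A w := by positivity
    have hB0 : B w = 0 := by
      rcases mul_eq_zero.1 (show |a| * B w = 0 by linarith) with h | h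
      · exact absurd h ha0.ne'
      · exact h
    have hA0 : A w = 0 := by
      rcases mul_eq_zero.1 (show |b| * A w = 0 by linarith) with h | h
      · exact absurd h hb0.ne'
      · exact h
    obtain ⟨c, hc⟩ := exists_eq_mul_planeCross hw.symm A hAv hA0
    obtain ⟨e, he⟩ := exists_eq_mul_planeCross hw.symm B hBv hB0
    have h3 : 0 < c * e * planeCross v w x ^ 2 := by
      have := mul_pos hAx hBx
      rw [hc, he] at this
      linarith
    have h4 : 0 < c * e := pos_of_mul_pos_left h3 (sq_nonneg _)
    have h5 : a * b = c * e * (planeCross v w x - C * planeCross v w y) ^ 2 := by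
      rw [ha, hb, hc, hc, he, he]; ring
    have := mul_nonneg h4.le (sq_nonneg (planeCross v w x - C * planeCross v w y))
    linarith

lemma pos_of_supporting_sector {u v w x b : Euc 2} {A B k : Euc 2 →ᵃ[ℝ] ℝ} (huv : u ≠ v)
    (hAu : A u = 0) (hAv : A v = 0) (hBv : B v = 0) (hBw : B w = 0) (hAw : 0 < A w)
    (hBu : 0 < B u) (hkv : k v = 0) (hku : 0 ≤ k u) (hkw : 0 ≤ k w) (hkx : 0 < k x)
    (hAb : 0 < A b) (hBb : 0 < B b) : 0 < k b := by
  obtain ⟨c, hc⟩ := exists_eq_mul_planeCross huv (k - (k u / B u) • B - (k w / A w) • A)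
    (by simp [hAu]; field_simp; ring) (by simp [hAv, hBv, hkv])
  obtain ⟨e, he⟩ := exists_eq_mul_planeCross huv A hAu hAv
  have hcw := hc w
  simp [hBw, hAw.ne'] at hcw
  have hc0 : c = 0 := hcw.resolve_right fun h => by
    rw [he, h] at hAw
    simp at hAw
  have hk : ∀ z, k z = k u / B u * B z + k w / A w * A z := by
    intro z
    have := hc z
    simp [hc0] at this
    linarith
  have h1 : 0 ≤ k u / B u := by positivity
  have h2 : 0 ≤ k w / A w := by positivity
  rw [hk]
  rcases h1.eq_or_lt with h1 | h1
  · rcases h2.eq_or_lt with h2 | h2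
    · rw [hk, ← h1, ← h2] at hkx
      simp at hkx
    · positivity
  · positivity

lemma ratio_eq_of_common_zeros {p q x y : Euc 2} (hpq : p ≠ q) {L M : Euc 2 →ᵃ[ℝ] ℝ}
    (hLp : L p = 0) (hLq : L q = 0) (hL : L.linear ≠ 0) (hMp : M p = 0) (hMq : M q = 0)
    (hMx : M x ≠ 0) : L x / L y = M x / M y := by
  obtain ⟨c, hc⟩ := exists_eq_mul_planeCross hpq L hLp hLq
  obtain ⟨e, he⟩ := exists_eq_mul_planeCross hpq M hMp hMq
  have hc0 : c ≠ 0 := by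
    rintro rfl
    have : L = AffineMap.const ℝ _ 0 := by ext v; simp [hc]
    exact hL (by simp [this])
  have he0 : e ≠ 0 := by
    rintro rfl
    simp [he] at hMx
  rw [hc, hc, he, he, mul_div_mul_left _ _ hc0, mul_div_mul_left _ _ he0]

lemma affineMap_ray {E : Type*} [AddCommGroup E] [Module ℝ E] (M : E →ᵃ[ℝ] ℝ) (x y : E) (t : ℝ) :
    M (x + t • (y - x)) = M x + t * (M y - M x) := by
  have := M.apply_lineMap x y t
  simp only [AffineMap.lineMap_apply, vsub_eq_sub, vadd_eq_add, smul_eq_mul] at this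
  rw [add_comm x, this, add_comm]

lemma norm_ratio_ray {E : Type*} [NormedAddCommGroup E] [NormedSpace ℝ E] {x y : E} (hxy : x ≠ y)
    {t : ℝ} (ht : 1 < t) :
    ‖x - (x + t • (y - x))‖ / ‖y - (x + t • (y - x))‖ = t / (t - 1) := by
  have h1 : x - (x + t • (y - x)) = (-t) • (y - x) := by module
  have h2 : y - (x + t • (y - x)) = (1 - t) • (y - x) := by module
  rw [h1, h2, norm_smul, norm_smul,
    mul_div_mul_right _ _ (norm_ne_zero_iff.2 (sub_ne_zero.2 hxy.symm)), norm_neg,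
    Real.norm_of_nonneg (by linarith), Real.norm_of_nonpos (by linarith), neg_sub]

lemma fin_add_one_ne_self {N : ℕ} [NeZero N] (hN : 2 ≤ N) (i : Fin N) : i + 1 ≠ i := by
  obtain ⟨n, rfl⟩ := Nat.exists_eq_add_of_le' hN
  simp

lemma fin_sub_one_ne_add_one {N : ℕ} [NeZero N] (hN : 3 ≤ N) (i : Fin N) : i - 1 ≠ i + 1 := by
  obtain ⟨n, rfl⟩ := Nat.exists_eq_add_of_le' hN
  intro h
  rw [sub_eq_iff_eq_add, add_assoc] at h
  have h2 : (1 + 1 : Fin (n + 3)) = 0 := by simpa using h.symm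
  have := congrArg Fin.val h2
  simp [Fin.val_add, Nat.mod_eq_of_lt] at this

section Polygon

variable {N : ℕ} {p : Fin N → Euc 2} {P : Set (Euc 2)} {M : Fin N → Euc 2 →ᵃ[ℝ] ℝ}

lemma exists_ray_endpoint (hP : P = convexHull ℝ (range p))
    (hMint : ∀ i, ∀ v ∈ interior P, 0 < M i v) (hMP : ∀ i, ∀ v ∈ P, 0 ≤ M i v)
    (hedge : ∀ b ∈ P, b ∉ interior P → ∃ i, M i b = 0)
    {x y : Euc 2} (hy : y ∈ interior P) (hxy : x ≠ y) :
    ∃ t : ℝ, 1 < t ∧ x + t • (y - x) ∈ frontier (interior P) ∧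
      (∃ j, M j x / M j y = t / (t - 1)) ∧ ∀ i, M i x / M i y ≤ t / (t - 1) := by
  have hcomp : IsCompact P := hP ▸ (finite_range p).isCompact_convexHull (𝕜 := ℝ)
  obtain ⟨t, ht, hfr⟩ := exists_ray_mem_frontier isOpen_interior
    (hcomp.isBounded.subset interior_subset) hy hxy
  have hfr' := frontier_interior_subset hfr
  rw [hcomp.isClosed.frontier_eq] at hfr'
  have ht' : 0 < t - 1 := by linarith
  refine ⟨t, ht, hfr, ?_, fun i => ?_⟩
  · obtain ⟨j, hj⟩ := hedge _ hfr'.1 hfr'.2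
    refine ⟨j, ?_⟩
    have := hMint j y hy
    rw [affineMap_ray] at hj
    rw [div_eq_div_iff this.ne' ht'.ne']
    linarith
  · have h0 := hMP i _ hfr'.1
    have := hMint i y hy
    rw [affineMap_ray] at h0
    rw [div_le_div_iff₀ this ht']
    linarith

variable [NeZero N]

lemma exists_edge_eq_zero (hN : 3 ≤ N) (hinj : Function.Injective p)
    (hP : P = convexHull ℝ (range p)) (hvert : ∀ i, p i ∈ P.extremePoints ℝ)
    (hM0 : ∀ i, M i (p i) = 0) (hM1 : ∀ i, M i (p (i + 1)) = 0)
    (hMint : ∀ i, ∀ v ∈ interior P, 0 < M i v) (hMP : ∀ i, ∀ v ∈ P, 0 ≤ M i v)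
    {x b : Euc 2} (hx : x ∈ interior P) (hb : b ∈ P) (hb' : b ∉ interior P) :
    ∃ i, M i b = 0 := by
  have hconv : Convex ℝ P := hP ▸ convex_convexHull ℝ _
  obtain ⟨k, hkb, -, hkint, hkP⟩ := exists_supporting_affineMap hconv ⟨x, hx⟩ hb hb
    (by rwa [midpoint_self])
  obtain ⟨i, hi⟩ : ∃ i, k (p i) = 0 := by
    by_contra! hne
    have hsub : P ⊆ k ⁻¹' Ioi 0 := by
      rw [hP]
      refine convexHull_min ?_ ((convex_Ioi 0).affine_preimage k)
      rintro _ ⟨i, rfl⟩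
      exact (hkP _ (hvert i).1).lt_of_ne' (hne i)
    exact (hsub hb).ne' hkb
  by_contra! hne
  have hpos : ∀ j, 0 < M j b := fun j => (hMP j b hb).lt_of_ne' (hne j)
  have hne1 : p (i - 1) ≠ p i := fun h => by
    have := hinj h
    exact fin_add_one_ne_self (by lia) (i - 1) (by rw [sub_add_cancel, this])
  have hne2 : p i ≠ p (i + 1) := fun h => fin_add_one_ne_self (by lia) i (hinj h).symm
  have hne3 : p (i - 1) ≠ p (i + 1) := fun h => fin_sub_one_ne_add_one hN i (hinj h)
  have hMi := hM1 (i - 1)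
  rw [sub_add_cancel] at hMi
  have hstrict : ∀ {u v w : Euc 2} {A : Euc 2 →ᵃ[ℝ] ℝ}, u ≠ v → A u = 0 → A v = 0 → 0 < A x →
      0 ≤ A w → ¬ Collinear ℝ {u, v, w} → 0 < A w := by
    intro u v w A huv hu hv hAx hw hcol
    refine hw.lt_of_ne' fun h0 => hcol ?_
    obtain ⟨c, hc⟩ := exists_eq_mul_planeCross huv A hu hv
    refine collinear_of_planeCross_eq_zero huv ?_
    rw [hc] at h0 hAx
    exact (mul_eq_zero.1 h0).resolve_left fun h => by simp [h] at hAx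
  refine (pos_of_supporting_sector (A := M (i - 1)) (B := M i) hne1 (hM0 _) hMi (hM0 _) (hM1 _)
    ?_ ?_ hi (hkP _ (hvert _).1) (hkP _ (hvert _).1) (hkint x hx) (hpos _) (hpos _)).ne' hkb
  · exact hstrict hne1 (hM0 _) hMi (hMint _ x hx) (hMP _ _ (hvert _).1)
      (not_collinear_of_extremePoints (hvert _) (hvert _) (hvert _) hne1 hne3 hne2)
  · exact hstrict hne2 (hM0 _) (hM1 _) (hMint _ x hx) (hMP _ _ (hvert _).1)
      (not_collinear_of_extremePoints (hvert _) (hvert _) (hvert _) hne2 hne1.symm hne3.symm)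

lemma not_three_crossings (hinj : Function.Injective p) (hp : ∀ i, p i ∈ P)
    (hM0 : ∀ i, M i (p i) = 0) (hM1 : ∀ i, M i (p (i + 1)) = 0)
    (hMint : ∀ i, ∀ v ∈ interior P, 0 < M i v) (hMP : ∀ i, ∀ v ∈ P, 0 ≤ M i v)
    {x y : Euc 2} (hx : x ∈ interior P) (hxy : x ≠ y) {C : ℝ} {i j k : Fin N}
    (hij : i ≠ j) (hik : i ≠ k) (hjk : j ≠ k)
    (hi : (M (i - 1) x - C * M (i - 1) y) * (M i x - C * M i y) < 0)
    (hj : (M (j - 1) x - C * M (j - 1) y) * (M j x - C * M j y) < 0) :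
    ¬ (M (k - 1) x - C * M (k - 1) y) * (M k x - C * M k y) < 0 := by
  have key : ∀ l, (M (l - 1) x - C * M (l - 1) y) * (M l x - C * M l y) < 0 →
      ∃ h : Euc 2 →ᵃ[ℝ] ℝ, h (p l) = 0 ∧ 0 < h x ∧ h x = C * h y ∧ ∀ m, m ≠ l → 0 < h (p m) := by
    intro l hl
    have hMl := hM1 (l - 1)
    rw [sub_add_cancel] at hMl
    obtain ⟨h, h1, h2, h3, h4⟩ := exists_tangent_affineMap (hMint (l - 1) x hx) (hMint l x hx)
      hMl (hM0 l) hl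
    exact ⟨h, h1, h2, h3, fun m hm =>
      h4 _ (fun he => hm (hinj he)) (hMP _ _ (hp m)) (hMP _ _ (hp m))⟩
  intro hk
  obtain ⟨f, f1, f2, f3, f4⟩ := key i hi
  obtain ⟨g, g1, g2, g3, g4⟩ := key j hj
  obtain ⟨h, h1, h2, h3, h4⟩ := key k hk
  have e1 := planeCross_mul_neg hxy f2 g2 f3 g3 f1 (f4 j hij.symm) g1 (g4 i hij)
  have e2 := planeCross_mul_neg hxy f2 h2 f3 h3 f1 (f4 k hik.symm) h1 (h4 i hik)
  have e3 := planeCross_mul_neg hxy g2 h2 g3 h3 g1 (g4 k hjk.symm) h1 (h4 j hjk)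
  nlinarith [mul_pos_of_neg_of_neg e1 e2,
    mul_nonneg (sq_nonneg (planeCross x y (p i))) (neg_nonneg.2 e3.le)]

end Polygon
/-- **Alexander's Crofton-type formula.** For a convex polygon `P ⊆ ℝ²` with vertices
`p₁, …, p_N` (in cyclic order, consecutive ones joined by edges of `P`), the interior angle
`Qᵢ` at the vertex `pᵢ` being the sector bounded by the lines through `p_{i-1}, pᵢ` and through
`pᵢ, p_{i+1}`, the Hilbert distance of two interior points `x, y` is
`d_P(x,y) = ½ Σᵢ δ_{Qᵢ}(x,y)`. -/
theorem alexander_formula {N : ℕ} [NeZero N] (hN : 3 ≤ N)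
    (p : Fin N → Euc 2) (hinj : Function.Injective p)
    (P : Set (Euc 2)) (hP : P = convexHull ℝ (Set.range p))
    (hvert : ∀ i, p i ∈ Set.extremePoints ℝ P)
    (hedge : ∀ i : Fin N, segment ℝ (p i) (p (i + 1)) ⊆ frontier P)
    (L : Fin N → Fin 2 → (Euc 2 →ᵃ[ℝ] ℝ))
    (hL0 : ∀ i : Fin N, L i 0 (p (i - 1)) = 0 ∧ L i 0 (p i) = 0 ∧ (L i 0).linear ≠ 0)
    (hL1 : ∀ i : Fin N, L i 1 (p i) = 0 ∧ L i 1 (p (i + 1)) = 0 ∧ (L i 1).linear ≠ 0)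
    (d : Euc 2 → Euc 2 → ℝ) (hd : IsHilbertDist (interior P) d)
    (x y : Euc 2) (hx : x ∈ interior P) (hy : y ∈ interior P) :
    d x y = (1/2) * ∑ i : Fin N, coneDist (L i 0) (L i 1) x y := by
  have hconv : Convex ℝ P := hP ▸ convex_convexHull ℝ _
  have hpP : ∀ i, p i ∈ P := fun i => (hvert i).1
  have hne : ∀ i, p i ≠ p (i + 1) := fun i h => fin_add_one_ne_self (by lia) i (hinj h).symm
  choose M hM0 hM1 hMint hMP using fun i => exists_supporting_affineMap hconv ⟨x, hx⟩ (hpP i)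
    (hpP (i + 1)) fun h => (hedge i (midpoint_mem_segment _ _)).2 h
  have hlog : ∀ i, coneDist (L i 0) (L i 1) x y =
      1 / 2 * |Real.log (M (i - 1) x / M (i - 1) y) - Real.log (M i x / M i y)| := by
    intro i
    have hne' := hne (i - 1)
    have hM1' := hM1 (i - 1)
    rw [sub_add_cancel] at hne' hM1'
    have hpos : ∀ j, 0 < M j x / M j y := fun j => div_pos (hMint j x hx) (hMint j y hy)
    rw [coneDist, ratio_eq_of_common_zeros hne' (hL0 i).1 (hL0 i).2.1 (hL0 i).2.2 (hM0 _) hM1'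
      (hMint _ x hx).ne', ratio_eq_of_common_zeros (hne i) (hL1 i).1 (hL1 i).2.1 (hL1 i).2.2
      (hM0 _) (hM1 _) (hMint _ y hy).ne', ← Real.log_div (hpos _).ne' (hpos _).ne', Real.log_abs,
      div_eq_mul_inv (M (i - 1) x / _) (M i x / _), inv_div]
  simp_rw [hlog]
  rcases eq_or_ne x y with rfl | hxy
  · simp [hd.1 x hx, div_self (hMint _ x hx).ne']
  have hzero : ∀ b ∈ P, b ∉ interior P → ∃ i, M i b = 0 := fun b hb hb' =>
    exists_edge_eq_zero hN hinj hP hvert hM0 hM1 hMint hMP hx hb hb'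
  obtain ⟨t, ht, htfr, ⟨j, hj⟩, htle⟩ := exists_ray_endpoint hP hMint hMP hzero hy hxy
  obtain ⟨s, hs, hsfr, ⟨k, hk⟩, hsle⟩ := exists_ray_endpoint hP hMint hMP hzero hx hxy.symm
  have hpos : ∀ i, 0 < M i x / M i y := fun i => div_pos (hMint i x hx) (hMint i y hy)
  have hpos' : ∀ i, 0 < M i y / M i x := fun i => div_pos (hMint i y hy) (hMint i x hx)
  set f : Fin N → ℝ := fun i => Real.log (M i x / M i y) with hf
  have hmax : ∀ i, f i ≤ f j := fun i => Real.log_le_log (hpos i) (hj ▸ htle i)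
  have hneg : ∀ i, Real.log (M i y / M i x) = - f i := fun i => by
    rw [hf, ← Real.log_inv, inv_div]
  have hmin : ∀ i, f k ≤ f i := fun i => by
    have := Real.log_le_log (hpos' i) (hk ▸ hsle i)
    rw [hneg, hneg] at this
    linarith
  have hdist := hd.2 x hx y hy hxy _ _ hsfr htfr
    ⟨1 - s, t, by linarith, ht, by module, rfl⟩
  rw [norm_ratio_ray hxy ht, norm_ratio_ray hxy.symm hs, ← hj, ← hk,
    Real.log_mul (hpos' k).ne' (hpos j).ne', hneg] at hdist
  have hcross : ∀ c i, ((f (i - 1) - c) * (f i - c) < 0) →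
      (M (i - 1) x - Real.exp c * M (i - 1) y) * (M i x - Real.exp c * M i y) < 0 := by
    have hlt : ∀ c i, f i < c → M i x - Real.exp c * M i y < 0 := fun c i h => by
      rw [sub_neg, ← div_lt_iff₀ (hMint i y hy)]
      exact (Real.log_lt_iff_lt_exp (hpos i)).1 h
    have hgt : ∀ c i, c < f i → 0 < M i x - Real.exp c * M i y := fun c i h => by
      rw [sub_pos, ← lt_div_iff₀ (hMint i y hy)]
      exact (Real.lt_log_iff_exp_lt (hpos i)).1 h
    intro c i h
    rcases mul_neg_iff.1 h with ⟨h1, h2⟩ | ⟨h1, h2⟩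
    · exact mul_neg_of_pos_of_neg (hgt _ _ (sub_pos.1 h1)) (hlt _ _ (sub_neg.1 h2))
    · exact mul_neg_of_neg_of_pos (hlt _ _ (sub_neg.1 h1)) (hgt _ _ (sub_pos.1 h2))
  have hupper := sum_abs_sub_le_of_crossings_le_two (fun i => f (i - 1)) f (f k) (f j) (hmax k)
    (fun i => ⟨hmin _, hmax _⟩) (fun i => ⟨hmin _, hmax _⟩)
    fun c i₁ i₂ i₃ h12 h13 h23 h1 h2 h3 =>
      not_three_crossings hinj hpP hM0 hM1 hMint hMP hx hxy h12 h13 h23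
        (hcross c _ h1) (hcross c _ h2) (hcross c _ h3)
  have hlower := two_mul_sub_le_sum_abs_cyclic f j k
  rw [hdist, ← Finset.mul_sum]
  linarith
end
end

section
/- Let P be a bounded convex polytope in ℝⁿ (n ≥ 2) that is not a simplex, and let (int P, d_P) be its Hilbert geometry. Then every isometry of (int P, d_P) onto itself is the restriction to int P of a projective transformation of ℝPⁿ that maps int P onto itself; consequently the isometry group of (int P, d_P) coincides with the group of collineations preserving P. -/
open Set Filter MeasureTheory

noncomputable section

/-- The lift of `x ∈ ℝⁿ` to homogeneous coordinates `(x, 1) ∈ ℝ^{n+1}`, viewing `ℝⁿ` as an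
affine chart of `ℝPⁿ`. -/
def projLift {n : ℕ} (x : Euc n) : Fin (n + 1) → ℝ := Fin.snoc (fun i => x i) 1

open Topology

/-- An irredundant description of a bounded open polytope as the set where the affine functions
`x ↦ A i x + b i` are positive; `pt i` lies in the relative interior of the `i`-th facet. -/
structure FacetSystem (E ι : Type*) [NormedAddCommGroup E] [NormedSpace ℝ E] where
  A : ι → E →L[ℝ] ℝ
  b : ι → ℝ
  center : E
  pt : ι → E
  center_pos : ∀ i, 0 < A i center + b i
  pt_self : ∀ i, A i (pt i) + b i = 0
  pt_pos : ∀ i j, j ≠ i → 0 < A j (pt i) + b j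
  eq_zero_of_nonneg : ∀ v, (∀ i, 0 ≤ A i v) → v = 0

namespace FacetSystem

variable {E ι : Type*} [NormedAddCommGroup E] [NormedSpace ℝ E]

/-- The `i`-th affine function of a facet system. -/
def ev (S : FacetSystem E ι) (i : ι) (x : E) : ℝ := S.A i x + S.b i

/-- The open polytope described by a facet system. -/
def dom (S : FacetSystem E ι) : Set E := {x | ∀ i, 0 < S.ev i x}

/-- The relative interior of the `i`-th facet. -/
def facet (S : FacetSystem E ι) (i : ι) : Set E :=
  {x | S.ev i x = 0 ∧ ∀ j, j ≠ i → 0 < S.ev j x}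

/-- The pairs `(x, y)` such that the ray from `y` through `x` leaves the polytope through the
facet `j`, and the ray from `x` through `y` leaves it through the facet `i`. -/
def chord (S : FacetSystem E ι) (i j : ι) : Set (E × E) :=
  {p | p.1 ∈ S.dom ∧ p.2 ∈ S.dom ∧
    (∀ k, k ≠ i → S.ev k p.1 * S.ev i p.2 < S.ev i p.1 * S.ev k p.2) ∧
    (∀ k, k ≠ j → S.ev j p.1 * S.ev k p.2 < S.ev k p.1 * S.ev j p.2)}

/-- The points lying on a chord that joins the facets `i` and `j`. -/
def visible (S : FacetSystem E ι) (i j : ι) : Set E := {x | ∃ y, (x, y) ∈ S.chord i j}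

variable (S : FacetSystem E ι)

lemma ev_center (i : ι) : 0 < S.ev i S.center := S.center_pos i

lemma center_mem : S.center ∈ S.dom := S.center_pos

lemma pt_mem (i : ι) : S.pt i ∈ S.facet i := ⟨S.pt_self i, S.pt_pos i⟩

lemma ev_add_smul (i : ι) (x v : E) (t : ℝ) : S.ev i (x + t • v) = S.ev i x + t * S.A i v := by
  simp [ev]; ring

lemma ev_segment (i : ι) (x y : E) (t : ℝ) :
    S.ev i (x + t • (y - x)) = (1 - t) * S.ev i x + t * S.ev i y := by
  simp [ev]; ring

lemma continuous_ev (i : ι) : Continuous (S.ev i) := by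
  unfold ev; fun_prop

lemma isOpen_dom [Finite ι] : IsOpen S.dom := by
  have : S.dom = ⋂ i, {x | 0 < S.ev i x} := by ext; simp [dom]
  rw [this]
  exact isOpen_iInter_of_finite fun i => isOpen_lt continuous_const (S.continuous_ev i)

lemma isOpen_chord [Finite ι] (i j : ι) : IsOpen (S.chord i j) := by
  have h1 : ∀ k, Continuous fun p : E × E => S.ev k p.1 := fun k =>
    (S.continuous_ev k).comp continuous_fst
  have h2 : ∀ k, Continuous fun p : E × E => S.ev k p.2 := fun k =>
    (S.continuous_ev k).comp continuous_snd
  have : S.chord i j = (Prod.fst ⁻¹' S.dom) ∩ ((Prod.snd ⁻¹' S.dom) ∩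
      ((⋂ k, ⋂ _ : k ≠ i, {p | S.ev k p.1 * S.ev i p.2 < S.ev i p.1 * S.ev k p.2}) ∩
        ⋂ k, ⋂ _ : k ≠ j, {p | S.ev j p.1 * S.ev k p.2 < S.ev k p.1 * S.ev j p.2})) := by
    ext; simp [chord]
  rw [this]
  refine (S.isOpen_dom.preimage continuous_fst).inter
    ((S.isOpen_dom.preimage continuous_snd).inter (.inter ?_ ?_)) <;>
  · refine isOpen_iInter_of_finite fun k => isOpen_iInter_of_finite fun _ => ?_
    exact isOpen_lt ((h1 _).mul (h2 _)) ((h1 _).mul (h2 _))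

lemma isOpen_visible [Finite ι] (i j : ι) : IsOpen (S.visible i j) := by
  rw [isOpen_iff_mem_nhds]
  rintro x ⟨y, hy⟩
  have : Continuous fun z : E => (z, y) := by fun_prop
  filter_upwards [((S.isOpen_chord i j).preimage this).mem_nhds hy] with z hz
  exact ⟨y, hz⟩

lemma exists_ev_lt {x y : E} (h : x ≠ y) : ∃ k, S.ev k x < S.ev k y := by
  by_contra! hk
  refine h (sub_eq_zero.mp (S.eq_zero_of_nonneg _ fun i => ?_))
  have := hk i
  simp only [ev, map_sub] at this ⊢
  linarith

lemma nonempty_index (S : FacetSystem E ι) [Nontrivial E] : Nonempty ι := by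
  obtain ⟨x, y, h⟩ := exists_pair_ne E
  exact ⟨(S.exists_ev_lt h).choose⟩

lemma chord_symm {i j : ι} {x y : E} (h : (x, y) ∈ S.chord i j) : (y, x) ∈ S.chord j i := by
  obtain ⟨h1, h2, h3, h4⟩ := h
  refine ⟨h2, h1, fun k hk => ?_, fun k hk => ?_⟩
  · have := h4 k hk; dsimp only at *; linarith
  · have := h3 k hk; dsimp only at *; linarith

lemma segment_mem_dom {x y : E} (hx : x ∈ S.dom) (hy : ∀ i, 0 ≤ S.ev i y) {t : ℝ} (h0 : 0 ≤ t)
    (h1 : t < 1) : x + t • (y - x) ∈ S.dom := fun i => by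
  rw [ev_segment]
  have := mul_pos (sub_pos.mpr h1) (hx i)
  have := mul_nonneg h0 (hy i)
  linarith

lemma mem_closure_dom {x : E} (hx : ∀ i, 0 ≤ S.ev i x) : x ∈ closure S.dom := by
  have h : Tendsto (fun t : ℝ => x + t • (S.center - x)) (𝓝[>] 0) (𝓝 x) := by
    have : Continuous fun t : ℝ => x + t • (S.center - x) := by fun_prop
    simpa using (this.tendsto 0).mono_left nhdsWithin_le_nhds
  refine mem_closure_of_tendsto h ?_
  filter_upwards [Ioo_mem_nhdsGT (zero_lt_one)] with t ht i
  rw [ev_segment]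
  have := mul_nonneg (sub_pos.mpr ht.2).le (hx i)
  have := mul_pos ht.1 (S.ev_center i)
  linarith

lemma nonneg_of_mem_closure {x : E} (hx : x ∈ closure S.dom) (i : ι) : 0 ≤ S.ev i x :=
  closure_minimal (t := {y | 0 ≤ S.ev i y}) (fun _ hy => (hy i).le)
    (isClosed_le continuous_const (S.continuous_ev i)) hx

/-- A chord can be prolonged beyond its first point. -/
lemma exists_chord_swap [Finite ι] {i j : ι} {x y : E} (h : (x, y) ∈ S.chord i j) :
    ∃ z, (x, z) ∈ S.chord j i := by
  obtain ⟨h1, h2, h3, h4⟩ := h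
  have hc : Tendsto (fun t : ℝ => x + t • (x - y)) (𝓝[>] 0) (𝓝 x) := by
    have : Continuous fun t : ℝ => x + t • (x - y) := by fun_prop
    simpa using (this.tendsto 0).mono_left nhdsWithin_le_nhds
  obtain ⟨t, ht, ht0⟩ := ((hc.eventually (S.isOpen_dom.mem_nhds h1)).and
    self_mem_nhdsWithin).exists
  have ht0 : 0 < t := ht0
  have he : ∀ k, S.ev k (x + t • (x - y)) = (1 + t) * S.ev k x - t * S.ev k y := fun k => by
    simp [ev]; ring
  refine ⟨x + t • (x - y), h1, ht, fun k hk => ?_, fun k hk => ?_⟩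
  · have := mul_lt_mul_of_pos_left (h4 k hk) ht0
    simp only [he] at this ⊢; linarith
  · have := mul_lt_mul_of_pos_left (h3 k hk) ht0
    simp only [he] at this ⊢; linarith

lemma visible_symm [Finite ι] {i j : ι} {x : E} (h : x ∈ S.visible i j) : x ∈ S.visible j i :=
  let ⟨_, hy⟩ := h
  S.exists_chord_swap hy

/-- Seen from a point `p` of the facet `k`, the point `y` is in front of the facet `j`. -/
lemma mem_visible_of_facet {k j : ι} {y p : E} (hy : y ∈ S.dom) (hp : p ∈ S.facet k)
    (h : ∀ m, m ≠ j → S.ev m p * S.ev j y < S.ev j p * S.ev m y) : y ∈ S.visible k j := by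
  have hp0 : ∀ i, 0 ≤ S.ev i p := fun i => by
    by_cases hi : i = k
    · subst hi; exact hp.1.ge
    · exact (hp.2 i hi).le
  refine ⟨y + (1 / 2 : ℝ) • (p - y), hy, S.segment_mem_dom hy hp0 (by norm_num) (by norm_num),
    fun m hm => ?_, fun m hm => ?_⟩
  · have := mul_pos (hy k) (hp.2 m hm)
    simp only [ev_segment, hp.1]; nlinarith
  · have := h m hm
    simp only [ev_segment]; nlinarith

end FacetSystem

/-- The largest of the ratios `u i / w i`. -/
def maxRatio {ι : Type*} [Fintype ι] [Nonempty ι] (u w : ι → ℝ) : ℝ :=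
  Finset.univ.sup' Finset.univ_nonempty fun i => u i / w i

section maxRatio

variable {ι : Type*} [Fintype ι] [Nonempty ι]

lemma le_maxRatio (u w : ι → ℝ) (i : ι) : u i / w i ≤ maxRatio u w :=
  Finset.le_sup' (fun i => u i / w i) (Finset.mem_univ i)

lemma exists_maxRatio_eq (u w : ι → ℝ) : ∃ i, maxRatio u w = u i / w i := by
  obtain ⟨i, -, h⟩ := Finset.exists_mem_eq_sup' Finset.univ_nonempty fun i => u i / w i
  exact ⟨i, h⟩

lemma maxRatio_le {u w : ι → ℝ} {c : ℝ} (h : ∀ k, u k / w k ≤ c) : maxRatio u w ≤ c :=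
  Finset.sup'_le _ _ fun k _ => h k

lemma maxRatio_eq {u w : ι → ℝ} (i : ι) (h : ∀ k, u k / w k ≤ u i / w i) :
    maxRatio u w = u i / w i :=
  (maxRatio_le h).antisymm (le_maxRatio u w i)

lemma maxRatio_pos {u w : ι → ℝ} (hu : ∀ i, 0 < u i) (hw : ∀ i, 0 < w i) :
    0 < maxRatio u w := by
  obtain ⟨i, hi⟩ := exists_maxRatio_eq u w
  exact hi ▸ div_pos (hu i) (hw i)

lemma ContinuousAt.maxRatio {X : Type*} [TopologicalSpace X] {u w : X → ι → ℝ} {x : X}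
    (hu : ∀ i, ContinuousAt (fun z => u z i) x) (hw : ∀ i, ContinuousAt (fun z => w z i) x)
    (h : ∀ i, w x i ≠ 0) : ContinuousAt (fun z => maxRatio (u z) (w z)) x :=
  ContinuousAt.finset_sup'_apply _ fun i _ => (hu i).div (hw i) (h i)

end maxRatio

namespace FacetSystem

variable {E ι : Type*} [NormedAddCommGroup E] [NormedSpace ℝ E] [Fintype ι] [Nonempty ι]

/-- The cross ratio whose logarithm is twice the Hilbert distance. -/
def cr (S : FacetSystem E ι) (x y : E) : ℝ :=
  maxRatio (S.ev · x) (S.ev · y) * maxRatio (S.ev · y) (S.ev · x)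

variable (S : FacetSystem E ι)

lemma one_lt_maxRatio {x y : E} (hy : y ∈ S.dom) (h : x ≠ y) :
    1 < maxRatio (S.ev · x) (S.ev · y) := by
  obtain ⟨k, hk⟩ := S.exists_ev_lt h.symm
  exact ((one_lt_div (hy k)).mpr hk).trans_le (le_maxRatio (S.ev · x) (S.ev · y) k)

lemma maxRatio_self {x : E} (hx : x ∈ S.dom) : maxRatio (S.ev · x) (S.ev · x) = 1 := by
  obtain ⟨i, hi⟩ := exists_maxRatio_eq (S.ev · x) (S.ev · x)
  rw [hi, div_self (hx i).ne']

lemma one_le_maxRatio {x y : E} (hy : y ∈ S.dom) :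
    1 ≤ maxRatio (S.ev · x) (S.ev · y) := by
  by_cases h : x = y
  · rw [h, S.maxRatio_self hy]
  · exact (S.one_lt_maxRatio hy h).le

lemma cr_self {x : E} (hx : x ∈ S.dom) : S.cr x x = 1 := by
  simp [cr, S.maxRatio_self hx]

lemma cr_pos {x y : E} (hx : x ∈ S.dom) (hy : y ∈ S.dom) : 0 < S.cr x y :=
  mul_pos (maxRatio_pos hx hy) (maxRatio_pos hy hx)

lemma continuousAt_cr {x : E} (hx : x ∈ S.dom) : ContinuousAt (fun z => S.cr x z) x := by
  refine .mul (.maxRatio (fun i => continuousAt_const) (fun i => (S.continuous_ev i).continuousAt)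
    fun i => (hx i).ne') (.maxRatio (fun i => (S.continuous_ev i).continuousAt)
    (fun i => continuousAt_const) fun i => (hx i).ne')

lemma abs_ev_sub_le {x y : E} (hx : x ∈ S.dom) (hy : y ∈ S.dom) (i : ι) :
    |S.ev i y - S.ev i x| ≤ (S.cr x y - 1) * S.ev i x := by
  have h1 := S.one_le_maxRatio (x := x) hy
  have h2 := S.one_le_maxRatio (x := y) hx
  have h3 := le_maxRatio (S.ev · x) (S.ev · y) i
  have h4 := le_maxRatio (S.ev · y) (S.ev · x) i
  have hc1 : maxRatio (S.ev · x) (S.ev · y) ≤ S.cr x y := by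
    unfold cr; nlinarith
  have hc2 : maxRatio (S.ev · y) (S.ev · x) ≤ S.cr x y := by
    unfold cr; nlinarith
  have h5 := (div_le_iff₀ (hy i)).mp (h3.trans hc1)
  have h6 := (div_le_iff₀ (hx i)).mp (h4.trans hc2)
  have hxi := hx i
  rw [abs_le]
  constructor
  · by_contra! hlt
    have : S.ev i y < (2 - S.cr x y) * S.ev i x := by linarith
    have hc : 0 < S.cr x y := S.cr_pos hx hy
    have := mul_lt_mul_of_pos_left this hc
    nlinarith [mul_nonneg hxi.le (sq_nonneg (S.cr x y - 1))]
  · linarith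

lemma chord_cr {i j : ι} {x y : E} (h : (x, y) ∈ S.chord i j) :
    S.cr x y = S.ev i x / S.ev i y * (S.ev j y / S.ev j x) := by
  obtain ⟨hx, hy, h1, h2⟩ := h
  dsimp only at hx hy h1 h2
  unfold cr
  rw [maxRatio_eq i fun k => ?_, maxRatio_eq j fun k => ?_]
  · rw [div_le_div_iff₀ (hx k) (hx j)]
    by_cases hk : k = j
    · subst hk; exact le_rfl
    · linarith [h2 k hk]
  · rw [div_le_div_iff₀ (hy k) (hy i)]
    by_cases hk : k = i
    · subst hk; exact le_rfl
    · exact (h1 k hk).le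

lemma tendsto_of_tendsto_ev [FiniteDimensional ℝ E] {X : Type*} {l : Filter X} {u : X → E} {x : E}
    (h : ∀ i, Tendsto (fun z => S.ev i (u z)) l (𝓝 (S.ev i x))) : Tendsto u l (𝓝 x) := by
  let L : E →ₗ[ℝ] (ι → ℝ) := LinearMap.pi fun i => (S.A i : E →ₗ[ℝ] ℝ)
  have hL : LinearMap.ker L = ⊥ := by
    rw [LinearMap.ker_eq_bot']
    intro v hv
    exact S.eq_zero_of_nonneg v fun i => (congrFun hv i).ge
  rw [(LinearMap.isClosedEmbedding_of_injective hL).isInducing.tendsto_nhds_iff, tendsto_pi_nhds]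
  intro i
  simpa [ev, L] using (h i).sub_const (S.b i)

/-- `f` and `g` are mutually inverse self-isometries of the Hilbert geometry on `S.dom`. -/
structure IsIsom (f g : E → E) : Prop where
  mapsTo : ∀ x ∈ S.dom, f x ∈ S.dom
  mapsTo_inv : ∀ x ∈ S.dom, g x ∈ S.dom
  left_inv : ∀ x ∈ S.dom, g (f x) = x
  right_inv : ∀ x ∈ S.dom, f (g x) = x
  cr_map : ∀ x ∈ S.dom, ∀ y ∈ S.dom, S.cr (f x) (f y) = S.cr x y

variable {S} {f g : E → E}

lemma IsIsom.symm (h : S.IsIsom f g) : S.IsIsom g f where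
  mapsTo := h.mapsTo_inv
  mapsTo_inv := h.mapsTo
  left_inv := h.right_inv
  right_inv := h.left_inv
  cr_map x hx y hy := by
    rw [← h.cr_map _ (h.mapsTo_inv x hx) _ (h.mapsTo_inv y hy), h.right_inv x hx, h.right_inv y hy]

lemma IsIsom.continuousAt [FiniteDimensional ℝ E] (h : S.IsIsom f g) {x : E} (hx : x ∈ S.dom) :
    ContinuousAt f x := by
  refine S.tendsto_of_tendsto_ev fun i => ?_
  have h1 : Tendsto (fun z => (S.cr x z - 1) * S.ev i (f x)) (𝓝 x) (𝓝 0) := by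
    simpa [S.cr_self hx] using
      (((S.continuousAt_cr hx).tendsto.sub_const 1).mul_const (S.ev i (f x)))
  rw [tendsto_iff_norm_sub_tendsto_zero]
  refine squeeze_zero' (.of_forall fun _ => norm_nonneg _) ?_ h1
  filter_upwards [S.isOpen_dom.mem_nhds hx] with z hz
  rw [Real.norm_eq_abs, ← h.cr_map x hx z hz]
  exact S.abs_ev_sub_le (h.mapsTo x hx) (h.mapsTo z hz) i

lemma IsIsom.isOpen_image [FiniteDimensional ℝ E] (h : S.IsIsom f g) {O : Set E} (hO : IsOpen O)
    (hs : O ⊆ S.dom) : IsOpen (f '' O) := by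
  rw [isOpen_iff_mem_nhds]
  rintro _ ⟨x, hx, rfl⟩
  have hx' := h.mapsTo x (hs hx)
  have hg : g ⁻¹' O ∈ 𝓝 (f x) := (h.symm.continuousAt hx').preimage_mem_nhds
    ((h.left_inv x (hs hx)).symm ▸ hO.mem_nhds hx)
  filter_upwards [hg, S.isOpen_dom.mem_nhds hx'] with z hz hz'
  exact ⟨g z, hz, h.right_inv z hz'⟩

end FacetSystem

namespace FacetSystem

variable {E ι : Type*} [NormedAddCommGroup E] [NormedSpace ℝ E] [Fintype ι] [Nonempty ι]
  (S : FacetSystem E ι)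

/-- If `r` is the maximal ratio of `q` to `p`, the ray from `q` through `p` leaves the polytope at
`p - (r - 1)⁻¹ • (q - p)`. -/
lemma exit_mem_frontier {p q : E} (hp : p ∈ S.dom) (h : q ≠ p) :
    p + (-(maxRatio (S.ev · q) (S.ev · p) - 1)⁻¹) • (q - p) ∈ frontier S.dom := by
  set r := maxRatio (S.ev · q) (S.ev · p) with hr
  have hr1 : 0 < r - 1 := sub_pos.mpr (S.one_lt_maxRatio hp h)
  have he : ∀ k, S.ev k (p + (-(r - 1)⁻¹) • (q - p)) =
      (r - S.ev k q / S.ev k p) * S.ev k p * (r - 1)⁻¹ := fun k => by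
    have := (hp k).ne'
    rw [ev_segment]
    field_simp
    ring
  rw [S.isOpen_dom.frontier_eq]
  refine ⟨S.mem_closure_dom fun k => ?_, fun hmem => ?_⟩
  · rw [he]
    have := sub_nonneg.mpr (le_maxRatio (S.ev · q) (S.ev · p) k)
    have := hp k
    positivity
  · obtain ⟨i, hi⟩ := exists_maxRatio_eq (S.ev · q) (S.ev · p)
    have := hmem i
    rw [he, ← hr.trans hi, sub_self] at this
    simp at this

lemma norm_ratio {p q : E} (h : q ≠ p) {r : ℝ} (hr : 1 < r) :
    ‖q - (p + (-(r - 1)⁻¹) • (q - p))‖ / ‖p - (p + (-(r - 1)⁻¹) • (q - p))‖ = r := by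
  have h0 : ‖q - p‖ ≠ 0 := norm_ne_zero_iff.mpr (sub_ne_zero.mpr h)
  have hr1 : 0 < r - 1 := sub_pos.mpr hr
  have e1 : q - (p + (-(r - 1)⁻¹) • (q - p)) = (1 + (r - 1)⁻¹) • (q - p) := by module
  have e2 : p - (p + (-(r - 1)⁻¹) • (q - p)) = (r - 1)⁻¹ • (q - p) := by module
  rw [e1, e2, norm_smul, norm_smul, mul_div_mul_right _ _ h0, Real.norm_of_nonneg (by positivity),
    Real.norm_of_nonneg (by positivity)]
  field_simp
  ring

lemma hilbertDist_eq {n : ℕ} (S : FacetSystem (Euc n) ι) {d : Euc n → Euc n → ℝ}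
    (hd : IsHilbertDist S.dom d) {p q : Euc n} (hp : p ∈ S.dom) (hq : q ∈ S.dom) :
    d p q = 1 / 2 * Real.log (S.cr p q) := by
  by_cases h : p = q
  · subst h
    rw [hd.1 p hp, S.cr_self hp]; simp
  have h1 := S.one_lt_maxRatio hp (Ne.symm h)
  have h2 := S.one_lt_maxRatio hq h
  rw [hd.2 p hp q hq h _ _ (S.exit_mem_frontier hp (Ne.symm h)) (S.exit_mem_frontier hq h) ?_,
    norm_ratio (Ne.symm h) h1, norm_ratio h h2]
  · rw [cr, mul_comm (maxRatio (S.ev · p) (S.ev · q))]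
  · refine ⟨_, 1 + (maxRatio (S.ev · p) (S.ev · q) - 1)⁻¹, ?_, ?_, rfl, ?_⟩
    · simpa using h1
    · simpa using h2
    · module

end FacetSystem

namespace FacetSystem

variable {E ι : Type*} [NormedAddCommGroup E] [NormedSpace ℝ E] [Fintype ι]
  (S : FacetSystem E ι)

/-- The functions `φ ∘ S.ev i` and the constants are linearly independent on any nonempty open set
as soon as `φ` is analytic on the positive reals and blows up at zero. -/
lemma eq_zero_of_sum_eq_const {φ : ℝ → ℝ} (hφ : ∀ t, 0 < t → AnalyticAt ℝ φ t)
    (h0 : Tendsto (fun t => |φ t|) (𝓝[>] 0) atTop) {O : Set E} (hO : IsOpen O)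
    (hne : O.Nonempty) (hs : O ⊆ S.dom) {c : ι → ℝ} {C : ℝ}
    (h : ∀ z ∈ O, ∑ i, c i * φ (S.ev i z) = C) (i : ι) : c i = 0 := by
  classical
  by_contra hc
  obtain ⟨x, hx⟩ := hne
  have hxd := hs hx
  set u : ℝ → ι → ℝ := fun t k => (1 - t) * S.ev k x + t * S.ev k (S.pt i) with hu
  have hpt : ∀ k, 0 ≤ S.ev k (S.pt i) := fun k => by
    by_cases hk : k = i
    · subst hk; exact (S.pt_mem k).1.ge
    · exact ((S.pt_mem i).2 k hk).le
  have hupos : ∀ t ∈ Ico (0 : ℝ) 1, ∀ k, 0 < u t k := fun t ht k => by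
    have := S.segment_mem_dom hxd hpt ht.1 ht.2 k
    rwa [ev_segment] at this
  set F : ℝ → ℝ := fun t => ∑ k, c k * φ (u t k) with hF
  have hFa : AnalyticOnNhd ℝ F (Ico 0 1) := fun t ht => by
    refine Finset.analyticAt_fun_sum _ fun k _ => analyticAt_const.mul ?_
    have hua : AnalyticAt ℝ (fun t => u t k) t := by
      simp only [hu]; fun_prop
    exact AnalyticAt.fun_comp (f := fun t => u t k) (hφ _ (hupos t ht k)) hua
  have hF0 : F =ᶠ[𝓝 0] fun _ => C := by
    have hcont : Continuous fun t : ℝ => x + t • (S.pt i - x) := by fun_prop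
    have : (fun t : ℝ => x + t • (S.pt i - x)) ⁻¹' O ∈ 𝓝 0 :=
      (hO.preimage hcont).mem_nhds (by simpa using hx)
    filter_upwards [this] with t ht
    rw [← h _ ht]
    simp only [hF, hu, ev_segment]
  have hFC := hFa.eqOn_of_preconnected_of_eventuallyEq (analyticOnNhd_const (v := C))
    isPreconnected_Ico (left_mem_Ico.mpr zero_lt_one) hF0
  have hlim : Tendsto (fun t => ∑ k ∈ Finset.univ.erase i, c k * φ (u t k)) (𝓝[<] 1)
      (𝓝 (∑ k ∈ Finset.univ.erase i, c k * φ (u 1 k))) := by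
    refine tendsto_finsetSum _ fun k hk => Tendsto.const_mul _ ?_
    have hpos : 0 < u 1 k := by
      simpa [hu] using (S.pt_mem i).2 k (Finset.ne_of_mem_erase hk)
    have hcu : Continuous fun t => u t k := by simp only [hu]; fun_prop
    exact ((hφ _ hpos).continuousAt.tendsto.comp hcu.continuousAt.tendsto).mono_left
      nhdsWithin_le_nhds
  have hi0 : Tendsto (fun t => u t i) (𝓝[<] 1) (𝓝[>] 0) := by
    refine tendsto_nhdsWithin_iff.mpr ⟨?_, ?_⟩
    · have hcu : Continuous fun t => u t i := by simp only [hu]; fun_prop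
      have : u 1 i = 0 := by simpa [hu] using (S.pt_mem i).1
      exact this ▸ (hcu.tendsto 1).mono_left nhdsWithin_le_nhds
    · filter_upwards [Ico_mem_nhdsLT zero_lt_one] with t ht using hupos t ht i
  have hblow : Tendsto (fun t => |c i * φ (u t i)|) (𝓝[<] 1) atTop := by
    simp only [abs_mul]
    exact (h0.comp hi0).const_mul_atTop (abs_pos.mpr hc)
  refine not_tendsto_nhds_of_tendsto_atTop hblow
    |C - ∑ k ∈ Finset.univ.erase i, c k * φ (u 1 k)| ?_
  refine ((hlim.const_sub C).abs).congr' ?_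
  filter_upwards [Ico_mem_nhdsLT zero_lt_one] with t ht
  have := hFC ht
  simp only [hF] at this
  rw [← Finset.add_sum_erase _ _ (Finset.mem_univ i)] at this
  rw [← this]
  congr 1
  ring

lemma tendsto_abs_log : Tendsto (fun t => |Real.log t|) (𝓝[>] 0) atTop :=
  tendsto_abs_atBot_atTop.comp Real.tendsto_log_nhdsGT_zero

lemma tendsto_abs_inv : Tendsto (fun t : ℝ => |t⁻¹|) (𝓝[>] 0) atTop :=
  tendsto_abs_atTop_atTop.comp tendsto_inv_nhdsGT_zero

lemma eq_zero_of_sum_log {O : Set E} (hO : IsOpen O)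
    (hne : O.Nonempty) (hs : O ⊆ S.dom) {c : ι → ℝ} {C : ℝ}
    (h : ∀ z ∈ O, ∑ i, c i * Real.log (S.ev i z) = C) (i : ι) : c i = 0 :=
  S.eq_zero_of_sum_eq_const (fun _ ht => analyticAt_log ht) tendsto_abs_log hO hne hs h i

lemma eq_zero_of_sum_inv {O : Set E} (hO : IsOpen O)
    (hne : O.Nonempty) (hs : O ⊆ S.dom) {c : ι → ℝ} {C : ℝ}
    (h : ∀ z ∈ O, ∑ i, c i * (S.ev i z)⁻¹ = C) (i : ι) : c i = 0 :=
  S.eq_zero_of_sum_eq_const (fun _ ht => analyticAt_inv ht.ne') tendsto_abs_inv hO hne hs h i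

/-- Products of the functions `S.ev i` determine their factors, even up to a constant. -/
lemma multiset_eq_of_prod_eq [DecidableEq ι] {O : Set E} (hO : IsOpen O)
    (hne : O.Nonempty) (hs : O ⊆ S.dom) {s t : Multiset ι} {C : ℝ}
    (h : ∀ z ∈ O, (s.map (S.ev · z)).prod = C * (t.map (S.ev · z)).prod) : s = t := by
  have hp : ∀ z ∈ O, ∀ u : Multiset ι, Real.log (u.map (S.ev · z)).prod =
      ∑ i, (u.count i : ℝ) * Real.log (S.ev i z) := fun z hz u => by
    rw [Finset.prod_multiset_map_count, Real.log_prod fun i _ => (pow_pos (hs hz i) _).ne']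
    rw [← Finset.sum_subset (Finset.subset_univ u.toFinset)]
    · simp
    · intro i _ hi
      simp [Multiset.count_eq_zero.mpr (mt Multiset.mem_toFinset.mpr hi)]
  have hpos : ∀ z ∈ O, ∀ u : Multiset ι, 0 < (u.map (S.ev · z)).prod := fun z hz u => by
    refine Multiset.prod_induction (fun r => 0 < r) _ (fun _ _ => mul_pos) one_pos ?_
    simp only [Multiset.mem_map]
    rintro _ ⟨i, -, rfl⟩
    exact hs hz i
  have := S.eq_zero_of_sum_log hO hne hs (c := fun i => (s.count i : ℝ) - t.count i)
    (C := Real.log C) fun z hz => by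
      have hC : C ≠ 0 := by
        rintro rfl
        have := hpos z hz s
        rw [h z hz, zero_mul] at this
        exact this.false
      have := congrArg Real.log (h z hz)
      rw [Real.log_mul hC (hpos z hz t).ne', hp z hz, hp z hz] at this
      simp only [sub_mul, Finset.sum_sub_distrib]
      linarith
  ext i
  exact_mod_cast sub_eq_zero.mp (this i)

end FacetSystem

lemma exists_open_subset_of_cover {X κ : Type*} [TopologicalSpace X] [BaireSpace X] [Countable κ]
    {O : Set X} (hO : IsOpen O) (hne : O.Nonempty) (f : κ → Set X) (hf : ∀ k, IsClosed (f k))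
    (hc : O ⊆ ⋃ k, f k) : ∃ k, ∃ O', IsOpen O' ∧ O'.Nonempty ∧ O' ⊆ O ∧ O' ⊆ f k := by
  let F : Option κ → Set X := fun o => o.elim Oᶜ f
  have hF : ∀ o, IsClosed (F o) := by
    rintro (_ | k)
    · exact hO.isClosed_compl
    · exact hf k
  have hU : ⋃ o, F o = univ := by
    refine eq_univ_of_forall fun x => ?_
    by_cases hx : x ∈ O
    · obtain ⟨k, hk⟩ := mem_iUnion.mp (hc hx)
      exact mem_iUnion.mpr ⟨some k, hk⟩
    · exact mem_iUnion.mpr ⟨none, hx⟩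
  obtain ⟨z, hzO, hz⟩ := (dense_iUnion_interior_of_closed hF hU).inter_open_nonempty O hO hne
  obtain ⟨o, ho⟩ := mem_iUnion.mp hz
  match o with
  | none => exact absurd hzO (interior_subset ho)
  | some k =>
    exact ⟨k, O ∩ interior (f k), hO.inter isOpen_interior, ⟨z, hzO, ho⟩, inter_subset_left,
      inter_subset_right.trans interior_subset⟩

namespace FacetSystem

variable {E ι : Type*} [NormedAddCommGroup E] [NormedSpace ℝ E] [Fintype ι]
  (S : FacetSystem E ι)

lemma chord_ne [Nontrivial ι] {i j : ι} {p : E × E} (h : p ∈ S.chord i j) : i ≠ j := by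
  rintro rfl
  obtain ⟨m, hm⟩ := exists_ne i
  have h1 := h.2.2.1 m hm
  have h2 := h.2.2.2 m hm
  linarith

lemma eq_of_mem_chord {i j k l : ι} {p : E × E} (h : p ∈ S.chord i j) (h' : p ∈ S.chord k l) :
    i = k ∧ j = l := by
  constructor
  · by_contra hne
    have h1 := h.2.2.1 k (Ne.symm hne)
    have h2 := h'.2.2.1 i hne
    linarith
  · by_contra hne
    have h1 := h.2.2.2 l (Ne.symm hne)
    have h2 := h'.2.2.2 j hne
    linarith

lemma eq_of_ev_eq_mul {O : Set E} (hO : IsOpen O)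
    (hne : O.Nonempty) (hs : O ⊆ S.dom) {i j : ι} {C : ℝ}
    (h : ∀ z ∈ O, S.ev i z = C * S.ev j z) : i = j := by
  classical
  have := S.multiset_eq_of_prod_eq hO hne hs (s := {i}) (t := {j}) (C := C) (by simpa using h)
  simpa using this

variable [Nonempty ι]

lemma exists_chord_of_cr_mul [BaireSpace E] [Nontrivial ι] {x y : E} (hx : x ∈ S.dom)
    (hy : y ∈ S.dom) {O : Set E} (hO : IsOpen O) (hne : O.Nonempty) (hs : O ⊆ S.dom)
    (h : ∀ z ∈ O, S.cr x z * S.cr z y = S.cr x y) : ∃ i j, (x, y) ∈ S.chord i j := by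
  classical
  obtain ⟨⟨i, j, k, l⟩, O', hO', hne', hsub, hcl⟩ := exists_open_subset_of_cover hO hne
    (κ := ι × ι × ι × ι) (fun q => ⋂ m,
      {z | S.ev m x * S.ev q.1 z ≤ S.ev q.1 x * S.ev m z} ∩
      ({z | S.ev m z * S.ev q.2.1 x ≤ S.ev q.2.1 z * S.ev m x} ∩
      ({z | S.ev m z * S.ev q.2.2.1 y ≤ S.ev q.2.2.1 z * S.ev m y} ∩
      {z | S.ev m y * S.ev q.2.2.2 z ≤ S.ev q.2.2.2 y * S.ev m z})))
    (fun q => by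
      have hc := S.continuous_ev
      refine isClosed_iInter fun m => IsClosed.inter ?_ (IsClosed.inter ?_ (IsClosed.inter ?_ ?_))
      all_goals exact isClosed_le (by fun_prop) (by fun_prop))
    (fun z hz => by
      obtain ⟨i, hi⟩ := exists_maxRatio_eq (S.ev · x) (S.ev · z)
      obtain ⟨j, hj⟩ := exists_maxRatio_eq (S.ev · z) (S.ev · x)
      obtain ⟨k, hk⟩ := exists_maxRatio_eq (S.ev · z) (S.ev · y)
      obtain ⟨l, hl⟩ := exists_maxRatio_eq (S.ev · y) (S.ev · z)
      have hz := hs hz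
      refine mem_iUnion.mpr ⟨(i, j, k, l), mem_iInter.mpr fun m => ⟨?_, ?_, ?_, ?_⟩⟩
      · exact (div_le_div_iff₀ (hz m) (hz i)).mp (hi ▸ le_maxRatio (S.ev · x) (S.ev · z) m)
      · exact (div_le_div_iff₀ (hx m) (hx j)).mp (hj ▸ le_maxRatio (S.ev · z) (S.ev · x) m)
      · exact (div_le_div_iff₀ (hy m) (hy k)).mp (hk ▸ le_maxRatio (S.ev · z) (S.ev · y) m)
      · exact (div_le_div_iff₀ (hz m) (hz l)).mp (hl ▸ le_maxRatio (S.ev · y) (S.ev · z) m))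
  have hcl : ∀ z ∈ O', ∀ m, S.ev m x * S.ev i z ≤ S.ev i x * S.ev m z ∧
      S.ev m z * S.ev j x ≤ S.ev j z * S.ev m x ∧ S.ev m z * S.ev k y ≤ S.ev k z * S.ev m y ∧
      S.ev m y * S.ev l z ≤ S.ev l y * S.ev m z := fun z hz m => by
    have := mem_iInter.mp (hcl hz) m
    exact ⟨this.1, this.2.1, this.2.2.1, this.2.2.2⟩
  have hs' := hsub.trans hs
  -- the factors cancel
  have hmul : ∀ z ∈ O', S.ev j z * S.ev k z =
      S.cr x y * (S.ev j x * S.ev k y / (S.ev i x * S.ev l y)) * (S.ev i z * S.ev l z) := by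
    intro z hz
    have hzd := hs' hz
    have h1 : S.cr x z = S.ev i x / S.ev i z * (S.ev j z / S.ev j x) := by
      unfold cr
      rw [maxRatio_eq i fun m => (div_le_div_iff₀ (hzd m) (hzd i)).mpr (hcl z hz m).1,
        maxRatio_eq j fun m => (div_le_div_iff₀ (hx m) (hx j)).mpr (hcl z hz m).2.1]
    have h2 : S.cr z y = S.ev k z / S.ev k y * (S.ev l y / S.ev l z) := by
      unfold cr
      rw [maxRatio_eq k fun m => (div_le_div_iff₀ (hy m) (hy k)).mpr (hcl z hz m).2.2.1,
        maxRatio_eq l fun m => (div_le_div_iff₀ (hzd m) (hzd l)).mpr (hcl z hz m).2.2.2]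
    rw [← h z (hsub hz), h1, h2]
    have := (hx i).ne'
    have := (hx j).ne'
    have := (hy k).ne'
    have := (hy l).ne'
    have := (hzd i).ne'
    have := (hzd l).ne'
    field_simp
  have hms := S.multiset_eq_of_prod_eq hO' hne' hs' (s := {j, k}) (t := {i, l}) (by simpa using hmul)
  have key1 : ∀ m, m ≠ i → ∃ z ∈ O', S.ev m x * S.ev i z < S.ev i x * S.ev m z := by
    intro m hm
    by_contra! hcon
    refine hm (S.eq_of_ev_eq_mul hO' hne' hs' (C := S.ev m x / S.ev i x) fun z hz => ?_)
    have := (hx i).ne'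
    field_simp
    linarith [hcon z hz, (hcl z hz m).1]
  have key2 : ∀ m, m ≠ j → ∃ z ∈ O', S.ev m z * S.ev j x < S.ev j z * S.ev m x := by
    intro m hm
    by_contra! hcon
    refine hm (S.eq_of_ev_eq_mul hO' hne' hs' (C := S.ev m x / S.ev j x) fun z hz => ?_)
    have := (hx j).ne'
    field_simp
    linarith [hcon z hz, (hcl z hz m).2.1]
  obtain ⟨rfl, rfl⟩ : k = i ∧ l = j := by
    have h' : (j = i ∧ k = l) ∨ (k = i ∧ j = l) := by
      have := (Multiset.cons_eq_cons).mp hms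
      rcases this with ⟨h1, h2⟩ | ⟨-, cs, h1, h2⟩
      · exact .inl ⟨h1, by simpa using h2⟩
      · have h3 := congrArg Multiset.card h1
        simp at h3
        subst h3
        simp at h1 h2
        exact .inr ⟨h1, h2.symm⟩
    rcases h' with ⟨rfl, -⟩ | ⟨h1, h2⟩
    · obtain ⟨m, hm⟩ := exists_ne j
      obtain ⟨z, hz, hlt⟩ := key1 m hm
      have := (hcl z hz m).2.1
      linarith
    · exact ⟨h1, h2.symm⟩
  refine ⟨k, l, hx, hy, fun m hm => ?_, fun m hm => ?_⟩
  · obtain ⟨z, hz, hlt⟩ := key1 m hm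
    have h3 := (hcl z hz m).2.2.1
    have hz' := hs' hz
    have e1 := mul_lt_mul_of_pos_right hlt (hy k)
    have e2 := mul_le_mul_of_nonneg_left h3 (hx k).le
    dsimp only
    by_contra! hcon
    linarith [mul_le_mul_of_nonneg_left hcon (hz' k).le]
  · obtain ⟨z, hz, hlt⟩ := key2 m hm
    have h3 := (hcl z hz m).2.2.2
    have hz' := hs' hz
    have e1 := mul_lt_mul_of_pos_right hlt (hy l)
    have e2 := mul_le_mul_of_nonneg_left h3 (hx l).le
    dsimp only
    by_contra! hcon
    linarith [mul_le_mul_of_nonneg_left hcon (hz' l).le]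

lemma exists_open_of_chord {i j : ι} {x y : E} (h : (x, y) ∈ S.chord i j) :
    ∃ O, IsOpen O ∧ O.Nonempty ∧ O ⊆ S.dom ∧ ∀ z ∈ O, S.cr x z * S.cr z y = S.cr x y := by
  refine ⟨{z | (x, z) ∈ S.chord i j ∧ (z, y) ∈ S.chord i j}, ?_, ⟨x + (1 / 2 : ℝ) • (y - x), ?_⟩,
    fun z hz => hz.1.2.1, fun z hz => ?_⟩
  · exact ((S.isOpen_chord i j).preimage (by fun_prop)).inter
      ((S.isOpen_chord i j).preimage (by fun_prop))
  · obtain ⟨hx, hy, h1, h2⟩ := h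
    have hm := S.segment_mem_dom hx (fun i => (hy i).le) (t := 1 / 2) (by norm_num) (by norm_num)
    refine ⟨⟨hx, hm, fun k hk => ?_, fun k hk => ?_⟩, hm, hy, fun k hk => ?_, fun k hk => ?_⟩
    all_goals
      dsimp only at *
      rw [ev_segment, ev_segment]
      try have := h1 k hk
      try have := h2 k hk
      linarith
  · rw [S.chord_cr hz.1, S.chord_cr hz.2, S.chord_cr h]
    have hzd := hz.1.2.1
    have := (hzd i).ne'
    have := (hzd j).ne'
    dsimp only at *
    field_simp

end FacetSystem

namespace FacetSystem

variable {E ι : Type*} [NormedAddCommGroup E] [NormedSpace ℝ E]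
  (S : FacetSystem E ι)

lemma convex_facet (i : ι) : Convex ℝ (S.facet i) := by
  intro x hx y hy a b ha hb hab
  have he : ∀ k, S.ev k (a • x + b • y) = a * S.ev k x + b * S.ev k y := fun k => by
    simp only [ev, map_add, map_smul, smul_eq_mul]
    linear_combination (-S.b k) * hab
  refine ⟨by simp [he, hx.1, hy.1], fun j hj => ?_⟩
  rw [he]
  have h1 := hx.2 j hj
  have h2 := hy.2 j hj
  rcases ha.eq_or_lt with rfl | ha
  · rw [zero_add] at hab; subst hab; simpa using h2
  · positivity

lemma mem_chord_of_facets {i j : ι} (hij : i ≠ j) {a b : E} (ha : a ∈ S.facet i)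
    (hb : b ∈ S.facet j) {s t : ℝ} (hs : 0 < s) (hst : s < t) (ht : t < 1) :
    (b + s • (a - b), b + t • (a - b)) ∈ S.chord i j := by
  have hpos : ∀ r : ℝ, 0 < r → r < 1 → b + r • (a - b) ∈ S.dom := fun r h0 h1 k => by
    rw [ev_segment]
    have h1' : 0 < 1 - r := by linarith
    by_cases hk : k = i
    · subst hk
      rw [ha.1]
      have := mul_pos h1' (hb.2 k hij)
      linarith
    · have := mul_pos h0 (ha.2 k hk)
      by_cases hk' : k = j
      · subst hk'; rw [hb.1]; linarith
      · have := mul_pos h1' (hb.2 k hk'); linarith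
  refine ⟨hpos s hs (hst.trans ht), hpos t (hs.trans hst) ht, fun k hk => ?_, fun k hk => ?_⟩
  · dsimp only
    simp only [ev_segment, ha.1]
    have := mul_pos (mul_pos (ha.2 k hk) (hb.2 i hij)) (sub_pos.mpr hst)
    nlinarith
  · dsimp only
    simp only [ev_segment, hb.1]
    have := mul_pos (mul_pos (hb.2 k hk) (ha.2 j hij.symm)) (sub_pos.mpr hst)
    nlinarith

lemma chord_nonempty {i j : ι} (hij : i ≠ j) : (S.chord i j).Nonempty :=
  ⟨_, S.mem_chord_of_facets hij (S.pt_mem i) (S.pt_mem j) (s := 1 / 3) (t := 2 / 3)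
    (by norm_num) (by norm_num) (by norm_num)⟩

lemma visible_nonempty {i j : ι} (hij : i ≠ j) : (S.visible i j).Nonempty :=
  let ⟨p, hp⟩ := S.chord_nonempty hij
  ⟨p.1, p.2, hp⟩

lemma exists_facets_of_mem_chord {i j : ι} (hij : i ≠ j) {x y : E} (h : (x, y) ∈ S.chord i j) :
    ∃ a ∈ S.facet i, ∃ b ∈ S.facet j, ∃ s t : ℝ, 0 < s ∧ s < t ∧ t < 1 ∧
      x = b + s • (a - b) ∧ y = b + t • (a - b) := by
  obtain ⟨hx, hy, h1, h2⟩ := h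
  dsimp only at hx hy h1 h2
  have hne : x ≠ y := by
    rintro rfl
    have := h1 j hij.symm
    linarith
  have hi : S.ev i y < S.ev i x := by
    obtain ⟨k, hk⟩ := S.exists_ev_lt hne.symm
    by_cases hki : k = i
    · exact hki ▸ hk
    · have := h1 k hki
      have := hx k; have := hx i; have := hy i; have := hy k
      by_contra! hcon
      nlinarith
  have hj : S.ev j x < S.ev j y := by
    obtain ⟨k, hk⟩ := S.exists_ev_lt hne
    by_cases hki : k = j
    · exact hki ▸ hk
    · have := h2 k hki
      have := hx k; have := hx j; have := hy j; have := hy k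
      by_contra! hcon
      nlinarith
  have hi' := sub_pos.mpr hi
  have hj' := sub_pos.mpr hj
  set α := S.ev i x / (S.ev i x - S.ev i y) with hα
  set q := S.ev j x / (S.ev j y - S.ev j x) with hq
  have hq0 : 0 < q := div_pos (hx j) hj'
  have hα1 : 1 < α := by rw [hα, one_lt_div hi']; linarith [hy i]
  have hab : x + α • (y - x) - (x + (-q) • (y - x)) = (α + q) • (y - x) := by module
  refine ⟨x + α • (y - x), ⟨?_, fun k hk => ?_⟩, x + (-q) • (y - x), ⟨?_, fun k hk => ?_⟩,
    q / (α + q), (1 + q) / (α + q), by positivity, ?_, ?_, ?_, ?_⟩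
  · rw [ev_segment, hα]; field_simp; ring
  · rw [ev_segment]
    have h3 := h1 k hk
    have : (1 - α) * S.ev k x + α * S.ev k y =
        (S.ev i x * S.ev k y - S.ev k x * S.ev i y) / (S.ev i x - S.ev i y) := by
      rw [hα]; field_simp; ring
    rw [this]
    exact div_pos (by linarith) hi'
  · rw [ev_segment, hq]; field_simp; ring
  · rw [ev_segment]
    have h3 := h2 k hk
    have : (1 - -q) * S.ev k x + -q * S.ev k y =
        (S.ev k x * S.ev j y - S.ev j x * S.ev k y) / (S.ev j y - S.ev j x) := by
      rw [hq]; field_simp; ring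
    rw [this]
    exact div_pos (by linarith) hj'
  · gcongr; linarith
  · rw [div_lt_one (by positivity)]; linarith
  · rw [hab, smul_smul, div_mul_cancel₀ _ (by positivity)]; module
  · rw [hab, smul_smul, div_mul_cancel₀ _ (by positivity)]; module

lemma isPreconnected_chord {i j : ι} (hij : i ≠ j) : IsPreconnected (S.chord i j) := by
  let K : Set (E × E × ℝ × ℝ) := S.facet i ×ˢ S.facet j ×ˢ {p | 0 < p.1 ∧ p.1 < p.2 ∧ p.2 < 1}
  have hK : Convex ℝ K := by
    refine (S.convex_facet i).prod ((S.convex_facet j).prod ?_)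
    rintro ⟨s, t⟩ ⟨h1, h2, h3⟩ ⟨s', t'⟩ ⟨h1', h2', h3'⟩ a b ha hb hab
    dsimp only at *
    rcases ha.eq_or_lt with rfl | ha
    · rw [zero_add] at hab; subst hab; simpa using ⟨h1', h2', h3'⟩
    · simp only [Prod.smul_mk, Prod.mk_add_mk, mem_ofPred_eq, smul_eq_mul]
      refine ⟨by positivity, by nlinarith, by nlinarith⟩
  have : S.chord i j = (fun p : E × E × ℝ × ℝ =>
      (p.2.1 + p.2.2.1 • (p.1 - p.2.1), p.2.1 + p.2.2.2 • (p.1 - p.2.1))) '' K := by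
    ext ⟨x, y⟩
    constructor
    · intro h
      obtain ⟨a, ha, b, hb, s, t, h1, h2, h3, rfl, rfl⟩ := S.exists_facets_of_mem_chord hij h
      exact ⟨(a, b, s, t), ⟨ha, hb, h1, h2, h3⟩, rfl⟩
    · rintro ⟨⟨a, b, s, t⟩, ⟨ha, hb, h1, h2, h3⟩, hp⟩
      rw [← hp]
      exact S.mem_chord_of_facets hij ha hb h1 h2 h3
  rw [this]
  exact hK.isPreconnected.image _ (by fun_prop)

lemma isPreconnected_visible {i j : ι} (hij : i ≠ j) : IsPreconnected (S.visible i j) := by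
  have : S.visible i j = Prod.fst '' S.chord i j := by
    ext x; simp [visible]
  rw [this]
  exact (S.isPreconnected_chord hij).image _ continuous_fst.continuousOn

lemma visible_subset (i j : ι) : S.visible i j ⊆ S.dom := fun _ ⟨_, h⟩ => h.1

variable {S} [Fintype ι] [Nontrivial ι] [FiniteDimensional ℝ E] {f g : E → E}

lemma IsIsom.exists_chord (h : S.IsIsom f g) {i j : ι} (hij : i ≠ j) :
    ∃ k l, ∀ x y, (x, y) ∈ S.chord i j → (f x, f y) ∈ S.chord k l := by
  have : CompleteSpace E := FiniteDimensional.complete ℝ E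
  have hex : ∀ p ∈ S.chord i j, ∃ k l, (f p.1, f p.2) ∈ S.chord k l := fun p hp => by
    obtain ⟨O, hO, ⟨z, hz⟩, hs, hcr⟩ := S.exists_open_of_chord hp
    refine S.exists_chord_of_cr_mul (h.mapsTo _ hp.1) (h.mapsTo _ hp.2.1) (h.isOpen_image hO hs)
      ⟨_, mem_image_of_mem f hz⟩ ?_ ?_
    · rintro _ ⟨z, hz, rfl⟩
      exact h.mapsTo z (hs hz)
    · rintro _ ⟨z, hz, rfl⟩
      rw [h.cr_map _ hp.1 _ (hs hz), h.cr_map _ (hs hz) _ hp.2.1, h.cr_map _ hp.1 _ hp.2.1]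
      exact hcr z hz
  obtain ⟨p, hp⟩ := S.chord_nonempty hij
  obtain ⟨k, l, hkl⟩ := hex p hp
  refine ⟨k, l, fun x y hxy => ?_⟩
  have hF : ContinuousOn (fun p : E × E => (f p.1, f p.2)) (S.chord i j) := fun q hq =>
    (ContinuousAt.prodMk ((h.continuousAt hq.1).comp continuousAt_fst)
      ((h.continuousAt hq.2.1).comp continuousAt_snd)).continuousWithinAt
  have hpre := (S.isPreconnected_chord hij).image _ hF
  have hmem : (f p.1, f p.2) ∈ (fun p : E × E => (f p.1, f p.2)) '' S.chord i j := ⟨p, hp, rfl⟩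
  have hsub := hpre.subset_left_of_subset_union (S.isOpen_chord k l)
    (v := ⋃ q : {q : ι × ι // q ≠ (k, l)}, S.chord q.1.1 q.1.2)
    (isOpen_iUnion fun q => S.isOpen_chord _ _) ?_ ?_ ⟨_, hmem, hkl⟩
  · exact hsub ⟨(x, y), hxy, rfl⟩
  · rw [disjoint_iUnion_right]
    rintro ⟨q, hq⟩
    rw [Set.disjoint_left]
    intro z hz hz'
    obtain ⟨h1, h2⟩ := S.eq_of_mem_chord hz hz'
    exact hq (Prod.ext h1.symm h2.symm)
  · rintro _ ⟨q, hq, rfl⟩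
    obtain ⟨k', l', h'⟩ := hex q hq
    by_cases hkl' : (k', l') = (k, l)
    · obtain ⟨rfl, rfl⟩ := Prod.mk.inj hkl'
      exact .inl h'
    · exact .inr (mem_iUnion.mpr ⟨⟨(k', l'), hkl'⟩, h'⟩)

/-- A self-isometry permutes the types of chords. -/
lemma IsIsom.exists_index (h : S.IsIsom f g) :
    ∃ s : ι → ι → ι, ∀ i j, i ≠ j → s i j ≠ s j i ∧
      ∀ x y, (x, y) ∈ S.chord i j → (f x, f y) ∈ S.chord (s i j) (s j i) := by
  choose k l hkl using fun q : {q : ι × ι // q.1 ≠ q.2} => h.exists_chord q.2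
  classical
  let s : ι → ι → ι := fun i j => if hij : i ≠ j then k ⟨(i, j), hij⟩ else i
  have hmap : ∀ i j, i ≠ j → ∀ x y, (x, y) ∈ S.chord i j → (f x, f y) ∈ S.chord (s i j) (s j i) := by
    intro i j hij x y hxy
    have h1 := hkl ⟨(i, j), hij⟩ x y hxy
    have h2 := hkl ⟨(j, i), hij.symm⟩ y x (S.chord_symm hxy)
    have h3 := S.eq_of_mem_chord h1 (S.chord_symm h2)
    simp only [s, dif_pos hij, dif_pos hij.symm]
    rw [h3.2] at h1
    exact h1
  refine ⟨s, fun i j hij => ⟨?_, hmap i j hij⟩⟩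
  obtain ⟨p, hp⟩ := S.chord_nonempty hij
  exact S.chord_ne (hmap i j hij _ _ hp)

lemma IsIsom.exists_const (h : S.IsIsom f g) {s : ι → ι → ι}
    (hs : ∀ i j, i ≠ j → s i j ≠ s j i ∧
      ∀ x y, (x, y) ∈ S.chord i j → (f x, f y) ∈ S.chord (s i j) (s j i)) :
    ∃ C : ι → ι → ℝ, ∀ i j, i ≠ j → 0 < C i j ∧ C i j * C j i = 1 ∧ ∀ x ∈ S.visible i j,
      S.ev (s i j) (f x) * S.ev j x = C i j * S.ev i x * S.ev (s j i) (f x) := by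
  set ψ : ι → ι → E → ℝ := fun i j x => S.ev (s i j) (f x) / S.ev (s j i) (f x) *
    (S.ev j x / S.ev i x) with hψ
  have hchord : ∀ i j, i ≠ j → ∀ x y, (x, y) ∈ S.chord i j → ψ i j x = ψ i j y := by
    intro i j hij x y hxy
    have h1 := S.chord_cr hxy
    rw [← h.cr_map x hxy.1 y hxy.2.1, S.chord_cr ((hs i j hij).2 x y hxy)] at h1
    have hx := h.mapsTo x hxy.1
    have hy := h.mapsTo y hxy.2.1
    have := (hx (s i j)).ne'
    have := (hx (s j i)).ne'
    have := (hy (s i j)).ne'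
    have := (hy (s j i)).ne'
    have := (hxy.1 i).ne'
    have := (hxy.1 j).ne'
    have := (hxy.2.1 i).ne'
    have := (hxy.2.1 j).ne'
    simp only [hψ]
    dsimp only at *
    field_simp at h1 ⊢
    linarith
  have hconst : ∀ i j, i ≠ j → ∀ x ∈ S.visible i j, ∀ y ∈ S.visible i j, ψ i j x = ψ i j y := by
    intro i j hij x hx y hy
    refine (S.isPreconnected_visible hij).induction₂ (fun x y => ψ i j x = ψ i j y) ?_
      (fun _ _ _ _ _ _ => Eq.trans) (fun _ _ _ _ => Eq.symm) hx hy
    rintro x ⟨y, hxy⟩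
    have hc : Continuous fun z : E => (z, y) := by fun_prop
    filter_upwards [nhdsWithin_le_nhds (((S.isOpen_chord i j).preimage hc).mem_nhds hxy)] with z hz
    exact (hchord i j hij x y hxy).trans (hchord i j hij z y hz).symm
  have hpos : ∀ i j, ∀ x ∈ S.dom, 0 < ψ i j x := fun i j x hx =>
    mul_pos (div_pos (h.mapsTo x hx _) (h.mapsTo x hx _)) (div_pos (hx _) (hx _))
  have hp : ∀ i j, ∃ p, i ≠ j → p ∈ S.visible i j := fun i j => by
    by_cases hij : i = j
    · exact ⟨S.center, fun hne => absurd hij hne⟩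
    · exact ⟨_, fun _ => (S.visible_nonempty hij).some_mem⟩
  choose p hp using hp
  refine ⟨fun i j => ψ i j (p i j), fun i j hij => ⟨hpos i j _ (S.visible_subset _ _ (hp i j hij)),
    ?_, fun x hx => ?_⟩⟩
  · have h1 := hconst i j hij _ (hp i j hij) _ (S.visible_symm (hp j i hij.symm))
    have hd := S.visible_subset _ _ (hp j i hij.symm)
    have hfd := h.mapsTo _ hd
    dsimp only
    rw [h1]
    simp only [hψ]
    have := (hd i).ne'
    have := (hd j).ne'
    have := (hfd (s i j)).ne'
    have := (hfd (s j i)).ne'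
    field_simp
  · have hd := S.visible_subset _ _ hx
    have := (hd i).ne'
    have := (h.mapsTo x hd (s j i)).ne'
    dsimp only
    rw [← hconst i j hij x hx _ (hp i j hij)]
    simp only [hψ]
    field_simp

end FacetSystem

lemma Continuous.eventually_lt_nhdsGT_zero {u w : ℝ → ℝ} (hu : Continuous u) (hw : Continuous w)
    (h : u 0 < w 0) : ∀ᶠ t in 𝓝[>] (0 : ℝ), u t < w t :=
  (hu.continuousAt.eventually_lt hw.continuousAt h).filter_mono nhdsWithin_le_nhds

namespace FacetSystem

variable {E ι : Type*} [NormedAddCommGroup E] [NormedSpace ℝ E]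
  (S : FacetSystem E ι)

/-- The relative interior of the intersection of two adjacent facets. -/
def ridge (j l : ι) : Set E :=
  {r | S.ev j r = 0 ∧ S.ev l r = 0 ∧ ∀ k, k ≠ j → k ≠ l → 0 < S.ev k r}

/-- Two distinct facets are adjacent if they share a ridge. -/
def adj (j l : ι) : Prop := j ≠ l ∧ (S.ridge j l).Nonempty

lemma adj_symm {j l : ι} (h : S.adj j l) : S.adj l j :=
  let ⟨hne, r, h1, h2, h3⟩ := h
  ⟨hne.symm, r, h2, h1, fun k hk hk' => h3 k hk' hk⟩

variable [Finite ι]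

/-- Near the ridge of two adjacent facets `j` and `l` there are points lying on chords that join
each two of the facets `i`, `j` and `l`. -/
lemma exists_mem_visible {i j l : ι} (hij : i ≠ j) (hil : i ≠ l) (h : S.adj j l) :
    ∃ x, x ∈ S.visible i j ∧ x ∈ S.visible i l ∧ x ∈ S.visible j l := by
  obtain ⟨hjl, r, hrj, hrl, hr⟩ := h
  have hri := hr i hij hil
  have hi0 := (S.pt_mem i).1
  have hi := (S.pt_mem i).2
  have hj0 := (S.pt_mem j).1
  have hj := (S.pt_mem j).2
  set v := S.ev i r • (S.pt j - r) + (S.ev i (S.pt j) - S.ev i r) • (S.pt i - r) with hv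
  have hAv : ∀ k, S.A k v = S.ev i r * (S.ev k (S.pt j) - S.ev k r) +
      (S.ev i (S.pt j) - S.ev i r) * (S.ev k (S.pt i) - S.ev k r) := fun k => by
    simp only [hv, map_add, map_smul, map_sub, smul_eq_mul, ev]; ring
  obtain ⟨ε, hε, hp'⟩ : ∃ ε : ℝ, 0 < ε ∧ S.pt i + ε • v ∈ S.facet i := by
    have : ∀ᶠ t : ℝ in 𝓝[>] (0 : ℝ), ∀ k, k ≠ i → 0 < S.ev k (S.pt i + t • v) := by
      refine eventually_all.mpr fun k => ?_
      by_cases hk : k = i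
      · exact .of_forall fun _ hne => absurd hk hne
      · have hc : Continuous fun t : ℝ => S.ev k (S.pt i + t • v) :=
          (S.continuous_ev k).comp (by fun_prop)
        filter_upwards [continuous_const.eventually_lt_nhdsGT_zero hc
          (by simpa using hi k hk)] with t ht _ using ht
    obtain ⟨ε, h1, h2⟩ := (this.and self_mem_nhdsWithin).exists
    refine ⟨ε, h2, ?_, h1⟩
    rw [ev_add_smul, hAv, hi0]; ring
  set p' := S.pt i + ε • v with hp'def
  have hslope : S.ev j p' * S.ev l (S.pt i) < S.ev l p' * S.ev j (S.pt i) := by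
    simp only [hp'def, ev_add_smul, hAv, hj0, hrj, hrl]
    have := mul_pos hε (mul_pos hri (mul_pos (hj l hjl.symm) (hi j hij.symm)))
    nlinarith
  set q := S.pt i + (1 / 2 : ℝ) • (p' - S.pt i) with hq
  have hqe : ∀ k, S.ev k q = (S.ev k (S.pt i) + S.ev k p') / 2 := fun k => by
    rw [hq, ev_segment]; ring
  have hqpos : ∀ k, k ≠ i → 0 < S.ev k q := fun k hk => by
    have := hi k hk
    have := hp'.2 k hk
    rw [hqe]; positivity
  have hqi : S.ev i q = 0 := by rw [hqe, hi0, hp'.1]; simp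
  have hlim : ∀ a b : ℝ, 0 < b → ∀ m k, (k = j ∨ k = l) → m ≠ j → m ≠ l → ∀ᶠ t : ℝ in 𝓝[>] (0 : ℝ),
      a * S.ev k (r + t • (q - r)) < b * S.ev m (r + t • (q - r)) := by
    intro a b hb m k hk hmj hml
    have hc : ∀ k, Continuous fun t : ℝ => S.ev k (r + t • (q - r)) := fun k =>
      (S.continuous_ev k).comp (by fun_prop)
    refine Continuous.eventually_lt_nhdsGT_zero (by have := hc k; fun_prop)
      (by have := hc m; fun_prop) ?_
    have h0 : S.ev k r = 0 := by rcases hk with rfl | rfl <;> assumption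
    simpa [h0] using mul_pos hb (hr m hmj hml)
  have hall : ∀ᶠ t : ℝ in 𝓝[>] (0 : ℝ), ∀ m, m ≠ j → m ≠ l →
      S.ev m (S.pt i) * S.ev j (r + t • (q - r)) < S.ev j (S.pt i) * S.ev m (r + t • (q - r)) ∧
      S.ev m p' * S.ev l (r + t • (q - r)) < S.ev l p' * S.ev m (r + t • (q - r)) ∧
      S.ev m (S.pt j) * S.ev l (r + t • (q - r)) < S.ev l (S.pt j) * S.ev m (r + t • (q - r)) := by
    refine eventually_all.mpr fun m => ?_
    by_cases hmj : m = j
    · exact .of_forall fun _ hne => absurd hmj hne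
    by_cases hml : m = l
    · exact .of_forall fun _ _ hne => absurd hml hne
    filter_upwards [hlim (S.ev m (S.pt i)) _ (hi j hij.symm) m j (.inl rfl) hmj hml,
      hlim (S.ev m p') _ (hp'.2 l hil.symm) m l (.inr rfl) hmj hml,
      hlim (S.ev m (S.pt j)) _ (hj l hjl.symm) m l (.inr rfl) hmj hml] with t h1 h2 h3 _ _
    exact ⟨h1, h2, h3⟩
  obtain ⟨t, hm, ht0, ht1⟩ := (hall.and (Ioo_mem_nhdsGT zero_lt_one)).exists
  set x := r + t • (q - r) with hxdef
  have hxj : S.ev j x = t * S.ev j q := by rw [hxdef, ev_segment, hrj]; ring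
  have hxl : S.ev l x = t * S.ev l q := by rw [hxdef, ev_segment, hrl]; ring
  have hx : x ∈ S.dom := fun k => by
    by_cases hkj : k = j
    · rw [hkj, hxj]; exact mul_pos ht0 (hqpos j hij.symm)
    by_cases hkl : k = l
    · rw [hkl, hxl]; exact mul_pos ht0 (hqpos l hil.symm)
    rw [hxdef, ev_segment]
    have h1 := mul_pos (sub_pos.mpr ht1) (hr k hkj hkl)
    by_cases hki : k = i
    · rw [hki, hqi, ← hki]; linarith
    · have := mul_pos ht0 (hqpos k hki); linarith
  refine ⟨x, S.mem_visible_of_facet hx (S.pt_mem i) fun m hmj => ?_,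
    S.mem_visible_of_facet hx hp' fun m hml => ?_,
    S.mem_visible_of_facet hx (S.pt_mem j) fun m hml => ?_⟩
  · by_cases hml : m = l
    · rw [hml, hxj, hxl, hqe, hqe]
      have := mul_lt_mul_of_pos_left hslope ht0
      linarith
    · exact (hm m hmj hml).1
  · by_cases hmj : m = j
    · rw [hmj, hxj, hxl, hqe, hqe]
      have := mul_lt_mul_of_pos_left hslope ht0
      linarith
    · exact (hm m hmj hml).2.1
  · by_cases hmj : m = j
    · rw [hmj, hj0, zero_mul]
      exact mul_pos (hj l hjl.symm) (hx j)
    · exact (hm m hmj hml).2.2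

end FacetSystem

section linearMax

variable {V ι : Type*} [AddCommGroup V] [Module ℝ V] [TopologicalSpace V] [IsTopologicalAddGroup V]
  [ContinuousSMul ℝ V] {α : ι → V →L[ℝ] ℝ} {u : ι → V}

/-- Three linear forms, each of which is somewhere strictly larger than the two others, agree on a
subspace whose complement is connected. -/
lemma isPreconnected_setOf_not_all_eq (hu : ∀ i j, j ≠ i → α j (u i) < α i (u i)) {j l m : ι}
    (hjl : j ≠ l) (hjm : j ≠ m) (hlm : l ≠ m) :
    IsPreconnected {w | ¬ (α j w = α m w ∧ α l w = α m w)} := by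
  let φ : V →ₗ[ℝ] ℝ × ℝ :=
    ((α j - α m : V →L[ℝ] ℝ) : V →ₗ[ℝ] ℝ).prod ((α l - α m : V →L[ℝ] ℝ) : V →ₗ[ℝ] ℝ)
  have hφ : Function.Surjective φ := by
    rw [← LinearMap.range_eq_top]
    by_contra hne
    obtain ⟨f, hf0, hf⟩ := Submodule.exists_le_ker_of_lt_top _ (lt_top_iff_ne_top.mpr hne)
    have hfe : ∀ x y : ℝ, f (x, y) = f (1, 0) * x + f (0, 1) * y := fun x y => by
      have : (x, y) = x • ((1 : ℝ), (0 : ℝ)) + y • ((0 : ℝ), (1 : ℝ)) := by simp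
      rw [this, map_add, map_smul, map_smul, smul_eq_mul, smul_eq_mul]
      ring
    have h0 : ∀ w, f (1, 0) * (α j w - α m w) + f (0, 1) * (α l w - α m w) = 0 := fun w => by
      rw [← hfe]
      exact hf ⟨w, rfl⟩
    set a := f (1, 0)
    set b := f (0, 1)
    have hab : a = 0 ∧ b = 0 := by
      have h1 := h0 (u j)
      have h2 := h0 (u l)
      have h3 := h0 (u m)
      have := hu j l hjl.symm
      have := hu j m hjm.symm
      have := hu l j hjl
      have := hu l m hlm.symm
      have := hu m j hjm
      have := hu m l hlm
      have key : ∀ a b p q : ℝ, a * p + b * q = 0 → p < 0 → q < 0 →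
          (a ≤ 0 ∧ b ≤ 0 ∨ 0 ≤ a ∧ 0 ≤ b) → a = 0 ∧ b = 0 := by
        rintro a b p q h hp hq (⟨ha, hb⟩ | ⟨ha, hb⟩)
        · constructor <;> nlinarith [mul_nonneg_of_nonpos_of_nonpos ha hp.le,
            mul_nonneg_of_nonpos_of_nonpos hb hq.le]
        · constructor <;> nlinarith [mul_nonpos_of_nonneg_of_nonpos ha hp.le,
            mul_nonpos_of_nonneg_of_nonpos hb hq.le]
      have k1 : (a ≤ 0 ∧ b ≤ 0 ∨ 0 ≤ a ∧ 0 ≤ b) → a = 0 ∧ b = 0 :=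
        key a b _ _ h3 (by linarith) (by linarith)
      have k2 : (b ≤ 0 ∧ -(a + b) ≤ 0 ∨ 0 ≤ b ∧ 0 ≤ -(a + b)) → b = 0 ∧ -(a + b) = 0 :=
        key b (-(a + b)) (α l (u j) - α j (u j)) (α m (u j) - α j (u j)) (by linarith)
          (by linarith) (by linarith)
      have k3 : (a ≤ 0 ∧ -(a + b) ≤ 0 ∨ 0 ≤ a ∧ 0 ≤ -(a + b)) → a = 0 ∧ -(a + b) = 0 :=
        key a (-(a + b)) (α j (u l) - α l (u l)) (α m (u l) - α l (u l)) (by linarith)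
          (by linarith) (by linarith)
      rcases le_total a 0 with ha | ha <;> rcases le_total b 0 with hb | hb
      · exact k1 (.inl ⟨ha, hb⟩)
      · rcases le_total (-(a + b)) 0 with hs | hs
        · have := k3 (.inl ⟨ha, hs⟩); constructor <;> linarith
        · have := k2 (.inr ⟨hb, hs⟩); constructor <;> linarith
      · rcases le_total (-(a + b)) 0 with hs | hs
        · have := k2 (.inl ⟨hb, hs⟩); constructor <;> linarith
        · have := k3 (.inr ⟨ha, hs⟩); constructor <;> linarith
      · exact k1 (.inr ⟨ha, hb⟩)
    refine hf0 (LinearMap.ext fun p => ?_)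
    rw [← Prod.mk.eta (p := p), hfe, hab.1, hab.2]
    simp
  have hrank : 1 < Module.rank ℝ (V ⧸ LinearMap.ker φ) := by
    have : Module.finrank ℝ (V ⧸ LinearMap.ker φ) = 2 := by
      rw [(φ.quotKerEquivOfSurjective hφ).finrank_eq]; simp
    exact_mod_cast Module.lt_rank_of_lt_finrank (n := 1) (this ▸ one_lt_two)
  have := (isPathConnected_compl_of_one_lt_codim hrank).isConnected.isPreconnected
  convert this using 1
  ext w
  simp [φ, sub_eq_zero]

end linearMax

section linearMax

variable {V ι : Type*} [AddCommGroup V] [Module ℝ V] [TopologicalSpace V] [IsTopologicalAddGroup V]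
  [ContinuousSMul ℝ V] {α : ι → V →L[ℝ] ℝ} {u : ι → V}

lemma exists_max_pair [DecidableEq ι] (hu : ∀ i j, j ≠ i → α j (u i) < α i (u i)) (A : Set ι)
    (I : Finset ι) (h1 : ∃ j ∈ I, j ∈ A) (h2 : ∃ l ∈ I, l ∉ A) :
    ∃ w, ∃ j ∈ I, j ∈ A ∧ ∃ l ∈ I, l ∉ A ∧ α j w = α l w ∧
      ∀ m ∈ I, m ≠ j → m ≠ l → α m w < α j w := by
  classical
  induction I using Finset.strongInduction with | H I ih
  obtain ⟨j, hjI, hjA⟩ := h1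
  obtain ⟨l, hlI, hlA⟩ := h2
  have hjl : j ≠ l := fun h => hlA (h ▸ hjA)
  by_cases hm : ∃ m ∈ I, m ≠ j ∧ m ≠ l
  swap
  · push Not at hm
    exact ⟨0, j, hjI, hjA, l, hlI, hlA, by simp, fun m hmI hmj hml => absurd (hm m hmI hmj) hml⟩
  obtain ⟨m, hmI, hmj, hml⟩ := hm
  have hne1 : (I.filter (· ∈ A)).Nonempty := ⟨j, by simp [hjI, hjA]⟩
  have hne2 : (I.filter (· ∉ A)).Nonempty := ⟨l, by simp [hlI, hlA]⟩
  let M1 : V → ℝ := fun w => (I.filter (· ∈ A)).sup' hne1 fun i => α i w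
  let M2 : V → ℝ := fun w => (I.filter (· ∉ A)).sup' hne2 fun i => α i w
  have hc1 : Continuous M1 := Continuous.finset_sup'_apply _ fun i _ => (α i).continuous
  have hc2 : Continuous M2 := Continuous.finset_sup'_apply _ fun i _ => (α i).continuous
  have hj12 : M2 (u j) ≤ M1 (u j) := by
    refine (Finset.sup'_le _ _ fun i hi => ?_).trans
      (Finset.le_sup' (fun i => α i (u j)) (by simp [hjI, hjA] : j ∈ I.filter (· ∈ A)))
    exact (hu j i fun h => (Finset.mem_filter.mp hi).2 (h ▸ hjA)).le
  have hl12 : M1 (u l) ≤ M2 (u l) := by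
    refine (Finset.sup'_le _ _ fun i hi => ?_).trans
      (Finset.le_sup' (fun i => α i (u l)) (by simp [hlI, hlA] : l ∈ I.filter (· ∉ A)))
    exact (hu l i fun h => hlA (h ▸ (Finset.mem_filter.mp hi).2)).le
  obtain ⟨w, hw, hw0⟩ := (isPreconnected_setOf_not_all_eq hu hjl hmj.symm hml.symm).intermediate_value
    (a := u l) (b := u j) (f := fun w => M1 w - M2 w)
    (fun h => (hu l j hjl).ne (h.1.trans h.2.symm)) (fun h => (hu j m hmj).ne h.1.symm)
    (hc1.sub hc2).continuousOn (show (0 : ℝ) ∈ Icc _ _ from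
      ⟨by simpa using hl12, by simpa using hj12⟩)
  have hM : M2 w = M1 w := by
    have : M1 w - M2 w = 0 := hw0
    linarith
  have hle : ∀ i ∈ I, α i w ≤ M1 w := fun i hi => by
    by_cases hA : i ∈ A
    · exact Finset.le_sup' (fun i => α i w) (by simp [hi, hA] : i ∈ I.filter (· ∈ A))
    · exact hM ▸ Finset.le_sup' (fun i => α i w) (by simp [hi, hA] : i ∈ I.filter (· ∉ A))
  obtain ⟨j', hj', hj'e⟩ := Finset.exists_mem_eq_sup' hne1 fun i => α i w
  obtain ⟨l', hl', hl'e⟩ := Finset.exists_mem_eq_sup' hne2 fun i => α i w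
  rw [Finset.mem_filter] at hj' hl'
  have hj'e : α j' w = M1 w := hj'e.symm
  have hl'e : α l' w = M1 w := hl'e.symm.trans hM
  obtain ⟨w', j₁, hj₁, hj₁A, l₁, hl₁, hl₁A, he, hlt⟩ := ih (I.filter fun i => α i w = M1 w) (by
      refine Finset.filter_ssubset.mpr ?_
      by_contra! hcon
      exact hw ⟨(hcon j hjI).trans (hcon m hmI).symm, (hcon l hlI).trans (hcon m hmI).symm⟩)
    ⟨j', by simp [hj'.1, hj'e], hj'.2⟩ ⟨l', by simp [hl'.1, hl'e], hl'.2⟩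
  rw [Finset.mem_filter] at hj₁ hl₁
  have hall : ∀ᶠ t : ℝ in 𝓝[>] (0 : ℝ), ∀ m ∈ I, m ≠ j₁ → m ≠ l₁ →
      α m (w + t • w') < α j₁ (w + t • w') := by
    refine (eventually_all_finset I).mpr fun m hm => ?_
    by_cases hmj : m = j₁
    · exact .of_forall fun _ hne => absurd hmj hne
    by_cases hml : m = l₁
    · exact .of_forall fun _ _ hne => absurd hml hne
    rcases (hle m hm).eq_or_lt with hmM | hmM
    · have h3 := hlt m (by simp [hm, hmM]) hmj hml
      filter_upwards [self_mem_nhdsWithin] with t ht _ _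
      have := mul_lt_mul_of_pos_left h3 (show 0 < t from ht)
      simp only [map_add, map_smul, smul_eq_mul]
      linarith [hj₁.2]
    · have hc : ∀ i, Continuous fun t : ℝ => α i (w + t • w') := fun i =>
        (α i).continuous.comp (by fun_prop)
      filter_upwards [(hc m).eventually_lt_nhdsGT_zero (hc j₁)
        (by simpa [hj₁.2] using hmM)] with t ht _ _ using ht
  obtain ⟨t, ht⟩ := hall.exists
  refine ⟨w + t • w', j₁, hj₁.1, hj₁A, l₁, hl₁.1, hl₁A, ?_, ht⟩
  simp only [map_add, map_smul, hj₁.2, hl₁.2, he]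

end linearMax

namespace FacetSystem

variable {E ι : Type*} [NormedAddCommGroup E] [NormedSpace ℝ E] [Fintype ι]
  (S : FacetSystem E ι)

/-- The adjacency graph of the facets is connected. -/
lemma exists_adj (hcard : 2 < Fintype.card ι) (A : Set ι) (h1 : A.Nonempty) (h2 : Aᶜ.Nonempty) :
    ∃ j ∈ A, ∃ l ∉ A, S.adj j l := by
  classical
  set α : ι → E →L[ℝ] ℝ := fun i => -(S.ev i S.center)⁻¹ • S.A i with hα
  have hev : ∀ i v, S.ev i (S.center + v) = S.ev i S.center * (1 - α i v) := fun i v => by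
    have := S.ev_add_smul i S.center v 1
    have h0 := (S.ev_center i).ne'
    rw [one_smul, one_mul] at this
    rw [this]
    simp [hα]
    field_simp
  have hαpt : ∀ i j, α j (S.pt i - S.center) = 1 - S.ev j (S.pt i) / S.ev j S.center :=
      fun i j => by
    have := hev j (S.pt i - S.center)
    rw [add_sub_cancel] at this
    have h0 := (S.ev_center j).ne'
    rw [this]; field_simp; ring
  have hu : ∀ i j, j ≠ i → α j (S.pt i - S.center) < α i (S.pt i - S.center) := by
    intro i j hji
    rw [hαpt, hαpt, (S.pt_mem i).1]
    have := div_pos ((S.pt_mem i).2 j hji) (S.ev_center j)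
    simp [this]
  obtain ⟨w, j, -, hj, l, -, hl, he, hlt⟩ := exists_max_pair hu A Finset.univ
    (by simpa using! h1) (by simpa using! h2)
  have hjl : j ≠ l := fun h => hl (h ▸ hj)
  obtain ⟨m, hm⟩ : ∃ m, m ∉ ({j, l} : Finset ι) := by
    by_contra! hcon
    have h3 := Finset.card_le_card (fun i _ => hcon i : Finset.univ ⊆ ({j, l} : Finset ι))
    rw [Finset.card_univ] at h3
    exact absurd (h3.trans Finset.card_le_two) (by omega)
  simp only [Finset.mem_insert, Finset.mem_singleton, not_or] at hm
  have hlt' := hlt m (Finset.mem_univ m) hm.1 hm.2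
  have hw : w ≠ 0 := by rintro rfl; simp at hlt'
  have hpos : 0 < α j w := by
    by_contra! hcon
    refine hw (S.eq_zero_of_nonneg w fun i => ?_)
    have h3 : α i w ≤ 0 := by
      by_cases hij : i = j
      · exact hij ▸ hcon
      by_cases hil : i = l
      · exact hil ▸ he ▸ hcon
      · exact (hlt i (Finset.mem_univ i) hij hil).le.trans hcon
    have h4 := S.ev_center i
    simp only [hα, smul_apply, smul_eq_mul, neg_mul] at h3
    have := inv_pos.mpr h4
    by_contra! hneg
    nlinarith
  refine ⟨j, hj, l, hl, hjl, S.center + (α j w)⁻¹ • w, ?_, ?_, fun k hkj hkl => ?_⟩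
  · rw [hev, map_smul, smul_eq_mul, inv_mul_cancel₀ hpos.ne']; simp
  · rw [hev, map_smul, smul_eq_mul, ← he, inv_mul_cancel₀ hpos.ne']; simp
  · rw [hev, map_smul, smul_eq_mul]
    refine mul_pos (S.ev_center k) (sub_pos.mpr ?_)
    rw [inv_mul_lt_one₀ hpos]
    exact hlt k (Finset.mem_univ k) hkj hkl

end FacetSystem

section Combinatorics

lemma Multiset.eq_or_eq_of_pair_eq {α : Type*} {a b p q : α}
    (h : ({a, b} : Multiset α) = {p, q}) : a = p ∧ b = q ∨ a = q ∧ b = p := by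
  rcases Multiset.cons_eq_cons.mp h with ⟨h1, h2⟩ | ⟨-, cs, h1, h2⟩
  · exact .inl ⟨h1, by simpa using h2⟩
  · have h3 := congrArg Multiset.card h1
    simp at h3
    subst h3
    simp at h1 h2
    exact .inr ⟨h2.symm, h1⟩

lemma Multiset.cyclic_of_triple_eq {α : Type*} {a b c p q r : α}
    (h : ({a, b, c} : Multiset α) = {p, q, r}) (h1 : a ≠ p) (h2 : b ≠ q) (h3 : c ≠ r) :
    a = r ∧ b = p ∧ c = q ∨ a = q ∧ b = r ∧ c = p := by
  have ha : a ∈ ({p, q, r} : Multiset α) := h ▸ by simp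
  simp only [Multiset.insert_eq_cons, Multiset.mem_cons, Multiset.mem_singleton, h1,
    false_or] at ha
  rcases ha with rfl | rfl
  · have h' : ({b, c} : Multiset α) = {p, r} := by
      simp only [Multiset.insert_eq_cons] at h ⊢
      rwa [Multiset.cons_swap p, Multiset.cons_inj_right] at h
    have := Multiset.eq_or_eq_of_pair_eq h'
    grind
  · have h' : ({b, c} : Multiset α) = {p, q} := by
      have hr : ({p, q, a} : Multiset α) = a ::ₘ {p, q} := by
        simp only [Multiset.insert_eq_cons]
        rw [← Multiset.cons_zero a, Multiset.cons_swap q, Multiset.cons_swap p, Multiset.cons_zero]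
      rwa [hr, Multiset.insert_eq_cons, Multiset.cons_inj_right] at h
    have := Multiset.eq_or_eq_of_pair_eq h'
    grind

variable {ι κ : Type*}

/-- On the triple `i, j, l`, the map `s` depends only on its first argument. -/
def FirstOnly (s : ι → ι → κ) (i j l : ι) : Prop := s i j = s i l ∧ s j l = s j i ∧ s l i = s l j

variable {R : ι → ι → Prop} {s : ι → ι → κ}

lemma not_mixed (hne : ∀ i j, i ≠ j → s i j ≠ s j i) {j l m k : ι} (hml : m ≠ l)
    (hkl : k ≠ l) (h1 : FirstOnly s k j l) (h2 : FirstOnly (Function.swap s) m j l)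
    (h3 : FirstOnly s m j k ∨ FirstOnly (Function.swap s) m j k) : False := by
  have := hne m l hml
  have := hne k l hkl
  simp only [FirstOnly, Function.swap] at *
  grind

lemma FirstOnly.perm {i j l : ι} (h : FirstOnly s i j l) :
    FirstOnly s i l j ∧ FirstOnly s j i l ∧ FirstOnly s j l i ∧ FirstOnly s l i j ∧
      FirstOnly s l j i := by
  simp only [FirstOnly] at *
  grind

lemma uniform_aux (hR : ∀ j l, R j l → j ≠ l ∧ R l j)
    (hcut : ∀ A : Set ι, A.Nonempty → Aᶜ.Nonempty → ∃ j ∈ A, ∃ l ∉ A, R j l)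
    (hne : ∀ i j, i ≠ j → s i j ≠ s j i)
    (H : ∀ i j l, R j l → i ≠ j → i ≠ l → FirstOnly s i j l ∨ FirstOnly (Function.swap s) i j l)
    {i m j l : ι} (hjl : R j l) (hij : i ≠ j) (hil : i ≠ l) (hmj : m ≠ j) (hml : m ≠ l)
    (hi : FirstOnly s i j l) (hm : FirstOnly (Function.swap s) m j l) : False := by
  obtain ⟨a, ha, k, hk, hak⟩ := hcut {j, l} ⟨j, by simp⟩ ⟨i, by simp [hij, hil]⟩
  have hne' := (hR j l hjl).1
  have hkj : k ≠ j := fun h => hk (by simp [h])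
  have hkl : k ≠ l := fun h => hk (by simp [h])
  have hsw : ∀ i j, i ≠ j → Function.swap s i j ≠ Function.swap s j i := fun i j hij =>
    hne j i hij.symm
  rcases H k j l hjl hkj hkl with hkd | hkr
  · have hmk : m ≠ k := by
      rintro rfl
      have := hne j l hne'
      simp only [FirstOnly, Function.swap] at *
      grind
    rcases ha with rfl | rfl
    · exact not_mixed hne hml hkl hkd hm (H m _ k hak hmj hmk)
    · exact not_mixed hne hmj hkj hkd.perm.1 hm.perm.1 (H m _ k hak hml hmk)
  · have hik : i ≠ k := by
      rintro rfl
      have := hne j l hne'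
      simp only [FirstOnly, Function.swap] at *
      grind
    rcases ha with rfl | rfl
    · exact not_mixed hsw hil hkl hkr hi (H i _ k hak hij hik).symm
    · exact not_mixed hsw hij hkj hkr.perm.1 hi.perm.1 (H i _ k hak hil hik).symm

lemma firstOnly_of_edge (hR : ∀ j l, R j l → j ≠ l ∧ R l j)
    (hcut : ∀ A : Set ι, A.Nonempty → Aᶜ.Nonempty → ∃ j ∈ A, ∃ l ∉ A, R j l)
    (hne : ∀ i j, i ≠ j → s i j ≠ s j i)
    (H : ∀ i j l, R j l → i ≠ j → i ≠ l → FirstOnly s i j l ∨ FirstOnly (Function.swap s) i j l)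
    {i j l : ι} (hjl : R j l) (hij : i ≠ j) (hil : i ≠ l) (hi : FirstOnly s i j l) :
    ∃ σ : ι → κ, ∀ i j, i ≠ j → s i j = σ i := by
  have huni : ∀ {i j l}, R j l → i ≠ j → i ≠ l → FirstOnly s i j l →
      ∀ m, m ≠ j → m ≠ l → FirstOnly s m j l := fun {i j l} hjl hij hil hi m hmj hml =>
    (H m j l hjl hmj hml).resolve_right fun hm =>
      uniform_aux hR hcut hne H hjl hij hil hmj hml hi hm
  let A : Set ι := {v | ∃ u, R v u ∧ ∀ m, m ≠ v → m ≠ u → FirstOnly s m v u}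
  have hA : Aᶜ = ∅ := by
    rw [← not_nonempty_iff_eq_empty]
    intro hAc
    obtain ⟨v, ⟨w, hvw, hw⟩, u, hu, hvu⟩ := hcut A ⟨j, l, hjl, huni hjl hij hil hi⟩ hAc
    have hwu : w ≠ u := by
      rintro rfl
      exact hu ⟨v, (hR _ _ hvw).2, fun m h1 h2 => (hw m h2 h1).perm.1⟩
    have hwv := (hR _ _ hvw).1.symm
    have huv := (hR _ _ hvu).1.symm
    refine hu ⟨v, (hR _ _ hvu).2, fun m h1 h2 => ?_⟩
    exact huni (hR _ _ hvu).2 hwu hwv ((hw u huv hwu.symm).perm.2.2.2.1) m h1 h2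
  have hall : ∀ v, ∃ u, R v u ∧ ∀ m, m ≠ v → m ≠ u → FirstOnly s m v u := fun v => by
    by_contra hv
    exact (hA ▸ (show v ∈ Aᶜ from hv) : v ∈ (∅ : Set ι))
  choose p hp hpd using hall
  refine ⟨fun i => s i (p i), fun i j hij => ?_⟩
  by_cases hjp : j = p i
  · rw [hjp]
  · exact (hpd i j hij.symm hjp).2.1.symm

/-- If `s` depends only on one argument on each triple containing an edge of a connected graph, then
it depends only on one argument. -/
lemma exists_eq_of_edges (hR : ∀ j l, R j l → j ≠ l ∧ R l j)
    (hcut : ∀ A : Set ι, A.Nonempty → Aᶜ.Nonempty → ∃ j ∈ A, ∃ l ∉ A, R j l)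
    (hne : ∀ i j, i ≠ j → s i j ≠ s j i)
    (H : ∀ i j l, R j l → i ≠ j → i ≠ l → FirstOnly s i j l ∨ FirstOnly (Function.swap s) i j l)
    (h3 : ∃ i j l : ι, i ≠ j ∧ i ≠ l ∧ j ≠ l) :
    (∃ σ : ι → κ, ∀ i j, i ≠ j → s i j = σ i) ∨ ∃ σ : ι → κ, ∀ i j, i ≠ j → s i j = σ j := by
  obtain ⟨a, b, c, hab, hac, hbc⟩ := h3
  obtain ⟨j, -, l, -, hjl⟩ := hcut {a} ⟨a, rfl⟩ ⟨b, hab.symm⟩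
  obtain ⟨i, hij, hil⟩ : ∃ i, i ≠ j ∧ i ≠ l := by
    by_contra! hcon
    have ha := hcon a
    have hb := hcon b
    have hc := hcon c
    by_cases a = j <;> by_cases b = j <;> by_cases c = j <;> simp_all
  rcases H i j l hjl hij hil with h | h
  · exact .inl (firstOnly_of_edge hR hcut hne H hjl hij hil h)
  · obtain ⟨σ, hσ⟩ := firstOnly_of_edge (s := Function.swap s) hR hcut
      (fun i j hij => hne j i hij.symm) (fun i j l h1 h2 h3 => (H i j l h1 h2 h3).symm)
      hjl hij hil h
    exact .inr ⟨σ, fun i j hij => hσ j i hij.symm⟩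

end Combinatorics

lemma maxRatio_comp {ι : Type*} [Fintype ι] [Nonempty ι] {u w u' w' : ι → ℝ} (σ : ι ≃ ι) {c : ℝ}
    (hc : 0 ≤ c) (h : ∀ m, u' (σ m) / w' (σ m) = c * (u m / w m)) :
    maxRatio u' w' = c * maxRatio u w := by
  refine le_antisymm (maxRatio_le fun k => ?_) ?_
  · rw [← σ.apply_symm_apply k, h]
    exact mul_le_mul_of_nonneg_left (le_maxRatio u w _) hc
  · obtain ⟨i, hi⟩ := exists_maxRatio_eq u w
    rw [hi, ← h]
    exact le_maxRatio u' w' _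

namespace FacetSystem

variable {E ι : Type*} [NormedAddCommGroup E] [NormedSpace ℝ E] [Fintype ι]
  {S : FacetSystem E ι}

section

variable (S)

lemma eventually_near_facet {j : ι} {a : E} (ha : a ∈ S.facet j) (c : ι → ℝ) :
    ∀ᶠ t : ℝ in 𝓝[>] (0 : ℝ), a + t • (S.center - a) ∈ S.dom ∧
      ∀ k, k ≠ j → c k * S.ev j (a + t • (S.center - a)) < S.ev k (a + t • (S.center - a)) := by
  have hc : ∀ k, Continuous fun t : ℝ => S.ev k (a + t • (S.center - a)) := fun k =>
    (S.continuous_ev k).comp (by fun_prop)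
  refine .and ?_ (eventually_all.mpr fun k => ?_)
  · filter_upwards [Ioo_mem_nhdsGT zero_lt_one] with t ht k
    rw [ev_segment]
    have h1 := mul_pos ht.1 (S.ev_center k)
    by_cases hk : k = j
    · rw [hk, ha.1, ← hk]; linarith
    · have := mul_pos (sub_pos.mpr ht.2) (ha.2 k hk); linarith
  · by_cases hk : k = j
    · exact .of_forall fun _ hne => absurd hk hne
    have hcj := hc j
    have := Continuous.eventually_lt_nhdsGT_zero (u := fun t =>
      c k * S.ev j (a + t • (S.center - a))) (by fun_prop) (hc k) (by simpa [ha.1] using ha.2 k hk)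
    filter_upwards [this] with t ht _ using ht

lemma eventually_visible {j : ι} {a : E} (ha : a ∈ S.facet j) :
    ∀ᶠ t : ℝ in 𝓝[>] (0 : ℝ), ∀ k, k ≠ j → a + t • (S.center - a) ∈ S.visible k j := by
  refine eventually_all.mpr fun k => ?_
  by_cases hk : k = j
  · exact .of_forall fun _ hne => absurd hk hne
  filter_upwards [S.eventually_near_facet ha fun m => S.ev m (S.pt k) / S.ev j (S.pt k)] with t ht _
  refine S.mem_visible_of_facet ht.1 (S.pt_mem k) fun m hm => ?_
  have h1 := ht.2 m hm
  have hj := (S.pt_mem k).2 j (Ne.symm hk)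
  rw [div_mul_eq_mul_div, div_lt_iff₀ hj] at h1
  linarith

end

variable {f g : E → E}

/-- On the points lying on a chord joining the facets `i` and `j`, the map `f` multiplies the
ratio of the distances to these facets by a constant, up to a relabelling of the facets. -/
def ChordRel (S : FacetSystem E ι) (f : E → E) (s : ι → ι → ι) (C : ι → ι → ℝ) : Prop :=
  ∀ i j, i ≠ j → s i j ≠ s j i ∧ 0 < C i j ∧ C i j * C j i = 1 ∧ ∀ x ∈ S.visible i j,
      S.ev (s i j) (f x) * S.ev j x = C i j * S.ev i x * S.ev (s j i) (f x)

lemma IsIsom.exists_chordRel [Nonempty ι] [Nontrivial ι] [FiniteDimensional ℝ E]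
    (h : S.IsIsom f g) : ∃ s C, ChordRel S f s C := by
  obtain ⟨s, hs⟩ := h.exists_index
  obtain ⟨C, hC⟩ := h.exists_const hs
  exact ⟨s, C, fun i j hij => ⟨(hs i j hij).1, hC i j hij⟩⟩

lemma IsIsom.firstOnly [Nonempty ι] [FiniteDimensional ℝ E] (h : S.IsIsom f g) {s : ι → ι → ι}
    {C : ι → ι → ℝ} (hC : ChordRel S f s C) {i j l : ι} (hij : i ≠ j) (hil : i ≠ l)
    (hjl : S.adj j l) : FirstOnly s i j l ∨ FirstOnly (Function.swap s) i j l := by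
  classical
  obtain ⟨x, hx⟩ := S.exists_mem_visible hij hil hjl
  have hjl := hjl.1
  set O := S.visible i j ∩ (S.visible i l ∩ S.visible j l) with hO
  have hOo : IsOpen O :=
    (S.isOpen_visible _ _).inter ((S.isOpen_visible _ _).inter (S.isOpen_visible _ _))
  have hOs : O ⊆ S.dom := fun z hz => S.visible_subset _ _ hz.1
  have hms := S.multiset_eq_of_prod_eq (h.isOpen_image hOo hOs) ⟨f x, x, hx, rfl⟩
    (by rintro _ ⟨z, hz, rfl⟩; exact h.mapsTo z (hOs hz)) (s := {s i j, s j l, s l i})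
    (t := {s j i, s l j, s i l}) (C := C i j * C j l * C l i) (by
      rintro _ ⟨z, hz, rfl⟩
      have h1 := (hC i j hij).2.2.2 z hz.1
      have h2 := (hC j l hjl).2.2.2 z hz.2.2
      have h3 := (hC l i hil.symm).2.2.2 z (S.visible_symm hz.2.1)
      have hz := hOs hz
      have := (mul_pos (mul_pos (hz i) (hz j)) (hz l)).ne'
      simp only [Multiset.insert_eq_cons, Multiset.map_cons, Multiset.map_singleton,
        Multiset.prod_cons, Multiset.prod_singleton]
      refine mul_right_cancel₀ this ?_
      have := congrArg₂ (· * ·) (congrArg₂ (· * ·) h1 h2) h3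
      linarith)
  rcases Multiset.cyclic_of_triple_eq hms (hC i j hij).1 (hC j l hjl).1 (hC l i hil.symm).1 with
    ⟨h1, h2, h3⟩ | ⟨h1, h2, h3⟩
  · exact .inl ⟨h1, h2, h3⟩
  · exact .inr ⟨h3.symm, h1.symm, h2.symm⟩

lemma IsIsom.exists_relabelling [Nonempty ι] [FiniteDimensional ℝ E] (h : S.IsIsom f g)
    (hcard : 2 < Fintype.card ι) {s : ι → ι → ι} {C : ι → ι → ℝ} (hC : ChordRel S f s C) :
    (∃ σ : ι ≃ ι, ∀ i j, i ≠ j → s i j = σ i) ∨ ∃ σ : ι ≃ ι, ∀ i j, i ≠ j → s i j = σ j := by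
  have hex := exists_eq_of_edges (R := S.adj) (s := s) (fun j l hjl => ⟨hjl.1, S.adj_symm hjl⟩)
    (S.exists_adj hcard) (fun i j hij => (hC i j hij).1)
    (fun i j l hjl hij hil => h.firstOnly hC hij hil hjl) (Fintype.two_lt_card_iff.mp hcard)
  rcases hex with ⟨σ, hσ⟩ | ⟨σ, hσ⟩
  · refine .inl ⟨Equiv.ofBijective σ (Finite.injective_iff_bijective.mp fun i j hij => ?_), hσ⟩
    by_contra hne
    exact (hC i j hne).1 ((hσ i j hne).trans (hij.trans (hσ j i (Ne.symm hne)).symm))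
  · refine .inr ⟨Equiv.ofBijective σ (Finite.injective_iff_bijective.mp fun i j hij => ?_), hσ⟩
    by_contra hne
    exact (hC i j hne).1 ((hσ i j hne).trans (hij.symm.trans (hσ j i (Ne.symm hne)).symm))

/-- The reversed relabelling forces the affine functions to be linearly independent. -/
lemma eq_zero_of_reversed [Nonempty ι] (hf : ∀ x ∈ S.dom, f x ∈ S.dom) {s : ι → ι → ι}
    {C : ι → ι → ℝ} (hC : ChordRel S f s C) {τ : ι ≃ ι} (hτ : ∀ i j, i ≠ j → s i j = τ j)
    {μ : ι → ℝ} (hμ : ∀ x, ∑ i, μ i * S.ev i x = 0) : μ = 0 := by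
  classical
  obtain ⟨j⟩ := ‹Nonempty ι›
  set O := S.dom ∩ ⋂ k, ⋂ _ : k ≠ j, S.visible k j with hO
  have hOo : IsOpen O := S.isOpen_dom.inter
    (isOpen_iInter_of_finite fun k => isOpen_iInter_of_finite fun _ => S.isOpen_visible k j)
  have hne : O.Nonempty := by
    obtain ⟨t, h1, h2⟩ := ((S.eventually_visible (S.pt_mem j)).and
      (S.eventually_near_facet (S.pt_mem j) 0)).exists
    exact ⟨_, h2.1, by simpa using h1⟩
  have hD : ∀ k, ∃ D : ℝ, D ≠ 0 ∧ ∀ y ∈ O,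
      S.ev (τ k) (f y) = S.ev (τ j) (f y) * S.ev j y * (D * (S.ev k y)⁻¹) := fun k => by
    by_cases hk : k = j
    · subst hk
      refine ⟨1, one_ne_zero, fun y hy => ?_⟩
      have := (hy.1 k).ne'
      field_simp
    · refine ⟨(C k j)⁻¹, inv_ne_zero (hC k j hk).2.1.ne', fun y hy => ?_⟩
      have h1 := (hC k j hk).2.2.2 y (mem_iInter₂.mp hy.2 k hk)
      rw [hτ k j hk, hτ j k (Ne.symm hk)] at h1
      have := (hy.1 k).ne'
      have := (hC k j hk).2.1.ne'
      rw [h1]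
      field_simp
  choose D hD0 hD using hD
  have hzero := S.eq_zero_of_sum_inv hOo hne inter_subset_left (c := fun k => μ (τ k) * D k)
    (C := 0) fun y hy => by
      have h1 := hμ (f y)
      rw [← τ.sum_comp, Finset.sum_congr rfl fun k _ => congrArg (μ (τ k) * ·) (hD k y hy)] at h1
      have hpos := (mul_pos (hf y hy.1 (τ j)) (hy.1 j)).ne'
      refine (mul_eq_zero.mp ?_).resolve_left hpos
      rw [← h1, Finset.mul_sum]
      exact Finset.sum_congr rfl fun k _ => by ring
  funext i
  have := hzero (τ.symm i)
  simpa [hD0] using this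

end FacetSystem

namespace FacetSystem

variable {E ι : Type*} [NormedAddCommGroup E] [NormedSpace ℝ E] [Fintype ι] [Nonempty ι]
  (S : FacetSystem E ι)

lemma tendsto_mul_maxRatio (u : ι → ℝ) (hu : ∀ i, 0 < u i) (j : ι) (a p : E) :
    Tendsto (fun t : ℝ => u j * maxRatio (S.ev · (a + t • (p - a))) u) (𝓝[>] 0)
      (𝓝 (u j * maxRatio (S.ev · a) u)) := by
  have h : ContinuousAt (fun t : ℝ => u j * maxRatio (S.ev · (a + t • (p - a))) u) 0 :=
    continuousAt_const.mul (.maxRatio (fun i => ((S.continuous_ev i).comp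
      (g := S.ev i) (f := fun t : ℝ => a + t • (p - a)) (by fun_prop)).continuousAt)
      (fun i => continuousAt_const) fun i => (hu i).ne')
  simpa using h.tendsto.mono_left nhdsWithin_le_nhds

lemma eventually_maxRatio_eq {u : ι → ℝ} (hu : ∀ i, 0 < u i) {j : ι} {a : E}
    (ha : a ∈ S.facet j) : ∀ᶠ t : ℝ in 𝓝[>] (0 : ℝ),
      maxRatio u (S.ev · (a + t • (S.center - a))) = u j / S.ev j (a + t • (S.center - a)) := by
  filter_upwards [S.eventually_near_facet ha fun k => u k / u j] with t ht
  refine maxRatio_eq j fun k => ?_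
  by_cases hk : k = j
  · rw [hk]
  have := ht.2 k hk
  rw [div_mul_eq_mul_div, div_lt_iff₀ (hu j)] at this
  rw [div_le_div_iff₀ (ht.1 k) (ht.1 j)]
  linarith

lemma mul_maxRatio_of_facet {u w : ι → ℝ} (hu : ∀ i, 0 < u i) (hw : ∀ i, 0 < w i) {j : ι} {a : E}
    (ha : a ∈ S.facet j) (h : ∀ᶠ t : ℝ in 𝓝[>] (0 : ℝ),
      maxRatio u (S.ev · (a + t • (S.center - a))) * maxRatio (S.ev · (a + t • (S.center - a))) u =
      maxRatio w (S.ev · (a + t • (S.center - a))) * maxRatio (S.ev · (a + t • (S.center - a))) w) :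
    u j * maxRatio (S.ev · a) u = w j * maxRatio (S.ev · a) w := by
  refine tendsto_nhds_unique_of_eventuallyEq (S.tendsto_mul_maxRatio u hu j a S.center)
    (S.tendsto_mul_maxRatio w hw j a S.center) ?_
  filter_upwards [h, S.eventually_maxRatio_eq hu ha, S.eventually_maxRatio_eq hw ha,
    S.eventually_near_facet ha 0] with t h h1 h2 h3
  rw [h1, h2] at h
  have := h3.1 j
  field_simp at h
  exact h

lemma mul_maxRatio_of_ridge {u w : ι → ℝ} (hu : ∀ i, 0 < u i) (hw : ∀ i, 0 < w i) {j l : ι}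
    (h : ∀ a ∈ S.facet j, u j * maxRatio (S.ev · a) u = w j * maxRatio (S.ev · a) w) {r : E}
    (hr : r ∈ S.ridge j l) :
    u j * maxRatio (S.ev · r) u = w j * maxRatio (S.ev · r) w := by
  refine tendsto_nhds_unique_of_eventuallyEq (S.tendsto_mul_maxRatio u hu j r (S.pt j))
    (S.tendsto_mul_maxRatio w hw j r (S.pt j)) ?_
  filter_upwards [Ioo_mem_nhdsGT (zero_lt_one' ℝ)] with t ht
  refine h _ ⟨?_, fun k hk => ?_⟩
  · rw [ev_segment, hr.1, (S.pt_mem j).1]; ring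
  · rw [ev_segment]
    have h1 := mul_pos ht.1 ((S.pt_mem j).2 k hk)
    by_cases hkl : k = l
    · rw [hkl, hr.2.1, ← hkl]; linarith
    · have := mul_pos (sub_pos.mpr ht.2) (hr.2.2 k hk hkl); linarith

lemma maxRatio_const_mul {u w : ι → ℝ} {c : ℝ} (hc : 0 < c) :
    maxRatio u (fun i => c * w i) = c⁻¹ * maxRatio u w :=
  maxRatio_comp (Equiv.refl ι) (inv_nonneg.mpr hc.le) fun m => by
    simp only [Equiv.refl_apply]; rw [div_mul_eq_div_div_swap, div_eq_inv_mul]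

variable {S} {f g : E → E}

/-- The coordinates of `f x`, relabelled and rescaled as seen from the facet `j`. -/
def rescaled (S : FacetSystem E ι) [DecidableEq ι] (f : E → E) (C : ι → ι → ℝ) (σ : ι ≃ ι) (j : ι)
    (x : E) (m : ι) : ℝ :=
  (if m = j then 1 else C j m) * S.ev (σ m) (f x)

lemma rescaled_pos [DecidableEq ι] (h : S.IsIsom f g) {s : ι → ι → ι} {C : ι → ι → ℝ}
    (hC : ChordRel S f s C) (σ : ι ≃ ι) (j : ι) {x : E} (hx : x ∈ S.dom) (m : ι) :
    0 < S.rescaled f C σ j x m := by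
  refine mul_pos ?_ (h.mapsTo x hx _)
  split_ifs with hm
  · exact zero_lt_one
  · exact (hC j m (Ne.symm hm)).2.1

lemma cr_map_of_visible [DecidableEq ι] (h : S.IsIsom f g) {s : ι → ι → ι} {C : ι → ι → ℝ}
    (hC : ChordRel S f s C) {σ : ι ≃ ι} (hσ : ∀ i j, i ≠ j → s i j = σ i) {j : ι} {x y : E}
    (hx : x ∈ S.dom) (hy : y ∈ S.dom) (hv : ∀ k, k ≠ j → y ∈ S.visible k j) :
    maxRatio (S.rescaled f C σ j x) (S.ev · y) * maxRatio (S.ev · y) (S.rescaled f C σ j x) =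
      S.cr x y := by
  set κ := S.ev (σ j) (f y) / S.ev j y with hκ
  have hκ0 : 0 < κ := div_pos (h.mapsTo y hy _) (hy j)
  have hF : ∀ m, (if m = j then 1 else C j m) * S.ev (σ m) (f y) = κ * S.ev m y := fun m => by
    have hyj := (hy j).ne'
    split_ifs with hm
    · subst hm; rw [one_mul, hκ, div_mul_cancel₀ _ hyj]
    · obtain ⟨-, h1, h2, h3⟩ := hC m j hm
      have h4 := h3 y (hv m hm)
      rw [hσ m j hm, hσ j m (Ne.symm hm)] at h4
      rw [hκ]
      field_simp
      linear_combination C j m * h4 + S.ev m y * S.ev (σ j) (f y) * h2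
  have hc : ∀ m, 0 < (if m = j then 1 else C j m) := fun m => by
    split_ifs with hm
    · exact zero_lt_one
    · exact (hC j m (Ne.symm hm)).2.1
  have key : ∀ m, S.ev (σ m) (f y) = κ * S.ev m y / (if m = j then 1 else C j m) := fun m => by
    rw [← hF]; have := (hc m).ne'; field_simp
  have h1 : maxRatio (S.ev · (f x)) (S.ev · (f y)) =
      κ⁻¹ * maxRatio (S.rescaled f C σ j x) (S.ev · y) :=
    maxRatio_comp σ (inv_nonneg.mpr hκ0.le) fun m => by
      rw [key, rescaled]
      have := (hc m).ne'
      have := hy m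
      field_simp
  have h2 : maxRatio (S.ev · (f y)) (S.ev · (f x)) =
      κ * maxRatio (S.ev · y) (S.rescaled f C σ j x) :=
    maxRatio_comp σ hκ0.le fun m => by
      rw [key, rescaled]
      have := (hc m).ne'
      have := h.mapsTo x hx (σ m)
      field_simp
  rw [← h.cr_map x hx y hy, cr, h1, h2]
  field_simp

lemma mul_maxRatio_rescaled [DecidableEq ι] (h : S.IsIsom f g) {s : ι → ι → ι} {C : ι → ι → ℝ}
    (hC : ChordRel S f s C) {σ : ι ≃ ι} (hσ : ∀ i j, i ≠ j → s i j = σ i) {j l : ι} {x r : E}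
    (hx : x ∈ S.dom) (hr : r ∈ S.ridge j l) :
    S.rescaled f C σ j x j * maxRatio (S.ev · r) (S.rescaled f C σ j x) =
      S.ev j x * maxRatio (S.ev · r) (S.ev · x) := by
  refine S.mul_maxRatio_of_ridge (w := (S.ev · x)) (rescaled_pos h hC σ j hx) hx (fun a ha => ?_) hr
  refine S.mul_maxRatio_of_facet (w := (S.ev · x)) (rescaled_pos h hC σ j hx) hx ha ?_
  filter_upwards [S.eventually_near_facet ha 0, S.eventually_visible ha] with t h1 h2
  exact cr_map_of_visible h hC hσ hx h1.1 h2

lemma rescaled_eq_mul [DecidableEq ι] (h : S.IsIsom f g) {s : ι → ι → ι} {C : ι → ι → ℝ}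
    (hC : ChordRel S f s C) {σ : ι ≃ ι} (hσ : ∀ i j, i ≠ j → s i j = σ i) {j l : ι}
    (hjl : S.adj j l) (x : E) :
    S.rescaled f C σ j x = fun m => C j l * S.rescaled f C σ l x m := by
  have hne := hjl.1
  funext m
  simp only [rescaled]
  rw [← mul_assoc]
  congr 1
  by_cases hmj : m = j
  · subst hmj; simp [hne, (hC m l hne).2.2.1]
  by_cases hml : m = l
  · subst hml; simp [hmj]
  simp only [if_neg hmj, if_neg hml]
  obtain ⟨z, h1, h2, h3⟩ := S.exists_mem_visible hmj hml hjl
  have e1 := (hC m j hmj).2.2.2 z h1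
  have e2 := (hC m l hml).2.2.2 z h2
  have e3 := (hC j l hne).2.2.2 z h3
  have i1 := (hC m j hmj).2.2.1
  have i2 := (hC m l hml).2.2.1
  have hz := S.visible_subset _ _ h3
  rw [hσ m j hmj, hσ j m (Ne.symm hmj)] at e1
  rw [hσ m l hml, hσ l m (Ne.symm hml)] at e2
  rw [hσ j l hne, hσ l j (Ne.symm hne)] at e3
  have p1 := hz m
  have p2 := hz j
  have p3 := hz l
  have q1 := h.mapsTo z hz (σ m)
  have q2 := h.mapsTo z hz (σ j)
  have q3 := h.mapsTo z hz (σ l)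
  have e4 : C m l = C m j * C j l := by
    have : S.ev m z * S.ev j z * S.ev (σ l) (f z) ≠ 0 := by positivity
    refine mul_right_cancel₀ this ?_
    linear_combination (-S.ev j z) * e2 + S.ev l z * e1 + C m j * S.ev m z * e3
  have c1 := (hC m j hmj).2.1.ne'
  have c2 := (hC m l hml).2.1.ne'
  refine mul_left_cancel₀ (mul_ne_zero c1 c2) ?_
  linear_combination C m l * i1 - (C m j * C j l) * i2 + e4

/-- For adjacent facets, the relation between the coordinates of `f x` and `x` holds everywhere. -/
lemma ev_map_of_adj (h : S.IsIsom f g) (hcard : 2 < Fintype.card ι) {s : ι → ι → ι}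
    {C : ι → ι → ℝ} (hC : ChordRel S f s C) {σ : ι ≃ ι} (hσ : ∀ i j, i ≠ j → s i j = σ i) {j l : ι}
    (hjl : S.adj j l) {x : E} (hx : x ∈ S.dom) :
    S.ev (σ j) (f x) * S.ev l x = C j l * S.ev j x * S.ev (σ l) (f x) := by
  classical
  obtain ⟨r, hr⟩ := hjl.2
  have hr' : r ∈ S.ridge l j := ⟨hr.2.1, hr.1, fun k h1 h2 => hr.2.2 k h2 h1⟩
  have e1 := mul_maxRatio_rescaled h hC hσ hx hr
  have e2 := mul_maxRatio_rescaled h hC hσ hx hr'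
  obtain ⟨m, hm⟩ : ∃ m, m ∉ ({j, l} : Finset ι) := by
    by_contra! hall
    have := Finset.card_le_card (fun m _ => hall m : Finset.univ ⊆ ({j, l} : Finset ι))
    have := Finset.card_le_two (a := j) (b := l)
    rw [Finset.card_univ] at *
    omega
  simp only [Finset.mem_insert, Finset.mem_singleton, not_or] at hm
  have hm0 : 0 < S.ev m r := hr.2.2 m hm.1 hm.2
  have hM : 0 < maxRatio (S.ev · r) (S.rescaled f C σ l x) :=
    (div_pos hm0 (rescaled_pos h hC σ l hx m)).trans_le
      (le_maxRatio (S.ev · r) _ m)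
  have hM' : 0 < maxRatio (S.ev · r) (S.ev · x) :=
    (div_pos hm0 (hx m)).trans_le (le_maxRatio (S.ev · r) (S.ev · x) m)
  have hc := (hC j l hjl.1).2.1
  rw [rescaled_eq_mul h hC hσ hjl, maxRatio_const_mul hc] at e1
  simp only [rescaled, if_neg hjl.1, if_true, one_mul] at e1 e2
  have i1 := (hC j l hjl.1).2.2.1
  have e3 : S.ev (σ j) (f x) * maxRatio (S.ev · r) (S.rescaled f C σ l x) =
      C j l * (S.ev j x * maxRatio (S.ev · r) (S.ev · x)) := by
    have := hc.ne'
    rw [← e1]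
    field_simp
    linear_combination (-S.ev (σ j) (f x)) * i1
  refine mul_right_cancel₀ (mul_pos hM hM').ne' ?_
  linear_combination (S.ev l x * maxRatio (S.ev · r) (S.ev · x)) * e3 -
    (C j l * S.ev j x * maxRatio (S.ev · r) (S.ev · x)) * e2

/-- Unless the affine functions of the facets are linearly independent, an isometry acts on them
by a permutation and positive scalings. -/
theorem IsIsom.exists_perm [Nontrivial ι] [FiniteDimensional ℝ E] (h : S.IsIsom f g)
    (hcard : 2 < Fintype.card ι) {μ : ι → ℝ} (hμ0 : μ ≠ 0) (hμ : ∀ x, ∑ i, μ i * S.ev i x = 0) :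
    ∃ (σ : ι ≃ ι) (K : ι → ℝ), (∀ i, 0 < K i) ∧ ∀ x ∈ S.dom, ∃ κ : ℝ, 0 < κ ∧
      ∀ i, S.ev (σ i) (f x) = κ * (K i * S.ev i x) := by
  obtain ⟨s, C, hC⟩ := h.exists_chordRel
  rcases h.exists_relabelling hcard hC with ⟨σ, hσ⟩ | ⟨τ, hτ⟩
  swap
  · exact absurd (eq_zero_of_reversed h.mapsTo hC hτ hμ) hμ0
  obtain ⟨o⟩ := ‹Nonempty ι›
  have hall : ∀ i, ∃ K : ℝ, 0 < K ∧ ∀ x ∈ S.dom,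
      S.ev (σ i) (f x) * S.ev o x = K * S.ev i x * S.ev (σ o) (f x) := by
    by_contra! hnot
    obtain ⟨i, hi⟩ := hnot
    obtain ⟨j, ⟨K, hK, hKx⟩, l, hl, hjl⟩ := S.exists_adj hcard
      {i | ∃ K : ℝ, 0 < K ∧ ∀ x ∈ S.dom,
        S.ev (σ i) (f x) * S.ev o x = K * S.ev i x * S.ev (σ o) (f x)}
      ⟨o, 1, zero_lt_one, fun x _ => by ring⟩
      ⟨i, fun ⟨K, hK, hKx⟩ => let ⟨x, hx, hne⟩ := hi K hK; hne (hKx x hx)⟩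
    refine hl ⟨C l j * K, mul_pos (hC l j hjl.1.symm).2.1 hK, fun x hx => ?_⟩
    have e1 := ev_map_of_adj h hcard hC hσ (S.adj_symm hjl) hx
    have e2 := hKx x hx
    refine mul_right_cancel₀ (hx j).ne' ?_
    linear_combination S.ev o x * e1 + C l j * S.ev l x * e2
  choose K hK hKx using hall
  refine ⟨σ, K, hK, fun x hx => ⟨S.ev (σ o) (f x) / S.ev o x,
    div_pos (h.mapsTo x hx _) (hx o), fun i => ?_⟩⟩
  have := (hx o).ne'
  field_simp
  linear_combination hKx i x hx

end FacetSystem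

namespace FacetSystem

variable {E ι : Type*} [NormedAddCommGroup E] [NormedSpace ℝ E]

/-- The homogeneous extension of the affine functions of a facet system. -/
def lift (S : FacetSystem E ι) : E × ℝ →ₗ[ℝ] (ι → ℝ) :=
  LinearMap.pi fun i => (S.A i : E →ₗ[ℝ] ℝ).coprod (S.b i • LinearMap.id)

lemma lift_apply (S : FacetSystem E ι) (w : E × ℝ) (i : ι) :
    S.lift w i = S.A i w.1 + S.b i * w.2 := by
  simp [lift]

lemma lift_one (S : FacetSystem E ι) (x : E) : S.lift (x, 1) = (S.ev · x) := by
  funext i; simp [lift_apply, ev]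

lemma lift_injective [Nonempty ι] (S : FacetSystem E ι) : Function.Injective S.lift := by
  obtain ⟨i⟩ := ‹Nonempty ι›
  have aux : ∀ v : E, ∀ h : ℝ, 0 ≤ h → S.lift (v, h) = 0 → (v, h) = 0 := fun v h hh h0 => by
    have h1 : ∀ k, S.A k v = -(S.b k * h) := fun k => by
      have := congrFun h0 k
      rw [lift_apply] at this
      exact eq_neg_of_add_eq_zero_left this
    have h2 : h • S.center - v = 0 := S.eq_zero_of_nonneg _ fun k => by
      have := mul_nonneg hh (S.ev_center k).le
      simp only [ev, map_sub, map_smul, smul_eq_mul, h1] at this ⊢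
      linarith
    have h3 : h * S.ev i S.center = 0 := by
      have := h1 i
      rw [← sub_eq_zero.mp h2, map_smul, smul_eq_mul] at this
      rw [ev]; linarith
    have h4 := (mul_eq_zero.mp h3).resolve_right (S.ev_center i).ne'
    rw [h4, zero_smul, zero_sub, neg_eq_zero] at h2
    rw [h2, h4]; rfl
  rw [injective_iff_map_eq_zero]
  rintro ⟨v, h⟩ h0
  rcases le_total 0 h with hh | hh
  · exact aux v h hh h0
  · refine neg_eq_zero.mp (aux (-v) (-h) (neg_nonneg.mpr hh) ?_)
    rw [← Prod.neg_mk, map_neg, h0, neg_zero]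

/-- The points `(x, 1)` with `x` in the polytope span the space. -/
lemma mem_submodule_of_dom [Finite ι] (S : FacetSystem E ι) {W : Submodule ℝ (E × ℝ)}
    (hW : ∀ x ∈ S.dom, (x, (1 : ℝ)) ∈ W) (w : E × ℝ) : w ∈ W := by
  have h1 : (w.1 - w.2 • S.center, (0 : ℝ)) ∈ W := by
    set v := w.1 - w.2 • S.center
    have hc : Tendsto (fun t : ℝ => S.center + t • v) (𝓝[>] 0) (𝓝 S.center) := by
      have : Continuous fun t : ℝ => S.center + t • v := by fun_prop
      simpa using (this.tendsto 0).mono_left nhdsWithin_le_nhds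
    obtain ⟨t, ht, ht0⟩ := ((hc.eventually (S.isOpen_dom.mem_nhds S.center_mem)).and
      self_mem_nhdsWithin).exists
    have ht0 : (0 : ℝ) < t := ht0
    have := W.smul_mem t⁻¹ (W.sub_mem (hW _ ht) (hW _ S.center_mem))
    simpa [ht0.ne'] using this
  have h2 := W.add_mem h1 (W.smul_mem w.2 (hW _ S.center_mem))
  simpa using h2

variable [Fintype ι] {S : FacetSystem E ι} {f g : E → E}

theorem IsIsom.exists_linearEquiv [Nonempty ι] [FiniteDimensional ℝ E] (h : S.IsIsom f g)
    (hcard : 2 < Fintype.card ι) {μ : ι → ℝ} (hμ0 : μ ≠ 0) (hμ : ∀ x, ∑ i, μ i * S.ev i x = 0) :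
    ∃ T : (E × ℝ) ≃ₗ[ℝ] (E × ℝ), ∀ x ∈ S.dom, ∃ c : ℝ, c ≠ 0 ∧ T (x, 1) = c • (f x, 1) := by
  have : Nontrivial ι := Fintype.one_lt_card_iff_nontrivial.mp (by omega)
  obtain ⟨σ, K, hK, hσ⟩ := h.exists_perm hcard hμ0 hμ
  let D : (ι → ℝ) →ₗ[ℝ] (ι → ℝ) :=
    LinearMap.pi fun k => K (σ.symm k) • LinearMap.proj (σ.symm k)
  have hD : ∀ u i, D u (σ i) = K i * u i := fun u i => by simp [D]
  have hDinj : Function.Injective D := fun u w huw => funext fun i => by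
    have := congrFun huw (σ i)
    rw [hD, hD] at this
    exact mul_left_cancel₀ (hK i).ne' this
  have hx : ∀ x ∈ S.dom, ∃ c : ℝ, c ≠ 0 ∧ D (S.lift (x, 1)) = S.lift (c • (f x, 1)) :=
    fun x hx => by
      obtain ⟨κ, hκ, hk⟩ := hσ x hx
      refine ⟨κ⁻¹, inv_ne_zero hκ.ne', funext fun k => ?_⟩
      rw [← σ.apply_symm_apply k, hD, map_smul, lift_one, lift_one, Pi.smul_apply, hk, smul_eq_mul,
        inv_mul_cancel_left₀ hκ.ne']
  obtain ⟨G, hG⟩ := S.lift.exists_leftInverse_of_injective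
    (LinearMap.ker_eq_bot.mpr S.lift_injective)
  have hG' : ∀ w, G (S.lift w) = w := fun w => LinearMap.congr_fun hG w
  have hrange : ∀ w, D (S.lift w) ∈ LinearMap.range S.lift := fun w => by
    have := S.mem_submodule_of_dom
      (W := (LinearMap.range S.lift).comap (D ∘ₗ S.lift)) (fun x hxd => ?_) w
    · exact this
    · obtain ⟨c, -, hc⟩ := hx x hxd
      exact ⟨_, hc.symm⟩
  have hT : Function.Injective (G ∘ₗ D ∘ₗ S.lift) := fun w w' hw => by
    obtain ⟨z, hz⟩ := hrange w
    obtain ⟨z', hz'⟩ := hrange w'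
    simp only [LinearMap.comp_apply, ← hz, ← hz', hG'] at hw
    rw [hw] at hz
    exact S.lift_injective (hDinj (hz.symm.trans hz'))
  refine ⟨LinearEquiv.ofInjectiveEndo _ hT, fun x hxd => ?_⟩
  obtain ⟨c, hc0, hc⟩ := hx x hxd
  refine ⟨c, hc0, ?_⟩
  rw [LinearEquiv.coe_ofInjectiveEndo]
  simp only [LinearMap.comp_apply, hc, hG']

end FacetSystem

/-- Homogeneous coordinates on the projective completion of `ℝⁿ`. -/
def homogeneousEquiv (n : ℕ) : (Euc n × ℝ) ≃ₗ[ℝ] (Fin (n + 1) → ℝ) where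
  toFun w := Fin.snoc (α := fun _ => ℝ) (fun i => w.1 i) w.2
  invFun z := (WithLp.toLp 2 (Fin.init z), z (Fin.last n))
  left_inv w := by ext <;> simp
  right_inv z := by simp
  map_add' v w := by
    funext i
    refine Fin.lastCases ?_ (fun i => ?_) i <;> simp
  map_smul' c w := by
    funext i
    refine Fin.lastCases ?_ (fun i => ?_) i <;> simp

lemma homogeneousEquiv_one {n : ℕ} (x : Euc n) : homogeneousEquiv n (x, 1) = projLift x := rfl

lemma exists_projective_of_prod {n : ℕ} {f : Euc n → Euc n} {Ω : Set (Euc n)}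
    (h : ∃ T : (Euc n × ℝ) ≃ₗ[ℝ] (Euc n × ℝ), ∀ x ∈ Ω, ∃ c : ℝ, c ≠ 0 ∧
      T (x, 1) = c • (f x, 1)) :
    ∃ T : (Fin (n + 1) → ℝ) ≃ₗ[ℝ] (Fin (n + 1) → ℝ),
      ∀ x ∈ Ω, ∃ c : ℝ, c ≠ 0 ∧ T (projLift x) = c • projLift (f x) := by
  obtain ⟨T, hT⟩ := h
  refine ⟨(homogeneousEquiv n).symm.trans (T.trans (homogeneousEquiv n)), fun x hx => ?_⟩
  obtain ⟨c, hc, h1⟩ := hT x hx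
  refine ⟨c, hc, ?_⟩
  rw [LinearEquiv.trans_apply, LinearEquiv.trans_apply, ← homogeneousEquiv_one,
    LinearEquiv.symm_apply_apply, h1, map_smul, homogeneousEquiv_one]

lemma exists_prod_of_projective {n : ℕ} {f : Euc n → Euc n} {Ω : Set (Euc n)}
    {T : (Fin (n + 1) → ℝ) ≃ₗ[ℝ] (Fin (n + 1) → ℝ)}
    (hT : ∀ x ∈ Ω, ∃ c : ℝ, c ≠ 0 ∧ T (projLift x) = c • projLift (f x)) :
    ∃ T : (Euc n × ℝ) ≃ₗ[ℝ] (Euc n × ℝ), ∀ x ∈ Ω, ∃ c : ℝ, c ≠ 0 ∧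
      T (x, 1) = c • (f x, 1) := by
  refine ⟨(homogeneousEquiv n).trans (T.trans (homogeneousEquiv n).symm), fun x hx => ?_⟩
  obtain ⟨c, hc, h1⟩ := hT x hx
  refine ⟨c, hc, ?_⟩
  rw [LinearEquiv.trans_apply, LinearEquiv.trans_apply, homogeneousEquiv_one, h1, map_smul,
    ← homogeneousEquiv_one, LinearEquiv.symm_apply_apply]

namespace FacetSystem

variable {E ι : Type*} [NormedAddCommGroup E] [NormedSpace ℝ E] {S : FacetSystem E ι}

section

variable {T : (E × ℝ) ≃ₗ[ℝ] (E × ℝ)} {g : E → E} {c : E → ℝ}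

/-- The homogeneous factor of a projective map has constant sign. -/
lemma factor_mul_pos (hc : ∀ x ∈ S.dom, c x ≠ 0 ∧ T (x, 1) = c x • (g x, 1)) {x y : E}
    (hx : x ∈ S.dom) (hy : y ∈ S.dom) : 0 < c x * c y := by
  have h2 : ∀ z ∈ S.dom, (T (z, 1)).2 = c z := fun z hz => by rw [(hc z hz).2]; simp
  have hx0 := (hc x hx).1
  have hy0 := (hc y hy).1
  by_contra! hneg
  replace hneg := lt_of_le_of_ne hneg (mul_ne_zero hx0 hy0)
  have hne : c x - c y ≠ 0 := fun h0 => by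
    rw [sub_eq_zero.mp h0] at hneg
    exact (mul_self_nonneg (c y)).not_gt hneg
  have hlt : 0 < (c x - c y) ^ 2 := by positivity
  set t := c x / (c x - c y) with ht
  have e0 : t = (c x ^ 2 - c x * c y) / (c x - c y) ^ 2 := by rw [ht]; field_simp
  have e1 : 1 - t = (c y ^ 2 - c x * c y) / (c x - c y) ^ 2 := by
    rw [ht]; field_simp; ring
  have ht0 : 0 ≤ t := by
    rw [e0]; exact div_nonneg (by nlinarith [sq_nonneg (c x)]) hlt.le
  have ht1 : 0 < 1 - t := by
    rw [e1]; exact div_pos (by nlinarith [sq_nonneg (c y)]) hlt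
  have hz : x + t • (y - x) ∈ S.dom :=
    S.segment_mem_dom hx (fun i => (hy i).le) ht0 (by linarith)
  refine (hc _ hz).1 ?_
  rw [← h2 _ hz]
  have : ((x + t • (y - x), (1 : ℝ)) : E × ℝ) = (1 - t) • (x, 1) + t • (y, 1) := by
    refine Prod.ext ?_ ?_
    · simp only [Prod.fst_add, Prod.smul_fst]; module
    · simp
  rw [this, map_add, map_smul, map_smul, Prod.snd_add, Prod.smul_snd, Prod.smul_snd, h2 x hx,
    h2 y hy, ht, smul_eq_mul, smul_eq_mul]
  field_simp
  ring

variable [Fintype ι] [Nonempty ι]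

lemma maxRatio_map_le (hg : ∀ x ∈ S.dom, g x ∈ S.dom)
    (hc : ∀ x ∈ S.dom, c x ≠ 0 ∧ T (x, 1) = c x • (g x, 1)) {x y : E}
    (hx : x ∈ S.dom) (hy : y ∈ S.dom) :
    maxRatio (S.ev · (g x)) (S.ev · (g y)) ≤ maxRatio (S.ev · x) (S.ev · y) * (c y / c x) := by
  have hxy : 0 < c y / c x := by
    have := factor_mul_pos hc hy hx
    have hx0 := (hc x hx).1
    have e : c y / c x = c y * c x / c x ^ 2 := by field_simp
    rw [e]; positivity
  refine maxRatio_le fun i => ?_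
  rw [← div_le_iff₀ hxy]
  refine le_of_forall_gt_imp_ge_of_dense fun r hr => ?_
  have hr1 : 0 < r - 1 := sub_pos.mpr ((S.one_le_maxRatio hy).trans_lt hr)
  have hz : y + (r - 1)⁻¹ • (y - x) ∈ S.dom := fun k => by
    have h1 := (le_maxRatio (S.ev · x) (S.ev · y) k).trans_lt hr
    rw [div_lt_iff₀ (hy k)] at h1
    have e : S.ev k (y + (r - 1)⁻¹ • (y - x)) = (r * S.ev k y - S.ev k x) * (r - 1)⁻¹ := by
      have e2 : S.A k y - S.A k x = S.ev k y - S.ev k x := by simp [ev]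
      rw [ev_add_smul, map_sub, e2]
      field_simp
      ring
    rw [e]
    exact mul_pos (by linarith) (inv_pos.mpr hr1)
  set z := y + (r - 1)⁻¹ • (y - x) with hzdef
  have h1 : (r - 1) • ((z, 1) : E × ℝ) = r • (y, 1) - (x, 1) := by
    refine Prod.ext ?_ ?_
    · simp only [Prod.smul_fst, Prod.fst_sub, hzdef, smul_add, smul_inv_smul₀ hr1.ne']; module
    · simp
  have h2 := congrArg (fun w => S.lift (T w) i) h1
  simp only [map_smul, map_sub, (hc _ hz).2, (hc _ hx).2, (hc _ hy).2, lift_one, Pi.smul_apply,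
    Pi.sub_apply, smul_eq_mul] at h2
  have h3 : 0 < (r - 1) * (c z * c x * S.ev i (g z)) :=
    mul_pos hr1 (mul_pos (factor_mul_pos hc hz hx) (hg z hz i))
  have hx0 := (hc x hx).1
  have hgy := hg y hy i
  rw [div_div, div_le_iff₀ (mul_pos hgy hxy)]
  have h4 : 0 < c x ^ 2 := by positivity
  refine le_of_mul_le_mul_left ?_ h4
  have e : c x ^ 2 * (r * (S.ev i (g y) * (c y / c x))) = c x * (r * (c y * S.ev i (g y))) := by
    field_simp
  rw [e]
  linear_combination h3.le + c x * h2

lemma cr_map_le (hg : ∀ x ∈ S.dom, g x ∈ S.dom)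
    (hc : ∀ x ∈ S.dom, c x ≠ 0 ∧ T (x, 1) = c x • (g x, 1)) {x y : E}
    (hx : x ∈ S.dom) (hy : y ∈ S.dom) : S.cr (g x) (g y) ≤ S.cr x y := by
  have h1 := maxRatio_map_le hg hc hx hy
  have h2 := maxRatio_map_le hg hc hy hx
  have hx0 := (hc x hx).1
  have hy0 := (hc y hy).1
  refine (mul_le_mul h1 h2 (maxRatio_pos (hg y hy) (hg x hx)).le
    ((maxRatio_pos (hg x hx) (hg y hy)).le.trans h1)).trans_eq ?_
  rw [cr]
  field_simp

end

/-- A projective map preserving the polytope preserves the cross ratio. -/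
theorem cr_map_of_projective [Fintype ι] [Nonempty ι] {g : E → E} (hg : BijOn g S.dom S.dom)
    (hT : ∃ T : (E × ℝ) ≃ₗ[ℝ] (E × ℝ), ∀ x ∈ S.dom, ∃ c : ℝ, c ≠ 0 ∧ T (x, 1) = c • (g x, 1))
    {x y : E} (hx : x ∈ S.dom) (hy : y ∈ S.dom) : S.cr (g x) (g y) = S.cr x y := by
  obtain ⟨T, hT⟩ := hT
  choose! c hc using hT
  refine le_antisymm (cr_map_le hg.mapsTo hc hx hy) ?_
  have hinv := hg.invOn_invFunOn
  have hmaps := hg.surjOn.mapsTo_invFunOn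
  have := cr_map_le (S := S) (T := T.symm) (g := Function.invFunOn g S.dom)
    (c := fun z => (c (Function.invFunOn g S.dom z))⁻¹) hmaps (fun z hz => ?_)
    (hg.mapsTo hx) (hg.mapsTo hy)
  · rwa [hinv.1 hx, hinv.1 hy] at this
  · obtain ⟨h0, h1⟩ := hc _ (hmaps hz)
    refine ⟨inv_ne_zero h0, ?_⟩
    rw [hinv.2 hz] at h1
    rw [LinearEquiv.symm_apply_eq, map_smul, h1, inv_smul_smul₀ h0]

end FacetSystem

namespace FacetSystem

variable {ι : Type*} [Fintype ι] {n : ℕ}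

lemma lt_card [Nonempty ι] (S : FacetSystem (Euc n) ι) : n < Fintype.card ι := by
  have := LinearMap.finrank_le_finrank_of_injective S.lift_injective
  rw [Module.finrank_prod, finrank_euclideanSpace_fin, Module.finrank_self,
    Module.finrank_fintype_fun_eq_card] at this
  omega

lemma lift_surjective {E : Type*} [NormedAddCommGroup E] [NormedSpace ℝ E] (S : FacetSystem E ι)
    (h : ∀ μ : ι → ℝ, (∀ x, ∑ i, μ i * S.ev i x = 0) → μ = 0) : Function.Surjective S.lift := by
  classical
  rw [← LinearMap.range_eq_top]
  by_contra hne
  obtain ⟨φ, hφ, hle⟩ := Submodule.exists_le_ker_of_lt_top _ (lt_top_iff_ne_top.mpr hne)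
  have hsum : ∀ u : ι → ℝ, φ u = ∑ i, φ (Pi.single i 1) * u i := fun u => by
    conv_lhs => rw [pi_eq_sum_univ' u, map_sum]
    refine Finset.sum_congr rfl fun i _ => ?_
    rw [map_smul, smul_eq_mul, mul_comm]
  have h0 := h (fun i => φ (Pi.single i 1)) fun x => by
    have := hle ⟨(x, 1), rfl⟩
    rwa [LinearMap.mem_ker, hsum, lift_one] at this
  refine hφ (LinearMap.ext fun u => ?_)
  rw [hsum]
  simp only [congrFun h0, Pi.zero_apply, zero_mul, Finset.sum_const_zero, LinearMap.zero_apply]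

/-- If the affine functions of the facets are linearly independent, the polytope is a simplex. -/
theorem exists_simplex [Nonempty ι] (S : FacetSystem (Euc n) ι)
    (h : ∀ μ : ι → ℝ, (∀ x, ∑ i, μ i * S.ev i x = 0) → μ = 0) :
    ∃ w : Fin (n + 1) → Euc n, AffineIndependent ℝ w ∧
      closure S.dom = convexHull ℝ (Set.range w) := by
  classical
  let e := LinearEquiv.ofBijective S.lift ⟨S.lift_injective, S.lift_surjective h⟩
  have hcard : Fintype.card (Fin (n + 1)) = Fintype.card ι := by
    have := e.finrank_eq
    rw [Module.finrank_prod, finrank_euclideanSpace_fin, Module.finrank_self,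
      Module.finrank_fintype_fun_eq_card] at this
    rw [Fintype.card_fin, this]
  let r : Fin (n + 1) ≃ ι := Fintype.equivOfCardEq hcard
  choose w hw using fun i => S.lift_surjective h (Pi.single i 1)
  have hwk : ∀ i k, S.A k (w i).1 + S.b k * (w i).2 = Pi.single (M := fun _ => ℝ) i 1 k :=
    fun i k => by rw [← hw i, lift_apply]
  have hpos : ∀ i, 0 < (w i).2 := fun i => by
    by_contra! hle
    have hnn : ∀ k, 0 ≤ Pi.single (M := fun _ => ℝ) i 1 k := fun k => by
      by_cases hk : k = i
      · subst hk; simp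
      · simp [hk]
    have h2 : (w i).1 - (w i).2 • S.center = 0 := S.eq_zero_of_nonneg _ fun k => by
      have h3 := mul_nonneg (neg_nonneg.mpr hle) (S.ev_center k).le
      have h4 := hwk i k
      have h5 := hnn k
      simp only [ev, map_sub, map_smul, smul_eq_mul] at h3 ⊢
      linarith
    have h3 := hwk i i
    rw [sub_eq_zero.mp h2, map_smul, smul_eq_mul, Pi.single_eq_same] at h3
    have h4 := mul_nonneg (neg_nonneg.mpr hle) (S.ev_center i).le
    simp only [ev] at h4
    linarith
  set V : ι → Euc n := fun i => (w i).2⁻¹ • (w i).1 with hV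
  have hev : ∀ i k, S.ev k (V i) = Pi.single (M := fun _ => ℝ) i 1 k * (w i).2⁻¹ := fun i k => by
    have := (hpos i).ne'
    rw [← hwk, ev, hV, map_smul, smul_eq_mul]
    field_simp
  refine ⟨V ∘ r, ?_, ?_⟩
  · refine AffineIndependent.comp_embedding r.toEmbedding ?_
    rw [affineIndependent_iff]
    intro s c hc hcV i hi
    have h1 : ∑ k ∈ s, c k * S.ev i (V k) = 0 := by
      have := congrArg (S.A i) hcV
      simp only [map_sum, map_smul, smul_eq_mul, map_zero] at this
      simp only [ev, mul_add, Finset.sum_add_distrib, ← Finset.sum_mul, this, hc]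
      ring
    rw [Finset.sum_eq_single i, hev, Pi.single_eq_same, one_mul] at h1
    · exact (mul_eq_zero.mp h1).resolve_right (inv_ne_zero (hpos i).ne')
    · intro k _ hk
      rw [hev, Pi.single_eq_of_ne hk.symm]; ring
    · exact fun hn => absurd hi hn
  · rw [Set.range_comp, r.range_eq_univ, Set.image_univ]
    refine subset_antisymm (fun x hx => ?_) ?_
    · have hx0 := S.nonneg_of_mem_closure hx
      have h1 : ((x, 1) : Euc n × ℝ) = ∑ i, S.ev i x • w i := by
        refine S.lift_injective (funext fun k => ?_)
        rw [lift_one, map_sum, Finset.sum_apply]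
        simp [hw, Pi.single_apply]
      have h2 : ∑ i, S.ev i x * (w i).2 = 1 := by
        have := congrArg Prod.snd h1
        simpa [Prod.snd_sum] using this.symm
      have h3 : x = ∑ i, (S.ev i x * (w i).2) • V i := by
        have := congrArg Prod.fst h1
        simp only [Prod.fst_sum, Prod.smul_fst] at this
        rw [this]
        refine Finset.sum_congr rfl fun i _ => ?_
        rw [← this, hV, smul_smul, mul_inv_cancel_right₀ (hpos i).ne']
      rw [h3]
      exact (convex_convexHull ℝ _).sum_mem (fun i _ => mul_nonneg (hx0 i) (hpos i).le) h2
        fun i _ => subset_convexHull ℝ _ ⟨i, rfl⟩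
    · refine convexHull_min ?_ (fun x hx y hy a b ha hb hab => S.mem_closure_dom fun k => ?_)
      · rintro _ ⟨i, rfl⟩
        refine S.mem_closure_dom fun k => ?_
        rw [hev]
        refine mul_nonneg ?_ (inv_nonneg.mpr (hpos i).le)
        by_cases hk : k = i
        · subst hk; simp
        · simp [hk]
      · have h1 := mul_nonneg ha (S.nonneg_of_mem_closure hx k)
        have h2 := mul_nonneg hb (S.nonneg_of_mem_closure hy k)
        have : S.ev k (a • x + b • y) = a * S.ev k x + b * S.ev k y := by
          simp only [ev, map_add, map_smul, smul_eq_mul]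
          linear_combination (-S.b k) * hab
        rw [this]
        exact add_nonneg h1 h2

end FacetSystem

section Polar

variable {E : Type*} [NormedAddCommGroup E] [NormedSpace ℝ E]

/-- The polar of a set with respect to a base point. -/
def polarAt (F : Set E) (o : E) : Set (E →L[ℝ] ℝ) := {φ | ∀ v ∈ F, φ (v - o) ≤ 1}

lemma convex_polarAt (F : Set E) (o : E) : Convex ℝ (polarAt F o) := by
  intro φ hφ ψ hψ a b ha hb hab v hv
  have h1 := mul_le_mul_of_nonneg_left (hφ v hv) ha
  have h2 := mul_le_mul_of_nonneg_left (hψ v hv) hb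
  simp only [add_apply, smul_apply, smul_eq_mul]
  linarith

lemma isClosed_polarAt (F : Set E) (o : E) : IsClosed (polarAt F o) := by
  have : polarAt F o = ⋂ v ∈ F, {φ : E →L[ℝ] ℝ | φ (v - o) ≤ 1} := by ext; simp [polarAt]
  rw [this]
  exact isClosed_biInter fun v _ => isClosed_le (by fun_prop) continuous_const

lemma le_one_of_mem_polarAt {F : Set E} {o : E} {φ : E →L[ℝ] ℝ} (hφ : φ ∈ polarAt F o) {x : E}
    (hx : x ∈ convexHull ℝ F) : φ (x - o) ≤ 1 := by
  refine convexHull_min (t := {x | φ (x - o) ≤ 1}) hφ (fun x hx y hy a b ha hb hab => ?_) hx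
  have h1 := mul_le_mul_of_nonneg_left hx ha
  have h2 := mul_le_mul_of_nonneg_left hy hb
  have e : a • x + b • y - o = a • (x - o) + b • (y - o) := by
    rw [← sub_eq_zero]
    have : o = (a + b) • o := by rw [hab, one_smul]
    nth_rw 1 [this]
    module
  simp only [mem_ofPred_eq, e, map_add, map_smul, smul_eq_mul]
  linarith

lemma lt_one_of_mem_polarAt {F : Set E} {o : E} {φ : E →L[ℝ] ℝ} (hφ : φ ∈ polarAt F o) {x : E}
    (hx : x ∈ interior (convexHull ℝ F)) : φ (x - o) < 1 := by
  have hc : Tendsto (fun t : ℝ => x + t • (x - o)) (𝓝[>] 0) (𝓝 x) := by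
    have : Continuous fun t : ℝ => x + t • (x - o) := by fun_prop
    simpa using (this.tendsto 0).mono_left nhdsWithin_le_nhds
  obtain ⟨t, ht, ht0⟩ := ((hc.eventually (isOpen_interior.mem_nhds hx)).and
    self_mem_nhdsWithin).exists
  have ht0 : (0 : ℝ) < t := ht0
  have h1 := le_one_of_mem_polarAt hφ (interior_subset ht)
  have e : x + t • (x - o) - o = (1 + t) • (x - o) := by module
  rw [e, map_smul, smul_eq_mul] at h1
  by_contra! hge
  nlinarith

lemma isBounded_polarAt {F : Set E} {o : E} (ho : o ∈ interior (convexHull ℝ F)) :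
    Bornology.IsBounded (polarAt F o) := by
  obtain ⟨ε, hε, hball⟩ := Metric.mem_nhds_iff.mp (mem_interior_iff_mem_nhds.mp ho)
  have key : ∀ φ ∈ polarAt F o, ∀ u : E, φ u ≤ 2 / ε * ‖u‖ := fun φ hφ u => by
    by_cases hu : u = 0
    · simp [hu]
    have hu0 : 0 < ‖u‖ := norm_pos_iff.mpr hu
    have h1 : o + (ε / 2 / ‖u‖) • u ∈ Metric.ball o ε := by
      rw [mem_ball_iff_norm, add_sub_cancel_left, norm_smul, Real.norm_of_nonneg (by positivity),
        div_mul_cancel₀ _ hu0.ne']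
      linarith
    have h2 := le_one_of_mem_polarAt hφ (hball h1)
    rw [add_sub_cancel_left, map_smul, smul_eq_mul] at h2
    have h3 : 0 < ε / 2 / ‖u‖ := by positivity
    refine le_of_mul_le_mul_left (h2.trans_eq ?_) h3
    field_simp
  refine (Metric.isBounded_closedBall (x := (0 : E →L[ℝ] ℝ)) (r := 2 / ε)).subset fun φ hφ => ?_
  rw [mem_closedBall_zero_iff]
  refine φ.opNorm_le_bound (by positivity) fun u => abs_le.mpr ⟨?_, key φ hφ u⟩
  have := key φ hφ (-u)
  rw [map_neg, norm_neg] at this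
  linarith

lemma finite_extremePoints_polarAt (F : Finset E) (o : E) :
    ((polarAt (F : Set E) o).extremePoints ℝ).Finite := by
  classical
  let act : (E →L[ℝ] ℝ) → Finset E := fun φ => F.filter fun v => φ (v - o) = 1
  refine Set.Finite.of_injOn (f := act) (t := (F.powerset : Set (Finset E)))
    (fun φ _ => Finset.mem_coe.mpr
      (Finset.mem_powerset.mpr (Finset.filter_subset _ _))) (fun φ hφ ψ hψ h => ?_) (Finset.finite_toSet _)
  have hev : ∀ᶠ t : ℝ in 𝓝 0, ∀ v ∈ F, (φ + t • (ψ - φ)) (v - o) ≤ 1 := by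
    refine (Filter.eventually_all_finset F).mpr fun v hv => ?_
    by_cases hact : φ (v - o) = 1
    · have h1 : v ∈ act ψ := h ▸ (Finset.mem_filter.mpr ⟨hv, hact⟩ : v ∈ act φ)
      have h2 := (Finset.mem_filter.mp h1).2
      refine .of_forall fun t => ?_
      simp [hact, h2]
    · have hlt := lt_of_le_of_ne (hφ.1 v hv) hact
      have hc : Continuous fun t : ℝ => (φ + t • (ψ - φ)) (v - o) := by
        simp only [add_apply, smul_apply]
        fun_prop
      have := (hc.tendsto 0).eventually_lt_const (u := 1) (by simpa using hlt)
      exact this.mono fun t ht => ht.le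
  obtain ⟨ε, hε, hball⟩ := Metric.eventually_nhds_iff.mp hev
  have hp : ∀ t : ℝ, |t| < ε → φ + t • (ψ - φ) ∈ polarAt (F : Set E) o := fun t ht =>
    hball (by simpa using ht)
  have h1 := hp (ε / 2) (by rw [abs_of_pos (by linarith)]; linarith)
  have h2 := hp (-(ε / 2)) (by rw [abs_neg, abs_of_pos (by linarith)]; linarith)
  have h3 := (mem_extremePoints.mp hφ).2 _ h1 _ h2
    ⟨1 / 2, 1 / 2, by norm_num, by norm_num, by norm_num, by module⟩
  have h4 : (ε / 2) • (ψ - φ) = 0 := by simpa using h3.1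
  exact (sub_eq_zero.mp ((smul_eq_zero.mp h4).resolve_left (by positivity))).symm

variable [FiniteDimensional ℝ E]

/-- The interior of a polytope is a finite intersection of open half-spaces. -/
lemma exists_finset_interior_convexHull (F : Finset E) {o : E}
    (ho : o ∈ interior (convexHull ℝ (F : Set E))) :
    ∃ G : Finset (E →L[ℝ] ℝ), ∀ x,
      x ∈ interior (convexHull ℝ (F : Set E)) ↔ ∀ φ ∈ G, φ (x - o) < 1 := by
  set K := polarAt (F : Set E) o with hK
  set P := convexHull ℝ (F : Set E) with hP
  have hfin := finite_extremePoints_polarAt F o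
  have : ProperSpace (E →L[ℝ] ℝ) := FiniteDimensional.proper_real _
  have hKc : IsCompact K := Metric.isCompact_of_isClosed_isBounded (isClosed_polarAt _ _)
    (isBounded_polarAt ho)
  have hKG : K = convexHull ℝ (K.extremePoints ℝ) := by
    rw [← (hfin.isClosed_convexHull ℝ).closure_eq]
    exact (closure_convexHull_extremePoints hKc (convex_polarAt _ _)).symm
  refine ⟨hfin.toFinset, fun x => ⟨fun hx φ hφ => ?_, fun hx => ?_⟩⟩
  · exact lt_one_of_mem_polarAt (extremePoints_subset (hfin.mem_toFinset.mp hφ)) hx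
  · by_contra hxP
    have hconv : Convex ℝ P := convex_convexHull ℝ _
    obtain ⟨f, hf⟩ := geometric_hahn_banach_open_point hconv.interior isOpen_interior hxP
    have hs : 0 < f x - f o := sub_pos.mpr (hf o ho)
    have hfK : (f x - f o)⁻¹ • f ∈ K := fun v hv => by
      have hcl : v ∈ closure (interior P) := by
        rw [hconv.closure_interior_eq_closure_of_nonempty_interior ⟨o, ho⟩]
        exact subset_closure (subset_convexHull ℝ _ hv)
      have : f v ≤ f x := closure_minimal (t := {y | f y ≤ f x}) (fun y hy => (hf y hy).le)
        (isClosed_le f.continuous continuous_const) hcl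
      rw [smul_apply, smul_eq_mul, map_sub, inv_mul_le_iff₀ hs]
      linarith
    have hlt : ∀ φ ∈ K, φ (x - o) < 1 := fun φ hφ => by
      rw [hKG] at hφ
      refine convexHull_min (t := {φ : E →L[ℝ] ℝ | φ (x - o) < 1})
        (fun φ hφ => hx φ (hfin.mem_toFinset.mpr hφ)) ?_ hφ
      exact convex_halfSpace_lt ⟨fun _ _ => rfl, fun _ _ => rfl⟩ 1
    have := hlt _ hfK
    rw [smul_apply, smul_eq_mul, map_sub, inv_mul_cancel₀ hs.ne'] at this
    exact lt_irrefl _ this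

/-- The interior of a polytope is the domain of a facet system. -/
theorem exists_facetSystem (F : Finset E) {o : E}
    (ho : o ∈ interior (convexHull ℝ (F : Set E))) :
    ∃ (G : Finset (E →L[ℝ] ℝ)) (S : FacetSystem E G),
      S.dom = interior (convexHull ℝ (F : Set E)) := by
  classical
  obtain ⟨G, hG⟩ := exists_minimal_of_wellFoundedLT _ (exists_finset_interior_convexHull F ho)
  have hbd : Bornology.IsBounded (convexHull ℝ (F : Set E)) :=
    (F.finite_toSet.isCompact_convexHull ℝ).isBounded
  have hpt : ∀ w : G, ∃ p : E, w.1 (p - o) = 1 ∧ ∀ φ ∈ G, φ ≠ w.1 → φ (p - o) < 1 := fun w => by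
    have hnot := hG.not_prop_of_lt (Finset.erase_ssubset w.2)
    obtain ⟨z, hz⟩ := not_forall.mp hnot
    have hz1 : ∀ φ ∈ G.erase w.1, φ (z - o) < 1 := by
      by_contra hcon
      refine hz (iff_of_false (fun hzi => hcon fun φ hφ => ?_) hcon)
      exact (hG.prop z).mp hzi φ (Finset.mem_of_mem_erase hφ)
    have hz2 : 1 ≤ w.1 (z - o) := by
      by_contra! hlt
      refine hz (iff_of_true ((hG.prop z).mpr fun φ hφ => ?_) hz1)
      by_cases hw : φ = w.1
      · rwa [hw]
      · exact hz1 φ (Finset.mem_erase.mpr ⟨hw, hφ⟩)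
    have hs : 0 < w.1 (z - o) := zero_lt_one.trans_le hz2
    refine ⟨o + (w.1 (z - o))⁻¹ • (z - o), ?_, fun φ hφ hne => ?_⟩
    · rw [add_sub_cancel_left, map_smul, smul_eq_mul, inv_mul_cancel₀ hs.ne']
    · rw [add_sub_cancel_left, map_smul, smul_eq_mul, inv_mul_lt_iff₀ hs, mul_one]
      exact (hz1 φ (Finset.mem_erase.mpr ⟨hne, hφ⟩)).trans_le hz2
  choose p hp1 hp2 using hpt
  have he : ∀ (φ : E →L[ℝ] ℝ) (x : E), (-φ) x + (1 + φ o) = 1 - φ (x - o) := fun φ x => by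
    rw [neg_apply, map_sub]; ring
  refine ⟨G, ⟨fun φ => -φ.1, fun φ => 1 + φ.1 o, o, p, fun φ => ?_, fun φ => ?_, fun φ ψ h => ?_,
    fun v hv => ?_⟩, ?_⟩
  · rw [he]; simp
  · rw [he, hp1, sub_self]
  · rw [he, sub_pos]
    exact hp2 φ ψ.1 ψ.2 fun h' => h (Subtype.ext h')
  · by_contra hv0
    obtain ⟨R, hR⟩ := hbd.subset_closedBall o
    have hR0 : 0 ≤ R := by
      have := hR (interior_subset ho)
      simpa using this
    have hv1 : 0 < ‖v‖ := norm_pos_iff.mpr hv0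
    have hmem : o + ((R + 1) / ‖v‖) • v ∈ interior (convexHull ℝ (F : Set E)) :=
      (hG.prop _).mpr fun φ hφ => by
        have h1 := hv ⟨φ, hφ⟩
        simp only [neg_apply] at h1
        have h2 : 0 ≤ (R + 1) / ‖v‖ := by positivity
        rw [add_sub_cancel_left, map_smul, smul_eq_mul]
        nlinarith
    have h3 := hR (interior_subset hmem)
    rw [mem_closedBall_iff_norm, add_sub_cancel_left, norm_smul,
      Real.norm_of_nonneg (by positivity), div_mul_cancel₀ _ hv1.ne'] at h3
    linarith
  · ext x
    rw [hG.prop x]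
    refine ⟨fun hx φ hφ => ?_, fun hx φ => ?_⟩
    · have := hx ⟨φ, hφ⟩
      simp only [FacetSystem.ev, he] at this
      linarith
    · have := hx φ.1 φ.2
      simp only [FacetSystem.ev, he]
      linarith

end Polar

lemma FacetSystem.cr_map_of_dist {ι : Type*} [Fintype ι] [Nonempty ι] {n : ℕ}
    (S : FacetSystem (Euc n) ι) {d : Euc n → Euc n → ℝ} (hd : IsHilbertDist S.dom d)
    {p q p' q' : Euc n} (hp : p ∈ S.dom) (hq : q ∈ S.dom) (hp' : p' ∈ S.dom) (hq' : q' ∈ S.dom)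
    (h : d p q = d p' q') : S.cr p q = S.cr p' q' := by
  rw [S.hilbertDist_eq hd hp hq, S.hilbertDist_eq hd hp' hq'] at h
  exact Real.log_injOn_pos (S.cr_pos hp hq) (S.cr_pos hp' hq') (by linarith)

/-- **Lemmens–Walsh.** Let `P ⊆ ℝⁿ` (`n ≥ 2`) be a bounded convex polytope with non-empty
interior which is not a simplex.  Then every isometry of the Hilbert geometry `(int P, d_P)`
onto itself is the restriction of a projective transformation of `ℝPⁿ` mapping `int P` onto
itself; conversely every such projective transformation restricts to an isometry.  Hence the
isometry group of `(int P, d_P)` coincides with the group of collineations preserving `P`. -/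
theorem isometries_of_nonsimplex_polytope_are_collineations {n : ℕ} (hn : 2 ≤ n)
    (F : Finset (Euc n)) (P : Set (Euc n)) (hP : P = convexHull ℝ (↑F : Set (Euc n)))
    (hint : (interior P).Nonempty)
    (hnotsimplex : ¬ ∃ w : Fin (n + 1) → Euc n,
      AffineIndependent ℝ w ∧ P = convexHull ℝ (Set.range w))
    (d : Euc n → Euc n → ℝ) (hd : IsHilbertDist (interior P) d) :
    (∀ f : Euc n → Euc n, Set.BijOn f (interior P) (interior P) →
      (∀ x ∈ interior P, ∀ y ∈ interior P, d (f x) (f y) = d x y) →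
      ∃ T : (Fin (n + 1) → ℝ) ≃ₗ[ℝ] (Fin (n + 1) → ℝ),
        ∀ x ∈ interior P, ∃ c : ℝ, c ≠ 0 ∧ T (projLift x) = c • projLift (f x)) ∧
    (∀ (T : (Fin (n + 1) → ℝ) ≃ₗ[ℝ] (Fin (n + 1) → ℝ)) (g : Euc n → Euc n),
      Set.BijOn g (interior P) (interior P) →
      (∀ x ∈ interior P, ∃ c : ℝ, c ≠ 0 ∧ T (projLift x) = c • projLift (g x)) →
      ∀ x ∈ interior P, ∀ y ∈ interior P, d (g x) (g y) = d x y) := by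
  subst hP
  set P := convexHull ℝ (F : Set (Euc n)) with hP
  obtain ⟨o, ho⟩ := hint
  obtain ⟨G, S, hS⟩ := exists_facetSystem F ho
  have : Nonempty (Fin n) := ⟨⟨0, by omega⟩⟩
  have hG : Nonempty G := S.nonempty_index
  rw [← hS] at hd ⊢
  refine ⟨fun f hf hiso => ?_, fun T g hg hT x hx y hy => ?_⟩
  · have hrel : ∃ μ : G → ℝ, (∀ x, ∑ i, μ i * S.ev i x = 0) ∧ μ ≠ 0 := by
      by_contra! hno
      obtain ⟨w, hw, hcl⟩ := S.exists_simplex hno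
      refine hnotsimplex ⟨w, hw, ?_⟩
      rw [← hcl, hS, (convex_convexHull ℝ _).closure_interior_eq_closure_of_nonempty_interior
        ⟨o, ho⟩, (F.finite_toSet.isClosed_convexHull ℝ).closure_eq]
    obtain ⟨μ, hμ, hμ0⟩ := hrel
    have hcard : 2 < Fintype.card G := hn.trans_lt S.lt_card
    have hmaps := hf.surjOn.mapsTo_invFunOn
    have hinv := hf.invOn_invFunOn
    have h : S.IsIsom f (Function.invFunOn f S.dom) :=
      ⟨hf.mapsTo, hmaps, hinv.1, hinv.2, fun x hx y hy => S.cr_map_of_dist hd (hf.mapsTo hx)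
        (hf.mapsTo hy) hx hy (hiso x hx y hy)⟩
    exact exists_projective_of_prod (h.exists_linearEquiv hcard hμ0 hμ)
  · rw [S.hilbertDist_eq hd (hg.mapsTo hx) (hg.mapsTo hy), S.hilbertDist_eq hd hx hy,
      FacetSystem.cr_map_of_projective hg (exists_prod_of_projective hT) hx hy]
end
end
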